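/- arXiv:1408.1491 — 2 statements merged into one kernel-verified Lean document; each statement's English description precedes it below -/
import Mathlib

section
/- Let 𝔤 be a finite-dimensional Lie algebra over the field ℂ of complex numbers satisfying the condition 𝒜(n), i.e. every abelian Lie subalgebra of 𝔤 has dimension at most n. Then 2 · dim 𝔤 ≤ n² + 17n. -/
section

open scoped RealInnerProductSpace

/-- A finite crystallographic root system in a real inner product space, as a set of vectors
(not required to span). -/
structure IsRootFinset {E : Type*} [NormedAddCommGroup E] [InnerProductSpace ℝ E]
    (Φ : Finset E) : Prop where
  zero_notMem : (0 : E) ∉ Φ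
  exists_int : ∀ α ∈ Φ, ∀ β ∈ Φ, ∃ z : ℤ, 2 * ⟪α, β⟫ = z * ⟪β, β⟫ ∧ α - z • β ∈ Φ

/-- The Cartan integer `2⟪x, y⟫ / ⟪y, y⟫` (rounded when it is not an integer). -/
noncomputable def cartanInt {E : Type*} [NormedAddCommGroup E] [InnerProductSpace ℝ E]
    (x y : E) : ℤ := round (2 * ⟪x, y⟫ / ⟪y, y⟫)

/-- A maximal family of pairwise orthogonal roots, with long roots preferred. -/
structure IsOrthFrame {E : Type*} [NormedAddCommGroup E] [InnerProductSpace ℝ E]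
    (Φ B : Finset E) : Prop where
  subset : B ⊆ Φ
  orth : ∀ b ∈ B, ∀ b' ∈ B, b ≠ b' → ⟪b, b'⟫ = 0
  dominates : ∀ α ∈ Φ, ∃ b ∈ B, ⟪α, b⟫ ≠ 0 ∧ ⟪α, α⟫ ≤ ⟪b, b⟫

namespace IsRootFinset

variable {E : Type*} [NormedAddCommGroup E] [InnerProductSpace ℝ E] {Φ B : Finset E}

lemma inner_self_pos (h : IsRootFinset Φ) {β : E} (hβ : β ∈ Φ) : 0 < ⟪β, β⟫ := by
  have : β ≠ 0 := fun h0 => h.zero_notMem (h0 ▸ hβ)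
  exact real_inner_self_pos.mpr this

lemma cartanInt_eq (h : IsRootFinset Φ) {α β : E} {z : ℤ} (hβ : β ∈ Φ)
    (hz : 2 * ⟪α, β⟫ = z * ⟪β, β⟫) : cartanInt α β = z := by
  have := h.inner_self_pos hβ
  rw [cartanInt, hz, mul_div_assoc, div_self this.ne', mul_one, round_intCast]

lemma cartanInt_mul (h : IsRootFinset Φ) {α β : E} (hα : α ∈ Φ) (hβ : β ∈ Φ) :
    (cartanInt α β : ℝ) * ⟪β, β⟫ = 2 * ⟪α, β⟫ := by
  obtain ⟨z, hz, -⟩ := h.exists_int α hα β hβ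
  rw [h.cartanInt_eq hβ hz, hz]

lemma sub_cartanInt_smul_mem (h : IsRootFinset Φ) {α β : E} (hα : α ∈ Φ) (hβ : β ∈ Φ) :
    α - cartanInt α β • β ∈ Φ := by
  obtain ⟨z, hz, hm⟩ := h.exists_int α hα β hβ
  rwa [h.cartanInt_eq hβ hz]

lemma cartanInt_self (h : IsRootFinset Φ) {β : E} (hβ : β ∈ Φ) : cartanInt β β = 2 :=
  h.cartanInt_eq hβ (by push_cast; ring)

lemma neg_mem (h : IsRootFinset Φ) {β : E} (hβ : β ∈ Φ) : -β ∈ Φ := by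
  have := h.sub_cartanInt_smul_mem hβ hβ
  rw [h.cartanInt_self hβ] at this
  convert this using 1
  rw [two_smul]; abel

lemma cartanInt_add (h : IsRootFinset Φ) {α α' β : E} (hα : α ∈ Φ) (hα' : α' ∈ Φ)
    (hβ : β ∈ Φ) : cartanInt (α + α') β = cartanInt α β + cartanInt α' β := by
  apply h.cartanInt_eq hβ
  have h1 := h.cartanInt_mul hα hβ
  have h2 := h.cartanInt_mul hα' hβ
  rw [inner_add_left]; push_cast; linarith

lemma cartanInt_sub (h : IsRootFinset Φ) {α α' β : E} (hα : α ∈ Φ) (hα' : α' ∈ Φ)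
    (hβ : β ∈ Φ) : cartanInt (α - α') β = cartanInt α β - cartanInt α' β := by
  apply h.cartanInt_eq hβ
  have h1 := h.cartanInt_mul hα hβ
  have h2 := h.cartanInt_mul hα' hβ
  rw [inner_sub_left]; push_cast; linarith

lemma cartanInt_pos_iff (h : IsRootFinset Φ) {α β : E} (hα : α ∈ Φ) (hβ : β ∈ Φ) :
    0 < cartanInt α β ↔ 0 < ⟪α, β⟫ := by
  have h1 := h.cartanInt_mul hα hβ
  have h2 := h.inner_self_pos hβ
  rw [← Int.cast_pos (R := ℝ), ← mul_pos_iff_of_pos_right h2, h1]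
  constructor <;> intro <;> linarith

lemma cartanInt_eq_zero_iff (h : IsRootFinset Φ) {α β : E} (hα : α ∈ Φ) (hβ : β ∈ Φ) :
    cartanInt α β = 0 ↔ ⟪α, β⟫ = 0 := by
  have h1 := h.cartanInt_mul hα hβ
  have h2 := h.inner_self_pos hβ
  constructor
  · intro h0; rw [h0] at h1; simpa using h1.symm
  · intro h0; 
    rw [h0, mul_zero, mul_eq_zero] at h1
    exact_mod_cast h1.resolve_right h2.ne'

lemma sub_mem (h : IsRootFinset Φ) {α β : E} (hα : α ∈ Φ) (hβ : β ∈ Φ) (hne : α ≠ β)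
    (hpos : 0 < ⟪α, β⟫) : α - β ∈ Φ := by
  have p1 := h.cartanInt_mul hα hβ
  have p2 := h.cartanInt_mul hβ hα
  have q1 := (h.cartanInt_pos_iff hα hβ).2 hpos
  have q2 := (h.cartanInt_pos_iff hβ hα).2 (by rwa [real_inner_comm])
  have a1 := h.inner_self_pos hα
  have a2 := h.inner_self_pos hβ
  have m1 := h.sub_cartanInt_smul_mem hα hβ
  have m2 := h.sub_cartanInt_smul_mem hβ hα
  rw [real_inner_comm α β] at p2
  set p := cartanInt α β
  set q := cartanInt β α
  have hd : 0 < ⟪α - β, α - β⟫ := real_inner_self_pos.mpr (sub_ne_zero.mpr hne)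
  have hd' : ⟪α - β, α - β⟫ = ⟪α, α⟫ - 2 * ⟪α, β⟫ + ⟪β, β⟫ := by
    rw [inner_sub_left, inner_sub_right, inner_sub_right, real_inner_comm α β]; ring
  rw [hd'] at hd
  by_cases hp : p = 1
  · simpa [hp] using m1
  by_cases hq : q = 1
  · simpa [hq] using h.neg_mem m2
  exfalso
  have hp2 : (2 : ℝ) ≤ p := by exact_mod_cast (by omega : (2 : ℤ) ≤ p)
  have hq2 : (2 : ℝ) ≤ q := by exact_mod_cast (by omega : (2 : ℤ) ≤ q)
  nlinarith

open Classical in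
lemma exists_orthFrame (h : IsRootFinset Φ) : ∃ B, IsOrthFrame Φ B := by
  have key : ∀ Ψ : Finset E, Ψ ⊆ Φ → ∃ B, IsOrthFrame Ψ B := by
    intro Ψ
    induction Ψ using Finset.induction_on_min_value (fun x : E => ⟪x, x⟫) with
    | empty => exact fun _ => ⟨∅, by simp, by simp, by simp⟩
    | insert a s ha hmin ih =>
      intro hs
      obtain ⟨B, hB⟩ := ih (fun x hx => hs (Finset.mem_insert_of_mem hx))
      by_cases hc : ∃ b ∈ B, ⟪a, b⟫ ≠ 0
      · obtain ⟨b, hb, hab⟩ := hc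
        refine ⟨B, hB.subset.trans (Finset.subset_insert _ _), hB.orth, ?_⟩
        intro α hα
        rcases Finset.mem_insert.mp hα with rfl | hα
        · exact ⟨b, hb, hab, hmin b (hB.subset hb)⟩
        · exact hB.dominates α hα
      · push Not at hc
        refine ⟨insert a B, Finset.insert_subset_insert _ hB.subset, ?_, ?_⟩
        · intro b hb b' hb' hne
          rcases Finset.mem_insert.mp hb with rfl | hb₁ <;>
            rcases Finset.mem_insert.mp hb' with rfl | hb₂
          · exact absurd rfl hne
          · exact hc b' hb₂
          · rw [real_inner_comm]; exact hc b hb₁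
          · exact hB.orth b hb₁ b' hb₂ hne
        · intro α hα
          rcases Finset.mem_insert.mp hα with rfl | hα
          · exact ⟨α, Finset.mem_insert_self _ _,
              (h.inner_self_pos (hs (Finset.mem_insert_self _ _))).ne', le_rfl⟩
          · obtain ⟨b, hb, h1, h2⟩ := hB.dominates α hα
            exact ⟨b, Finset.mem_insert_of_mem hb, h1, h2⟩
  exact key Φ subset_rfl

end IsRootFinset

end

section

open scoped RealInnerProductSpace

namespace IsRootFinset

variable {E : Type*} [NormedAddCommGroup E] [InnerProductSpace ℝ E] {Φ B : Finset E}

/-- The `ℓ¹`-norm of the vector of Cartan integers of `x` against `B`. -/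
noncomputable def cartanLength (B : Finset E) (x : E) : ℤ := ∑ b ∈ B, |cartanInt x b|

open Classical in
/-- The members of `B` against which `x` has a nonzero Cartan integer. -/
noncomputable def cartanSupport (B : Finset E) (x : E) : Finset E :=
  {b ∈ B | cartanInt x b ≠ 0}

/-- Twice the component of `x` orthogonal to `B`, for `B` an orthogonal family. -/
noncomputable def defect (B : Finset E) (x : E) : E := (2 : ℝ) • x - ∑ b ∈ B, (cartanInt x b : ℝ) • b

lemma mem_cartanSupport {x b : E} : b ∈ cartanSupport B x ↔ b ∈ B ∧ cartanInt x b ≠ 0 := by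
  classical
  simp [cartanSupport]

lemma cartanSupport_subset (x : E) : cartanSupport B x ⊆ B := fun _ hb =>
  (mem_cartanSupport.1 hb).1

lemma inner_defect_self (h : IsRootFinset Φ) (hB : IsOrthFrame Φ B) {α : E} (hα : α ∈ Φ) :
    ⟪defect B α, defect B α⟫ =
      (4 - ∑ b ∈ B, (cartanInt α b : ℝ) * cartanInt b α) * ⟪α, α⟫ := by
  have e1 : ∀ b ∈ B, (cartanInt α b : ℝ) * ⟪α, b⟫ =
      (cartanInt α b : ℝ) * cartanInt b α * ⟪α, α⟫ / 2 := by
    intro b hb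
    have := h.cartanInt_mul (hB.subset hb) hα
    rw [real_inner_comm α b] at this
    linear_combination (-(cartanInt α b : ℝ) / 2) * this
  have e2 : ⟪∑ b ∈ B, (cartanInt α b : ℝ) • b, ∑ b ∈ B, (cartanInt α b : ℝ) • b⟫ =
      2 * ∑ b ∈ B, (cartanInt α b : ℝ) * ⟪α, b⟫ := by
    rw [sum_inner, Finset.mul_sum]
    refine Finset.sum_congr rfl fun b hb => ?_
    rw [inner_sum, Finset.sum_eq_single_of_mem b hb]
    · rw [real_inner_smul_left, real_inner_smul_right]
      have := h.cartanInt_mul hα (hB.subset hb)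
      linear_combination (cartanInt α b : ℝ) * this
    · intro b' hb' hne
      rw [real_inner_smul_left, real_inner_smul_right, hB.orth b hb b' hb' hne.symm]
      simp
  have e3 : ⟪α, ∑ b ∈ B, (cartanInt α b : ℝ) • b⟫ = ∑ b ∈ B, (cartanInt α b : ℝ) * ⟪α, b⟫ := by
    rw [inner_sum]
    exact Finset.sum_congr rfl fun b hb => real_inner_smul_right _ _ _
  have e3' : ⟪∑ b ∈ B, (cartanInt α b : ℝ) • b, α⟫ = ∑ b ∈ B, (cartanInt α b : ℝ) * ⟪α, b⟫ :=
    (real_inner_comm _ _).trans e3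
  have e4 : ∑ b ∈ B, (cartanInt α b : ℝ) * ⟪α, b⟫ =
      (∑ b ∈ B, (cartanInt α b : ℝ) * cartanInt b α) * ⟪α, α⟫ / 2 := by
    rw [Finset.sum_congr rfl e1, Finset.sum_mul, Finset.sum_div]
  rw [defect, inner_sub_left, inner_sub_right, inner_sub_right, e2, real_inner_smul_left,
    real_inner_smul_left, real_inner_smul_right, real_inner_smul_right, e3,
    e3', e4]
  ring

lemma sum_cartanInt_mul_le (h : IsRootFinset Φ) (hB : IsOrthFrame Φ B) {α : E} (hα : α ∈ Φ) :
    ∑ b ∈ B, cartanInt α b * cartanInt b α ≤ 4 := by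
  have h1 := h.inner_defect_self hB hα
  have h2 : 0 ≤ ⟪defect B α, defect B α⟫ := real_inner_self_nonneg
  have h3 := h.inner_self_pos hα
  rw [h1] at h2
  have := nonneg_of_mul_nonneg_left h2 h3
  have : ((∑ b ∈ B, cartanInt α b * cartanInt b α : ℤ) : ℝ) ≤ 4 := by push_cast; linarith
  exact_mod_cast this

lemma abs_cartanInt_le (h : IsRootFinset Φ) {α β : E} (hα : α ∈ Φ) (hβ : β ∈ Φ) :
    |cartanInt α β| ≤ cartanInt α β * cartanInt β α := by
  have c1 := h.cartanInt_pos_iff hα hβ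
  have c2 := h.cartanInt_pos_iff hβ hα
  have z1 := h.cartanInt_eq_zero_iff hα hβ
  have z2 := h.cartanInt_eq_zero_iff hβ hα
  rw [real_inner_comm] at c2 z2
  have c := c1.trans c2.symm
  have z := z1.trans z2.symm
  rcases lt_trichotomy (cartanInt α β) 0 with hp | hp | hp
  · have : cartanInt β α < 0 := by
      have a1 : ¬ 0 < cartanInt β α := fun hh => by have := c.2 hh; omega
      have a2 : cartanInt β α ≠ 0 := fun hh => by have := z.2 hh; omega
      omega
    rw [abs_of_neg hp]; nlinarith
  · simp [hp]
  · have := c.1 hp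
    rw [abs_of_pos hp]; nlinarith

lemma cartanLength_le (h : IsRootFinset Φ) (hB : IsOrthFrame Φ B) {α : E} (hα : α ∈ Φ) :
    cartanLength B α ≤ 4 :=
  (Finset.sum_le_sum fun _ hb => h.abs_cartanInt_le hα (hB.subset hb)).trans
    (h.sum_cartanInt_mul_le hB hα)

lemma defect_eq_zero (h : IsRootFinset Φ) (hB : IsOrthFrame Φ B) {α : E} (hα : α ∈ Φ)
    (h4 : cartanLength B α = 4) : defect B α = 0 := by
  have h1 : ∑ b ∈ B, cartanInt α b * cartanInt b α = 4 :=
    le_antisymm (h.sum_cartanInt_mul_le hB hα)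
      (h4.symm.trans_le (Finset.sum_le_sum fun _ hb => h.abs_cartanInt_le hα (hB.subset hb)))
  have h1' : ∑ b ∈ B, (cartanInt α b : ℝ) * cartanInt b α = 4 := by exact_mod_cast h1
  have := h.inner_defect_self hB hα
  rw [h1'] at this
  exact inner_self_eq_zero.1 (this.trans (by ring))

lemma abs_cartanInt_eq_one (h : IsRootFinset Φ) (hB : IsOrthFrame Φ B) {α b : E} (hα : α ∈ Φ)
    (h4 : cartanLength B α = 4) (hb : b ∈ B) (h0 : cartanInt α b ≠ 0) :
    |cartanInt b α| = 1 := by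
  have hle : ∀ b ∈ B, |cartanInt α b| ≤ cartanInt α b * cartanInt b α := fun _ hb =>
    h.abs_cartanInt_le hα (hB.subset hb)
  have h1 : ∑ b ∈ B, |cartanInt α b| = ∑ b ∈ B, cartanInt α b * cartanInt b α :=
    le_antisymm (Finset.sum_le_sum hle) ((h.sum_cartanInt_mul_le hB hα).trans h4.ge)
  have h2 := (Finset.sum_eq_sum_iff_of_le hle).1 h1 b hb
  have h3 : |cartanInt α b| = |cartanInt α b| * |cartanInt b α| := by
    rw [← abs_mul, ← h2, abs_abs]
  have h5 : |cartanInt α b| ≠ 0 := by simpa using h0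
  have : |cartanInt α b| * (|cartanInt b α| - 1) = 0 := by linear_combination -h3
  rcases mul_eq_zero.1 this with h6 | h6
  · exact absurd h6 h5
  · omega

lemma cartanSupport_nonempty (h : IsRootFinset Φ) (hB : IsOrthFrame Φ B) {α : E} (hα : α ∈ Φ) :
    ∃ b ∈ B, cartanInt α b ≠ 0 := by
  obtain ⟨b, hb, h1, -⟩ := hB.dominates α hα
  exact ⟨b, hb, fun h0 => h1 ((h.cartanInt_eq_zero_iff hα (hB.subset hb)).1 h0)⟩

lemma cartanInt_of_mem_frame (h : IsRootFinset Φ) (hB : IsOrthFrame Φ B) {b b' : E} (hb : b ∈ B)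
    (hb' : b' ∈ B) (hne : b ≠ b') : cartanInt b b' = 0 :=
  (h.cartanInt_eq_zero_iff (hB.subset hb) (hB.subset hb')).2 (hB.orth b hb b' hb' hne)

lemma card_cartanSupport_le (x : E) : ((cartanSupport B x).card : ℤ) ≤ cartanLength B x := by
  classical
  rw [cartanSupport, Finset.card_filter, cartanLength]
  push_cast
  refine Finset.sum_le_sum fun b _ => ?_
  split_ifs with h0
  · exact Int.one_le_abs h0
  · exact abs_nonneg _

open Classical in
lemma exists_flip (h : IsRootFinset Φ) (hB : IsOrthFrame Φ B) {α : E} (hα : α ∈ Φ)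
    (U : Finset E) (hU : U ⊆ B) :
    (α - ∑ b ∈ U, cartanInt α b • b) ∈ Φ ∧ ∀ b ∈ B,
      cartanInt (α - ∑ b ∈ U, cartanInt α b • b) b =
        if b ∈ U then - cartanInt α b else cartanInt α b := by
  induction U using Finset.induction_on with
  | empty => simpa using hα
  | insert a s ha ih =>
    obtain ⟨h1, h2⟩ := ih (fun x hx => hU (Finset.mem_insert_of_mem hx))
    have haB : a ∈ B := hU (Finset.mem_insert_self _ _)
    set x := α - ∑ b ∈ s, cartanInt α b • b with hx
    have hxa : cartanInt x a = cartanInt α a := by rw [h2 a haB, if_neg ha]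
    have e : α - ∑ b ∈ insert a s, cartanInt α b • b = x - cartanInt x a • a := by
      rw [Finset.sum_insert ha, hxa, hx]; abel
    rw [e]
    refine ⟨h.sub_cartanInt_smul_mem h1 (hB.subset haB), fun b hb => ?_⟩
    have : cartanInt (x - cartanInt x a • a) b = cartanInt x b - cartanInt x a * cartanInt a b := by
      apply h.cartanInt_eq (hB.subset hb)
      have p1 := h.cartanInt_mul h1 (hB.subset hb)
      have p2 := h.cartanInt_mul (hB.subset haB) (hB.subset hb)
      rw [inner_sub_left, ← Int.cast_smul_eq_zsmul ℝ, real_inner_smul_left]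
      push_cast
      linear_combination -p1 + (cartanInt x a : ℝ) * p2
    rw [this]
    by_cases hba : b = a
    · subst hba
      rw [h.cartanInt_self (hB.subset haB), hxa, if_pos (Finset.mem_insert_self _ _)]; ring
    · rw [h.cartanInt_of_mem_frame hB haB hb (Ne.symm hba), h2 b hb, mul_zero, sub_zero]
      simp [hba]

end IsRootFinset

end

section

open scoped RealInnerProductSpace

namespace IsRootFinset

variable {E : Type*} [NormedAddCommGroup E] [InnerProductSpace ℝ E] {Φ B : Finset E}

open Classical in
/-- The roots all of whose Cartan integers against `B` are nonnegative. -/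
noncomputable def dominant (Φ B : Finset E) : Finset E := {α ∈ Φ | ∀ b ∈ B, 0 ≤ cartanInt α b}

lemma mem_dominant {x : E} : x ∈ dominant Φ B ↔ x ∈ Φ ∧ ∀ b ∈ B, 0 ≤ cartanInt x b := by
  classical
  simp [dominant]

open Classical in
lemma card_le_sum_dominant (h : IsRootFinset Φ) (hB : IsOrthFrame Φ B) :
    Φ.card ≤ ∑ α ∈ dominant Φ B, 2 ^ (cartanSupport B α).card := by
  have hsub : Φ ⊆ (dominant Φ B).biUnion fun α =>
      (cartanSupport B α).powerset.image fun U => α - ∑ b ∈ U, cartanInt α b • b := by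
    intro x hx
    set N : Finset E := {b ∈ B | cartanInt x b < 0} with hN
    obtain ⟨h1, h2⟩ := h.exists_flip hB hx N (Finset.filter_subset _ _)
    set y := x - ∑ b ∈ N, cartanInt x b • b with hy
    have h3 : ∀ b ∈ N, cartanInt y b = - cartanInt x b := fun b hb => by
      rw [h2 b (Finset.mem_filter.1 hb).1, if_pos hb]
    refine Finset.mem_biUnion.2 ⟨y, mem_dominant.2 ⟨h1, fun b hb => ?_⟩,
      Finset.mem_image.2 ⟨N, Finset.mem_powerset.2 fun b hb => mem_cartanSupport.2 ⟨?_, ?_⟩, ?_⟩⟩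
    · rw [h2 b hb]
      split_ifs with hbN
      · have := (Finset.mem_filter.1 hbN).2
        omega
      · by_contra hlt
        exact hbN (Finset.mem_filter.2 ⟨hb, by omega⟩)
    · exact (Finset.mem_filter.1 hb).1
    · rw [h3 b hb]
      have := (Finset.mem_filter.1 hb).2
      omega
    · rw [Finset.sum_congr rfl fun b hb => by rw [h3 b hb], hy]
      simp
  refine (Finset.card_le_card hsub).trans (Finset.card_biUnion_le.trans ?_)
  refine Finset.sum_le_sum fun α _ => Finset.card_image_le.trans ?_
  rw [Finset.card_powerset]

lemma cartanInt_eq_zero_of_cartanLength_eq_one {x b b' : E} (h1 : cartanLength B x = 1)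
    (hb : b ∈ B) (hx : cartanInt x b ≠ 0) (hb' : b' ∈ B) (hne : b' ≠ b) : cartanInt x b' = 0 := by
  classical
  rw [cartanLength, ← Finset.add_sum_erase _ _ hb] at h1
  have h2 : |cartanInt x b'| ≤ ∑ b ∈ B.erase b, |cartanInt x b| :=
    Finset.single_le_sum (f := fun b => |cartanInt x b|) (fun _ _ => abs_nonneg _)
      (Finset.mem_erase.2 ⟨hne, hb'⟩)
  have h3 := Int.one_le_abs hx
  have h4 := abs_nonneg (cartanInt x b')
  exact abs_eq_zero.1 (by omega)

open Classical in
lemma card_cartanLength_eq_one_le (h : IsRootFinset Φ) (hB : IsOrthFrame Φ B) :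
    ({α ∈ dominant Φ B | cartanLength B α = 1}).card ≤ 2 * B.card := by
  set C : Finset E := {α ∈ dominant Φ B | cartanLength B α = 1} with hC
  have hex : ∀ α ∈ C, ∃ b ∈ B, cartanInt α b ≠ 0 := fun α hα =>
    h.cartanSupport_nonempty hB (mem_dominant.1 (Finset.mem_filter.1 hα).1).1
  have hone : ∀ α ∈ C, ∀ b ∈ B, cartanInt α b ≠ 0 →
      α ∈ Φ ∧ cartanInt α b = 1 ∧ ∀ b' ∈ B, b' ≠ b → cartanInt α b' = 0 := by
    intro α hα b hb h0
    obtain ⟨hd, hl⟩ := Finset.mem_filter.1 hα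
    obtain ⟨hΦ, hn⟩ := mem_dominant.1 hd
    refine ⟨hΦ, ?_, fun b' hb' hne => cartanInt_eq_zero_of_cartanLength_eq_one hl hb h0 hb' hne⟩
    have : |cartanInt α b| ≤ cartanLength B α :=
      Finset.single_le_sum (f := fun b => |cartanInt α b|) (fun _ _ => abs_nonneg _) hb
    rw [hl, abs_of_nonneg (hn b hb)] at this
    have := hn b hb
    omega
  have hzero : ∀ x ∈ Φ, ¬ ∀ b ∈ B, cartanInt x b = 0 := fun x hx hh => by
    obtain ⟨b, hb, h0⟩ := h.cartanSupport_nonempty hB hx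
    exact h0 (hh b hb)
  choose! f hfB hf using hex
  rw [mul_comm]
  refine (Finset.card_le_mul_card_image_of_maps_to (f := f) (t := B) hfB 2 ?_).trans (by omega)
  intro b hb
  rcases Finset.eq_empty_or_nonempty ({a ∈ C | f a = b} : Finset E) with he | ⟨α, hα⟩
  · rw [he]; simp
  have hsub : ({a ∈ C | f a = b} : Finset E) ⊆ {α, b - α} := by
    obtain ⟨hαC, rfl⟩ := Finset.mem_filter.1 hα
    obtain ⟨hαΦ, hα1, hα0⟩ := hone α hαC _ hb (hf α hαC)
    intro α' hα'
    obtain ⟨hαC', hfe⟩ := Finset.mem_filter.1 hα'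
    obtain ⟨hαΦ', hα1', hα0'⟩ := hone α' hαC' (f α) hb (hfe ▸ hf α' hαC')
    set b := f α with hb_def
    have hbΦ := hB.subset hb
    by_contra hcon
    simp only [Finset.mem_insert, Finset.mem_singleton, not_or] at hcon
    obtain ⟨hn1, hn2⟩ := hcon
    have hle : ⟪α', α⟫ ≤ 0 := by
      by_contra! hlt
      refine hzero _ (h.sub_mem hαΦ' hαΦ hn1 hlt) fun c hc => ?_
      rw [h.cartanInt_sub hαΦ' hαΦ (hB.subset hc)]
      by_cases hcb : c = b
      · rw [hcb, hα1, hα1', sub_self]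
      · rw [hα0 c hc hcb, hα0' c hc hcb, sub_self]
    have hbα : b ≠ α := by
      intro he
      have := h.cartanInt_self hbΦ
      rw [← he] at hα1
      omega
    have hm : b - α ∈ Φ := h.sub_mem hbΦ hαΦ hbα (by
      rw [real_inner_comm]
      exact (h.cartanInt_pos_iff hαΦ hbΦ).1 (by omega))
    have hpos : 0 < ⟪α', b - α⟫ := by
      rw [inner_sub_right]
      have := (h.cartanInt_pos_iff hαΦ' hbΦ).1 (by omega)
      linarith
    refine hzero _ (h.sub_mem hαΦ' hm hn2 hpos) fun c hc => ?_
    rw [h.cartanInt_sub hαΦ' hm (hB.subset hc), h.cartanInt_sub hbΦ hαΦ (hB.subset hc)]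
    by_cases hcb : c = b
    · rw [hcb, hα1, hα1', h.cartanInt_self hbΦ]; norm_num
    · rw [hα0 c hc hcb, hα0' c hc hcb, h.cartanInt_of_mem_frame hB hb hc (Ne.symm hcb)]; norm_num
  exact (Finset.card_le_card hsub).trans Finset.card_le_two

lemma two_mul_cartanInt (h : IsRootFinset Φ) {α β β' γ : E} (hα : α ∈ Φ) (hβ : β ∈ Φ)
    (hβ' : β' ∈ Φ) (hγ : γ ∈ Φ) (he : (2 : ℝ) • α = β + β') :
    2 * cartanInt α γ = cartanInt β γ + cartanInt β' γ := by
  have e := congrArg (fun x => ⟪x, γ⟫) he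
  simp only [inner_add_left, real_inner_smul_left] at e
  have h1 := h.cartanInt_mul hα hγ
  have h2 := h.cartanInt_mul hβ hγ
  have h3 := h.cartanInt_mul hβ' hγ
  have h4 := h.inner_self_pos hγ
  have : (2 * (cartanInt α γ : ℝ) - (cartanInt β γ + cartanInt β' γ)) * ⟪γ, γ⟫ = 0 := by
    linear_combination 2 * h1 - h2 - h3 + 2 * e
  have := (mul_eq_zero.1 this).resolve_right h4.ne'
  exact_mod_cast sub_eq_zero.1 this

/-- A root of length two, equal to half the sum of two members of the frame, which meets the
support of a root of length four. -/
def IsBad (Φ B : Finset E) (α : E) : Prop :=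
  α ∈ dominant Φ B ∧ α ∉ B ∧ cartanLength B α = 2 ∧ defect B α = 0 ∧
    ∃ γ ∈ Φ, cartanLength B γ = 4 ∧ ∃ b ∈ B, cartanInt α b ≠ 0 ∧ cartanInt γ b ≠ 0

open Classical in
lemma IsBad.exists_eq {α β : E} (hα : IsBad Φ B α)
    (hβ : β ∈ B) (h0 : cartanInt α β ≠ 0) :
    ∃ β' ∈ B, β' ≠ β ∧ (2 : ℝ) • α = β + β' ∧ cartanSupport B α = {β, β'} := by
  obtain ⟨hd, hnB, hl, hdef, -⟩ := hα
  have hn := (mem_dominant.1 hd).2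
  have hl' : ∑ b ∈ B.erase β, cartanInt α b = 2 - cartanInt α β := by
    rw [← hl, cartanLength, Finset.sum_congr rfl fun b hb => abs_of_nonneg (hn b hb),
      ← Finset.add_sum_erase _ _ hβ]
    ring
  have hdef' : (2 : ℝ) • α = (cartanInt α β : ℝ) • β + ∑ b ∈ B.erase β, (cartanInt α b : ℝ) • b := by
    rw [Finset.add_sum_erase B (fun b => (cartanInt α b : ℝ) • b) hβ]
    exact sub_eq_zero.1 hdef
  have hne : ∀ b ∈ B.erase β, 0 ≤ cartanInt α b := fun b hb => hn b (Finset.mem_of_mem_erase hb)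
  have hs := Finset.sum_nonneg hne
  have h1 : cartanInt α β = 1 := by
    by_contra hc
    have := hn β hβ
    have h2 : cartanInt α β = 2 := by omega
    rw [h2] at hl' hdef'
    have hz := (Finset.sum_eq_zero_iff_of_nonneg hne).1 (by omega)
    rw [Finset.sum_eq_zero (s := B.erase β) (f := fun b => (cartanInt α b : ℝ) • b)
      fun b hb => by rw [hz b hb]; simp, add_zero] at hdef'
    push_cast at hdef'
    have := smul_right_injective E (two_ne_zero (α := ℝ)) hdef'
    exact hnB (this ▸ hβ)
  rw [h1] at hl' hdef'
  obtain ⟨β', hβ', h2⟩ : ∃ b ∈ B.erase β, cartanInt α b ≠ 0 := by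
    by_contra! hc
    rw [Finset.sum_eq_zero hc] at hl'
    omega
  have hz : ∀ b ∈ (B.erase β).erase β', cartanInt α b = 0 := by
    have h3 : ∀ b ∈ (B.erase β).erase β', 0 ≤ cartanInt α b := fun b hb =>
      hne b (Finset.mem_of_mem_erase hb)
    have h4 := Finset.sum_nonneg h3
    rw [← Finset.add_sum_erase _ _ hβ'] at hl'
    have := hne β' hβ'
    exact (Finset.sum_eq_zero_iff_of_nonneg h3).1 (by omega)
  have h3 : cartanInt α β' = 1 := by
    rw [← Finset.add_sum_erase _ _ hβ', Finset.sum_eq_zero hz] at hl'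
    omega
  rw [← Finset.add_sum_erase _ _ hβ', Finset.sum_eq_zero (s := (B.erase β).erase β')
    fun b hb => by rw [hz b hb]; simp, h3] at hdef'
  refine ⟨β', Finset.mem_of_mem_erase hβ', Finset.ne_of_mem_erase hβ', by simpa using hdef', ?_⟩
  ext b
  rw [mem_cartanSupport, Finset.mem_insert, Finset.mem_singleton]
  constructor
  · rintro ⟨hb, hb0⟩
    by_contra! hc
    exact hb0 (hz b (by simp [hc, hb]))
  · rintro (rfl | rfl)
    · exact ⟨hβ, h0⟩
    · exact ⟨Finset.mem_of_mem_erase hβ', h2⟩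

open Classical in
lemma IsBad.subset (h : IsRootFinset Φ) (hB : IsOrthFrame Φ B) {α γ β : E} (hα : IsBad Φ B α)
    (hγ : γ ∈ Φ) (h4 : cartanLength B γ = 4) (hβ : β ∈ B) (h1 : cartanInt α β ≠ 0)
    (h2 : cartanInt γ β ≠ 0) : cartanSupport B α ⊆ cartanSupport B γ := by
  obtain ⟨β', hβ', hne, he, hs⟩ := hα.exists_eq hβ h1
  rw [hs]
  have hαΦ := (mem_dominant.1 hα.1).1
  have e := h.two_mul_cartanInt hαΦ (hB.subset hβ) (hB.subset hβ') hγ he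
  have e1 := h.abs_cartanInt_eq_one hB hγ h4 hβ h2
  have h3 : cartanInt β' γ ≠ 0 := by
    intro h0
    rw [h0] at e
    rcases abs_eq (by norm_num) |>.1 e1 with h5 | h5 <;> omega
  have h5 : cartanInt γ β' ≠ 0 := fun h0 => h3 (by
    rw [h.cartanInt_eq_zero_iff hγ (hB.subset hβ')] at h0
    rw [h.cartanInt_eq_zero_iff (hB.subset hβ') hγ, real_inner_comm, h0])
  intro b hb
  rcases Finset.mem_insert.1 hb with rfl | hb
  · exact mem_cartanSupport.2 ⟨hβ, h2⟩
  · rw [Finset.mem_singleton.1 hb]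
    exact mem_cartanSupport.2 ⟨hβ', h5⟩

open Classical in
lemma two_mul_card_isBad_le (h : IsRootFinset Φ) (hB : IsOrthFrame Φ B) :
    2 * ({α ∈ dominant Φ B | IsBad Φ B α}).card ≤ 3 * B.card := by
  set C : Finset E := {α ∈ dominant Φ B | IsBad Φ B α} with hC
  have hbad : ∀ α ∈ C, IsBad Φ B α := fun α hα => (Finset.mem_filter.1 hα).2
  rw [mul_comm, mul_comm 3]
  refine Finset.card_mul_le_card_mul (fun α b => cartanInt α b ≠ 0) ?_ ?_
  · intro α hα
    obtain ⟨-, -, -, -, -, -, -, β, hβ, h0, -⟩ := hbad α hα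
    obtain ⟨β', hβ', hne, -, hs⟩ := (hbad α hα).exists_eq hβ h0
    have : Finset.bipartiteAbove (fun α b => cartanInt α b ≠ 0) B α = cartanSupport B α := by
      ext; simp [mem_cartanSupport, Finset.bipartiteAbove]
    rw [this, hs, Finset.card_pair hne.symm]
  · intro β hβ
    rcases Finset.eq_empty_or_nonempty
      (Finset.bipartiteBelow (fun α b => cartanInt α b ≠ 0) C β) with he | ⟨α, hα⟩
    · rw [he]; simp
    obtain ⟨hαC, hα0⟩ := Finset.mem_filter.1 hα
    obtain ⟨-, -, -, -, γ, hγ, h4, b, hb, h1, h2⟩ := hbad α hαC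
    have hβγ : cartanInt γ β ≠ 0 := (mem_cartanSupport.1 ((hbad α hαC).subset h hB hγ h4 hb h1 h2
      (mem_cartanSupport.2 ⟨hβ, hα0⟩))).2
    have hcard : ((cartanSupport B γ).erase β).card ≤ 3 := by
      rw [Finset.card_erase_of_mem (mem_cartanSupport.2 ⟨hβ, hβγ⟩)]
      have := card_cartanSupport_le (B := B) γ
      omega
    refine (Finset.card_le_card_of_injOn (fun x => (2 : ℝ) • x - β) ?_ ?_).trans hcard
    · intro x hx
      obtain ⟨hxC, hx0⟩ := Finset.mem_filter.1 (Finset.mem_coe.1 hx)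
      obtain ⟨β', hβ', hne, he, hs⟩ := (hbad x hxC).exists_eq hβ hx0
      have : (2 : ℝ) • x - β = β' := by rw [he]; abel
      simp only [this]
      refine Finset.mem_coe.2 (Finset.mem_erase.2 ⟨hne, (hbad x hxC).subset h hB hγ h4 hβ hx0 hβγ ?_⟩)
      rw [hs]; simp
    · intro x _ y _ hxy
      exact smul_right_injective E (two_ne_zero (α := ℝ)) (sub_left_injective hxy)

end IsRootFinset

end

section

open scoped RealInnerProductSpace

open Classical in
lemma exists_linear_functional_pos {k V ι : Type*} [Field k] [LinearOrder k]
    [IsStrictOrderedRing k] [AddCommGroup V] [Module k V] (F : Finset ι)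
    (v : ι → V) (hv : ∀ i ∈ F, v i ≠ 0) :
    ∃ g : V →ₗ[k] k, (∀ i ∈ F, g (v i) ≠ 0) ∧ F.card ≤ 2 * ({i ∈ F | 0 < g (v i)}).card := by
  obtain ⟨g, hg⟩ := Module.exists_dual_forall_apply_ne_zero (K := k) (fun i : F => v i)
    (fun i => hv i i.2)
  have hg' : ∀ i ∈ F, g (v i) ≠ 0 := fun i hi => hg ⟨i, hi⟩
  have hsplit := Finset.card_filter_add_card_filter_not (s := F) (fun i => 0 < g (v i))
  by_cases hc : F.card ≤ 2 * ({i ∈ F | 0 < g (v i)}).card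
  · exact ⟨g, hg', hc⟩
  · refine ⟨-g, fun i hi => by simpa using hg' i hi, ?_⟩
    have : ({i ∈ F | ¬ 0 < g (v i)}) = ({i ∈ F | 0 < (-g) (v i)}) := by
      refine Finset.filter_congr fun i hi => ?_
      have := hg' i hi
      simp only [LinearMap.neg_apply, Left.neg_pos_iff, not_lt]
      exact ⟨fun h => lt_of_le_of_ne h this, le_of_lt⟩
    rw [this] at hsplit
    omega

namespace IsRootFinset

variable {E : Type*} [NormedAddCommGroup E] [InnerProductSpace ℝ E] {Φ B : Finset E}

/-- No two members of `S` add up to a member of `Φ` or to zero. -/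
def IsAbelian (Φ S : Finset E) : Prop := ∀ a ∈ S, ∀ b ∈ S, a + b ∉ Φ ∧ a + b ≠ 0

lemma cartanInt_eq_neg_of_add_eq_zero (h : IsRootFinset Φ) {a a' b : E} (ha : a ∈ Φ) (hb : b ∈ Φ)
    (h0 : a + a' = 0) : cartanInt a' b = - cartanInt a b := by
  apply h.cartanInt_eq hb
  have := h.cartanInt_mul ha hb
  rw [eq_neg_of_add_eq_zero_right h0, inner_neg_left]; push_cast; linarith

lemma cartanLength_of_mem_frame (h : IsRootFinset Φ) (hB : IsOrthFrame Φ B) {b : E} (hb : b ∈ B) :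
    cartanLength B b = 2 := by
  rw [cartanLength, Finset.sum_eq_single_of_mem b hb fun b' hb' hne => by
    rw [h.cartanInt_of_mem_frame hB hb hb' hne.symm, abs_zero], h.cartanInt_self (hB.subset hb)]
  norm_num

lemma defect_of_mem_frame (h : IsRootFinset Φ) (hB : IsOrthFrame Φ B) {b : E} (hb : b ∈ B) :
    defect B b = 0 := by
  rw [defect, Finset.sum_eq_single_of_mem b hb fun b' hb' hne => by
    rw [h.cartanInt_of_mem_frame hB hb hb' hne.symm, Int.cast_zero, zero_smul],
    h.cartanInt_self (hB.subset hb)]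
  simp

lemma cartanSupport_of_mem_frame (h : IsRootFinset Φ) (hB : IsOrthFrame Φ B) {b : E}
    (hb : b ∈ B) : cartanSupport B b = {b} := by
  ext c
  rw [mem_cartanSupport, Finset.mem_singleton]
  constructor
  · rintro ⟨hc, h0⟩
    by_contra hne
    exact h0 (h.cartanInt_of_mem_frame hB hb hc (Ne.symm hne))
  · rintro rfl
    exact ⟨hb, by rw [h.cartanInt_self (hB.subset hb)]; norm_num⟩

lemma mem_dominant_of_mem_frame (h : IsRootFinset Φ) (hB : IsOrthFrame Φ B) {b : E} (hb : b ∈ B) :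
    b ∈ dominant Φ B := by
  refine mem_dominant.2 ⟨hB.subset hb, fun c hc => ?_⟩
  by_cases hcb : b = c
  · subst hcb; rw [h.cartanInt_self (hB.subset hb)]; norm_num
  · rw [h.cartanInt_of_mem_frame hB hb hc hcb]

lemma defect_add (h : IsRootFinset Φ) (hB : IsOrthFrame Φ B) {a a' : E} (ha : a ∈ Φ)
    (ha' : a' ∈ Φ) : defect B (a + a') = defect B a + defect B a' := by
  rw [defect, defect, defect, Finset.sum_congr rfl fun b hb => by
    rw [h.cartanInt_add ha ha' (hB.subset hb), Int.cast_add, add_smul], Finset.sum_add_distrib,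
    smul_add]
  abel

lemma frame_add_notMem (h : IsRootFinset Φ) (hB : IsOrthFrame Φ B) {b b' : E} (hb : b ∈ B)
    (hb' : b' ∈ B) : b + b' ∉ Φ := by
  intro hm
  obtain ⟨c, hc, h0, hle⟩ := hB.dominates _ hm
  have p := h.inner_self_pos (hB.subset hb)
  have p' := h.inner_self_pos (hB.subset hb')
  have hnn : 0 ≤ ⟪b, b'⟫ := by
    by_cases e : b = b'
    · subst e; exact p.le
    · exact (hB.orth b hb b' hb' e).ge
  have hs : ⟪b + b', b + b'⟫ = ⟪b, b⟫ + 2 * ⟪b, b'⟫ + ⟪b', b'⟫ := by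
    rw [inner_add_left, inner_add_right, inner_add_right, real_inner_comm b b']; ring
  rw [hs] at hle
  have : c = b ∨ c = b' := by
    by_contra! hcon
    rw [inner_add_left, hB.orth b hb c hc hcon.1.symm, hB.orth b' hb' c hc hcon.2.symm] at h0
    simp at h0
  rcases this with rfl | rfl <;> linarith

open Classical in
/-- The first candidate for a large abelian set of roots. -/
noncomputable def abelianDominant (Φ B : Finset E) (g : E →ₗ[ℝ] ℝ) : Finset E :=
  {α ∈ dominant Φ B | α ∈ B ∨ 3 ≤ cartanLength B α ∨
    (cartanLength B α = 2 ∧ α ∉ B ∧ defect B α = 0 ∧ ¬ IsBad Φ B α) ∨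
    (cartanLength B α = 2 ∧ α ∉ B ∧ 0 < g (defect B α))}

open Classical in
lemma isAbelian_abelianDominant (h : IsRootFinset Φ) (hB : IsOrthFrame Φ B) (g : E →ₗ[ℝ] ℝ) :
    IsAbelian Φ (abelianDominant Φ B g) := by
  have htwo : ∀ α ∈ abelianDominant Φ B g, 2 ≤ cartanLength B α := by
    intro α hα
    rcases (Finset.mem_filter.1 hα).2 with h1 | h1 | h1 | h1
    · exact (h.cartanLength_of_mem_frame hB h1).ge
    · omega
    · exact h1.1.ge
    · exact h1.1.ge
  intro a ha a' ha'
  have hd := mem_dominant.1 (Finset.mem_filter.1 ha).1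
  have hd' := mem_dominant.1 (Finset.mem_filter.1 ha').1
  constructor
  · intro hm
    have hadd : cartanLength B (a + a') = cartanLength B a + cartanLength B a' := by
      rw [cartanLength, cartanLength, cartanLength, ← Finset.sum_add_distrib]
      refine Finset.sum_congr rfl fun b hb => ?_
      rw [h.cartanInt_add hd.1 hd'.1 (hB.subset hb), abs_of_nonneg (hd.2 b hb),
        abs_of_nonneg (hd'.2 b hb), abs_of_nonneg (add_nonneg (hd.2 b hb) (hd'.2 b hb))]
    have hle := h.cartanLength_le hB hm
    have t := htwo a ha
    have t' := htwo a' ha'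
    have h4 : cartanLength B (a + a') = 4 := by omega
    have hdef : g (defect B a) + g (defect B a') = 0 := by
      rw [← map_add, ← h.defect_add hB hd.1 hd'.1, h.defect_eq_zero hB hm h4, map_zero]
    have key : ∀ x ∈ abelianDominant Φ B g, cartanLength B x = 2 →
        (∃ b ∈ B, cartanInt x b ≠ 0 ∧ cartanInt (a + a') b ≠ 0) →
        x ∈ B ∧ g (defect B x) = 0 ∨ 0 < g (defect B x) := by
      intro x hx hx2 hex
      obtain ⟨hxd, h1⟩ := Finset.mem_filter.1 hx
      rcases h1 with h1 | h1 | ⟨-, h1, h2, h3⟩ | h1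
      · exact Or.inl ⟨h1, by rw [h.defect_of_mem_frame hB h1, map_zero]⟩
      · omega
      · exact absurd ⟨hxd, h1, hx2, h2, _, hm, h4, hex⟩ h3
      · exact Or.inr h1.2.2
    have k1 := key a ha (by omega) (by
      obtain ⟨b, hb, h0⟩ := h.cartanSupport_nonempty hB hd.1
      refine ⟨b, hb, h0, ?_⟩
      rw [h.cartanInt_add hd.1 hd'.1 (hB.subset hb)]
      have := hd.2 b hb
      have := hd'.2 b hb
      omega)
    have k2 := key a' ha' (by omega) (by
      obtain ⟨b, hb, h0⟩ := h.cartanSupport_nonempty hB hd'.1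
      refine ⟨b, hb, h0, ?_⟩
      rw [h.cartanInt_add hd.1 hd'.1 (hB.subset hb)]
      have := hd.2 b hb
      have := hd'.2 b hb
      omega)
    rcases k1 with k1 | k1 <;> rcases k2 with k2 | k2
    · exact h.frame_add_notMem hB k1.1 k2.1 hm
    · linarith [k1.2]
    · linarith [k2.2]
    · linarith
  · intro h0
    obtain ⟨b, hb, hne⟩ := h.cartanSupport_nonempty hB hd.1
    have := h.cartanInt_eq_neg_of_add_eq_zero hd.1 (hB.subset hb) h0
    have := hd.2 b hb
    have := hd'.2 b hb
    omega

open Classical in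
/-- The second candidate for a large abelian set of roots, consisting of roots of large length;
a negative coordinate is only allowed in the last position with respect to `o`. -/
noncomputable def abelianLong (Φ B : Finset E) (o : E → ℕ) : Finset E :=
  {x ∈ Φ | 3 ≤ cartanLength B x ∧ ∀ b ∈ B, cartanInt x b < 0 →
    cartanInt x b = -1 ∧ cartanLength B x = 4 ∧ ∀ c ∈ B, cartanInt x c ≠ 0 → o c ≤ o b}

open Classical in
lemma isAbelian_abelianLong (h : IsRootFinset Φ) (hB : IsOrthFrame Φ B) {o : E → ℕ}
    (ho : Set.InjOn o B) : IsAbelian Φ (abelianLong Φ B o) := by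
  have key : ∀ x ∈ abelianLong Φ B o, ∀ y ∈ abelianLong Φ B o, ∀ b ∈ B,
      cartanInt x b < 0 → 0 < cartanInt y b → 5 ≤ ∑ c ∈ B, |cartanInt x c + cartanInt y c| := by
    intro x hx y hy b hb hxb hyb
    obtain ⟨hxΦ, hx3, hxn⟩ := Finset.mem_filter.1 hx
    obtain ⟨hyΦ, hy3, hyn⟩ := Finset.mem_filter.1 hy
    obtain ⟨h1, h4, hmax⟩ := hxn b hb hxb
    have : cartanLength B x + cartanLength B y - 2 ≤ ∑ c ∈ B, |cartanInt x c + cartanInt y c| := by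
      have h2 : (2 : ℤ) = ∑ c ∈ B, if c = b then 2 else 0 := by
        rw [Finset.sum_ite_eq' B b, if_pos hb]
      rw [h2, cartanLength, cartanLength, ← Finset.sum_add_distrib, ← Finset.sum_sub_distrib]
      refine Finset.sum_le_sum fun c hc => ?_
      by_cases hcb : c = b
      · rw [if_pos hcb, hcb, h1, abs_of_pos hyb,
          abs_of_nonneg (a := -1 + cartanInt y b) (by omega)]
        norm_num
        omega
      · rw [if_neg hcb, sub_zero]
        rcases le_or_gt 0 (cartanInt x c) with s | s
        · rcases le_or_gt 0 (cartanInt y c) with t | t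
          · rw [abs_of_nonneg s, abs_of_nonneg t, abs_of_nonneg (add_nonneg s t)]
          · rcases s.eq_or_lt with s | s
            · rw [← s]; simp
            · exfalso
              have e1 := hmax c hc s.ne'
              have e2 := (hyn c hc t).2.2 b hb hyb.ne'
              exact hcb (ho hc hb (le_antisymm e1 e2))
        · exfalso
          have e1 := hmax c hc s.ne
          have e2 := (hxn c hc s).2.2 b hb hxb.ne
          exact hcb (ho hc hb (le_antisymm e1 e2))
    omega
  have main : ∀ x ∈ abelianLong Φ B o, ∀ y ∈ abelianLong Φ B o,
      5 ≤ ∑ c ∈ B, |cartanInt x c + cartanInt y c| := by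
    intro x hx y hy
    by_cases h1 : ∃ b ∈ B, cartanInt x b < 0 ∧ 0 < cartanInt y b
    · obtain ⟨b, hb, h2, h3⟩ := h1
      exact key x hx y hy b hb h2 h3
    by_cases h2 : ∃ b ∈ B, cartanInt y b < 0 ∧ 0 < cartanInt x b
    · obtain ⟨b, hb, h3, h4⟩ := h2
      have := key y hy x hx b hb h3 h4
      simpa only [add_comm] using this
    push Not at h1 h2
    have : ∑ c ∈ B, |cartanInt x c + cartanInt y c| = cartanLength B x + cartanLength B y := by
      rw [cartanLength, cartanLength, ← Finset.sum_add_distrib]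
      refine Finset.sum_congr rfl fun c hc => ?_
      have := h1 c hc
      have := h2 c hc
      rcases le_or_gt 0 (cartanInt x c) with s | s
      · rcases le_or_gt 0 (cartanInt y c) with t | t
        · rw [abs_of_nonneg s, abs_of_nonneg t, abs_of_nonneg (add_nonneg s t)]
        · have : cartanInt x c = 0 := by have := h2 c hc t; omega
          rw [this]; simp
      · have := h1 c hc s
        rw [abs_of_neg s, abs_of_nonpos this, abs_of_neg (by omega)]
        ring
    have := (Finset.mem_filter.1 hx).2.1
    have := (Finset.mem_filter.1 hy).2.1
    omega
  intro x hx y hy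
  have h5 := main x hx y hy
  have hxΦ := (Finset.mem_filter.1 hx).1
  have hyΦ := (Finset.mem_filter.1 hy).1
  constructor
  · intro hm
    have := h.cartanLength_le hB hm
    rw [cartanLength, Finset.sum_congr rfl fun b hb => by
      rw [h.cartanInt_add hxΦ hyΦ (hB.subset hb)]] at this
    omega
  · intro h0
    rw [Finset.sum_eq_zero fun b hb => by
      rw [h.cartanInt_eq_neg_of_add_eq_zero hxΦ (hB.subset hb) h0, add_neg_cancel, abs_zero]] at h5
    omega

open Classical in
lemma card_abelianLong (h : IsRootFinset Φ) (hB : IsOrthFrame Φ B) (o : E → ℕ) :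
    ({α ∈ dominant Φ B | 3 ≤ cartanLength B α ∧ (cartanSupport B α).card ≤ 3}).card +
      2 * ({α ∈ dominant Φ B | (cartanSupport B α).card = 4}).card ≤ (abelianLong Φ B o).card := by
  set C₃ : Finset E := {α ∈ dominant Φ B | 3 ≤ cartanLength B α ∧ (cartanSupport B α).card ≤ 3}
  set C₄ : Finset E := {α ∈ dominant Φ B | (cartanSupport B α).card = 4}
  have hmax : ∀ T : Finset E, T.Nonempty → ∃ b ∈ T, ∀ c ∈ T, o c ≤ o b := fun T hT =>
    Finset.exists_max_image T o hT
  choose! l hlT hlmax using hmax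
  have hne : ∀ α ∈ C₄, (cartanSupport B α).Nonempty := fun α hα =>
    Finset.card_pos.1 (by rw [(Finset.mem_filter.1 hα).2]; norm_num)
  let fl : E → E := fun α => α - ∑ b ∈ {l (cartanSupport B α)}, cartanInt α b • b
  have hfl : ∀ α ∈ C₄, fl α ∈ Φ ∧ l (cartanSupport B α) ∈ cartanSupport B α ∧ ∀ b ∈ B,
      cartanInt (fl α) b = if b = l (cartanSupport B α) then - cartanInt α b
        else cartanInt α b := by
    intro α hα
    have hl := hlT _ (hne α hα)
    have := h.exists_flip hB (mem_dominant.1 (Finset.mem_filter.1 hα).1).1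
      {l (cartanSupport B α)} (Finset.singleton_subset_iff.2 (cartanSupport_subset _ hl))
    refine ⟨this.1, hl, fun b hb => ?_⟩
    rw [this.2 b hb]
    simp only [Finset.mem_singleton]
  have hsupp : ∀ α ∈ C₄, cartanSupport B (fl α) = cartanSupport B α := by
    intro α hα
    ext b
    rw [mem_cartanSupport, mem_cartanSupport]
    refine and_congr_right fun hb => ?_
    rw [(hfl α hα).2.2 b hb]
    split_ifs <;> simp
  have hlen : ∀ α ∈ C₄, cartanLength B α = 4 := fun α hα => by
    have h1 := h.cartanLength_le hB (mem_dominant.1 (Finset.mem_filter.1 hα).1).1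
    have h2 := card_cartanSupport_le (B := B) α
    rw [(Finset.mem_filter.1 hα).2] at h2
    omega
  have hone : ∀ α ∈ C₄, ∀ b ∈ B, cartanInt α b ≠ 0 → cartanInt α b = 1 := by
    intro α hα b hb h0
    obtain ⟨hd, h4⟩ := Finset.mem_filter.1 hα
    have hn := (mem_dominant.1 hd).2
    have e : ∑ c ∈ cartanSupport B α, (cartanInt α c - 1) = 0 := by
      have : ∑ c ∈ cartanSupport B α, cartanInt α c = cartanLength B α := by
        rw [cartanLength, cartanSupport, Finset.sum_filter_ne_zero]
        exact Finset.sum_congr rfl fun c hc => (abs_of_nonneg (hn c hc)).symm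
      rw [Finset.sum_sub_distrib, this, hlen α hα]
      simp [h4]
    have := (Finset.sum_eq_zero_iff_of_nonneg fun c hc => by
      have h1 := mem_cartanSupport.1 hc
      have := hn c h1.1
      omega).1 e b (mem_cartanSupport.2 ⟨hb, h0⟩)
    omega
  have hinj : Set.InjOn fl C₄ := by
    intro α hα β hβ he
    have hs : cartanSupport B α = cartanSupport B β := by
      rw [← hsupp α hα, ← hsupp β hβ, he]
    have h1 := (hfl α hα).2.1
    have h2 := (hfl β hβ).2.1
    have c1 := hone α hα _ (cartanSupport_subset _ h1) (mem_cartanSupport.1 h1).2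
    have c2 := hone β hβ _ (cartanSupport_subset _ h2) (mem_cartanSupport.1 h2).2
    simp only [fl, Finset.sum_singleton] at he
    rw [c1, c2, hs] at he
    exact sub_left_injective he
  have hdisj1 : Disjoint C₃ C₄ := by
    rw [Finset.disjoint_left]
    intro α h3 h4
    have := (Finset.mem_filter.1 h3).2.2
    have := (Finset.mem_filter.1 h4).2
    omega
  have hdisj2 : Disjoint (C₃ ∪ C₄) (C₄.image fl) := by
    rw [Finset.disjoint_right]
    intro x hx hx'
    obtain ⟨α, hα, rfl⟩ := Finset.mem_image.1 hx
    have hd : fl α ∈ dominant Φ B := by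
      rcases Finset.mem_union.1 hx' with hx' | hx' <;> exact (Finset.mem_filter.1 hx').1
    obtain ⟨h1, h2, h3⟩ := hfl α hα
    have hlB := cartanSupport_subset _ h2
    have := (mem_dominant.1 hd).2 _ hlB
    rw [h3 _ hlB, if_pos rfl, hone α hα _ hlB (mem_cartanSupport.1 h2).2] at this
    omega
  have hsub : (C₃ ∪ C₄) ∪ C₄.image fl ⊆ abelianLong Φ B o := by
    intro x hx
    rcases Finset.mem_union.1 hx with hx | hx
    · have hd : x ∈ dominant Φ B := by
        rcases Finset.mem_union.1 hx with hx' | hx' <;> exact (Finset.mem_filter.1 hx').1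
      have h3 : 3 ≤ cartanLength B x := by
        rcases Finset.mem_union.1 hx with hx' | hx'
        · exact (Finset.mem_filter.1 hx').2.1
        · rw [hlen x hx']; norm_num
      refine Finset.mem_filter.2 ⟨(mem_dominant.1 hd).1, h3, fun b hb hlt => ?_⟩
      have := (mem_dominant.1 hd).2 b hb
      omega
    · obtain ⟨α, hα, rfl⟩ := Finset.mem_image.1 hx
      obtain ⟨h1, h2, h3⟩ := hfl α hα
      have h4 : cartanLength B (fl α) = 4 := by
        rw [← hlen α hα]
        refine Finset.sum_congr rfl fun b hb => ?_
        rw [h3 b hb]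
        split_ifs <;> simp
      refine Finset.mem_filter.2 ⟨h1, by rw [h4]; norm_num, fun b hb hlt => ?_⟩
      have hbl : b = l (cartanSupport B α) := by
        by_contra hc
        rw [h3 b hb, if_neg hc] at hlt
        have := (mem_dominant.1 (Finset.mem_filter.1 hα).1).2 b hb
        omega
      refine ⟨?_, h4, fun c hc hc0 => ?_⟩
      · rw [h3 b hb, if_pos hbl, hone α hα b hb (mem_cartanSupport.1 (hbl ▸ h2)).2]
      · rw [hbl]
        refine hlmax _ (hne α hα) c ?_
        rw [← hsupp α hα]
        exact mem_cartanSupport.2 ⟨hc, hc0⟩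
  have := Finset.card_le_card hsub
  rw [Finset.card_union_of_disjoint hdisj2, Finset.card_union_of_disjoint hdisj1,
    Finset.card_image_of_injOn hinj] at this
  omega

open Classical in
/-- Every finite root system contains an abelian set with at least one fourteenth of the roots. -/
theorem exists_isAbelian (h : IsRootFinset Φ) :
    ∃ S ⊆ Φ, IsAbelian Φ S ∧ Φ.card ≤ 14 * S.card := by
  obtain ⟨B, hB⟩ := h.exists_orthFrame
  obtain ⟨o, ho⟩ := Set.countable_iff_exists_injOn.1 B.countable_toSet
  set V : Finset E := {α ∈ dominant Φ B | cartanLength B α = 2 ∧ α ∉ B ∧ defect B α ≠ 0} with hV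
  obtain ⟨g, -, hg⟩ := exists_linear_functional_pos (k := ℝ) V (defect B) fun α hα =>
    (Finset.mem_filter.1 hα).2.2.2
  have hsum := h.card_le_sum_dominant hB
  have hc1 := h.card_cartanLength_eq_one_le hB
  have hbad := h.two_mul_card_isBad_le hB
  have hX := h.card_abelianLong hB o
  have hBD : B.card = ({α ∈ dominant Φ B | α ∈ B}).card := by
    congr 1
    ext x
    simp only [Finset.mem_filter]
    exact ⟨fun hx => ⟨h.mem_dominant_of_mem_frame hB hx, hx⟩, fun hx => hx.2⟩
  have hVg : ({i ∈ V | 0 < g (defect B i)}).card =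
      ({α ∈ dominant Φ B | cartanLength B α = 2 ∧ α ∉ B ∧ 0 < g (defect B α)}).card := by
    congr 1
    ext x
    simp only [hV, Finset.mem_filter]
    constructor
    · rintro ⟨⟨h1, h2, h3, h4⟩, h5⟩
      exact ⟨h1, h2, h3, h5⟩
    · rintro ⟨h1, h2, h3, h5⟩
      refine ⟨⟨h1, h2, h3, fun h0 => ?_⟩, h5⟩
      rw [h0, map_zero] at h5
      exact lt_irrefl _ h5
  have hZ : B.card +
      ({α ∈ dominant Φ B | cartanLength B α = 2 ∧ α ∉ B ∧ defect B α = 0 ∧ ¬ IsBad Φ B α}).card +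
      ({α ∈ dominant Φ B | cartanLength B α = 2 ∧ α ∉ B ∧ 0 < g (defect B α)}).card +
      ({α ∈ dominant Φ B | 3 ≤ cartanLength B α ∧ (cartanSupport B α).card ≤ 3}).card +
      ({α ∈ dominant Φ B | (cartanSupport B α).card = 4}).card ≤ (abelianDominant Φ B g).card := by
    rw [hBD, abelianDominant]
    simp only [Finset.card_filter, ← Finset.sum_add_distrib]
    refine Finset.sum_le_sum fun α _ => ?_
    have h1 := card_cartanSupport_le (B := B) α
    by_cases hb : α ∈ B
    · have := h.cartanLength_of_mem_frame hB hb
      have h2 : (cartanSupport B α).card = 1 := by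
        rw [h.cartanSupport_of_mem_frame hB hb]; simp
      simp [hb, this, h2]
    · by_cases h2 : cartanLength B α = 2
      · rw [h2] at h1
        have h4 : (cartanSupport B α).card ≠ 4 := by omega
        by_cases h0 : defect B α = 0
        · simp [hb, h2, h4, h0]
        · simp [hb, h2, h4, h0]
      · by_cases h3 : 3 ≤ cartanLength B α
        · by_cases h4 : (cartanSupport B α).card = 4
          · simp [hb, h2, h3, h4]
          · simp [hb, h2, h3, h4]
            split_ifs <;> simp
        · have h4 : (cartanSupport B α).card ≠ 4 := by omega
          simp [hb, h2, h3, h4]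
  have hle : ∑ α ∈ dominant Φ B, 2 ^ (cartanSupport B α).card ≤ 2 * B.card +
      2 * ({α ∈ dominant Φ B | cartanLength B α = 1}).card +
      4 * ({α ∈ dominant Φ B | cartanLength B α = 2 ∧ α ∉ B ∧ defect B α = 0 ∧ ¬ IsBad Φ B α}).card +
      4 * ({α ∈ dominant Φ B | IsBad Φ B α}).card + 4 * V.card +
      8 * ({α ∈ dominant Φ B | 3 ≤ cartanLength B α ∧ (cartanSupport B α).card ≤ 3}).card +
      16 * ({α ∈ dominant Φ B | (cartanSupport B α).card = 4}).card := by
    rw [hBD, hV]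
    simp only [Finset.card_filter, ← Finset.sum_add_distrib, Finset.mul_sum]
    refine Finset.sum_le_sum fun α hα => ?_
    have h1 := card_cartanSupport_le (B := B) α
    have hl4 := h.cartanLength_le hB (mem_dominant.1 hα).1
    have hpow : ∀ n, (cartanSupport B α).card ≤ n → 2 ^ (cartanSupport B α).card ≤ 2 ^ n :=
      fun n hn => Nat.pow_le_pow_right (by norm_num) hn
    have hpos : 1 ≤ cartanLength B α := by
      obtain ⟨b, hb, h0⟩ := h.cartanSupport_nonempty hB (mem_dominant.1 hα).1
      exact (Int.one_le_abs h0).trans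
        (Finset.single_le_sum (f := fun b => |cartanInt α b|) (fun _ _ => abs_nonneg _) hb)
    by_cases hb : α ∈ B
    · have h2 : (cartanSupport B α).card = 1 := by
        rw [h.cartanSupport_of_mem_frame hB hb]; simp
      rw [h2, if_pos hb]
      omega
    · rcases (by omega : cartanLength B α = 1 ∨ cartanLength B α = 2 ∨ 3 ≤ cartanLength B α)
        with h2 | h2 | h2
      · have := hpow 1 (by omega)
        rw [if_pos h2]
        omega
      · have := hpow 2 (by omega)
        by_cases h0 : defect B α = 0
        · by_cases hbd : IsBad Φ B α
          · rw [if_pos hbd]; omega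
          · rw [if_pos (c := cartanLength B α = 2 ∧ α ∉ B ∧ defect B α = 0 ∧ ¬ IsBad Φ B α)
              ⟨h2, hb, h0, hbd⟩]
            omega
        · rw [if_pos (c := cartanLength B α = 2 ∧ α ∉ B ∧ defect B α ≠ 0) ⟨h2, hb, h0⟩]; omega
      · by_cases h4 : (cartanSupport B α).card = 4
        · rw [if_pos h4, h4]; omega
        · have := hpow 3 (by omega)
          rw [if_pos (c := 3 ≤ cartanLength B α ∧ (cartanSupport B α).card ≤ 3) ⟨h2, by omega⟩]
          omega
  by_cases hcmp : (abelianLong Φ B o).card ≤ (abelianDominant Φ B g).card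
  · refine ⟨abelianDominant Φ B g, (Finset.filter_subset _ _).trans (Finset.filter_subset _ _),
      h.isAbelian_abelianDominant hB g, ?_⟩
    omega
  · exact ⟨abelianLong Φ B o, Finset.filter_subset _ _, h.isAbelian_abelianLong hB ho, by omega⟩

end IsRootFinset

end

section

lemma LinearMap.finrank_range_le_add_of_ker_inf_le {K V V₁ V₂ V₃ : Type*} [Field K]
    [AddCommGroup V] [Module K V] [FiniteDimensional K V] [AddCommGroup V₁] [Module K V₁]
    [AddCommGroup V₂] [Module K V₂] [AddCommGroup V₃] [Module K V₃]
    (f : V →ₗ[K] V₁) (g : V →ₗ[K] V₂) (h : V →ₗ[K] V₃)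
    (hk : LinearMap.ker f ⊓ LinearMap.ker g ≤ LinearMap.ker h) :
    Module.finrank K (LinearMap.range h) ≤
      Module.finrank K (LinearMap.range f) + Module.finrank K (LinearMap.range g) := by
  have hf := f.finrank_range_add_finrank_ker
  have hg := g.finrank_range_add_finrank_ker
  have hh := h.finrank_range_add_finrank_ker
  have h1 := Submodule.finrank_mono hk
  have h2 := Submodule.finrank_sup_add_finrank_inf_eq (LinearMap.ker f) (LinearMap.ker g)
  have h3 := Submodule.finrank_le (LinearMap.ker f ⊔ LinearMap.ker g)
  omega

namespace LieAlgebra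

open Module

variable {K : Type*} [Field K] [CharZero K] [IsAlgClosed K]

lemma two_mul_finrank_range_toEnd_le {L : Type*} [LieRing L] [LieAlgebra K L]
    [FiniteDimensional K L] [IsSolvable L] (m : ℕ) :
    ∀ (V : Type*) [AddCommGroup V] [Module K V] [LieRingModule L V] [LieModule K L V]
    [FiniteDimensional K V], finrank K V = m →
    2 * finrank K (LinearMap.range (LieModule.toEnd K L V : L →ₗ[K] End K V)) ≤ m * (m + 1) := by
  induction m with
  | zero =>
    intro V _ _ _ _ _ hV
    have : finrank K (End K V) = 0 := by rw [finrank_linearMap, hV]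
    have := Submodule.finrank_le (LinearMap.range (LieModule.toEnd K L V : L →ₗ[K] End K V))
    omega
  | succ m ih =>
    intro V _ _ _ _ _ hV
    have : Nontrivial V := nontrivial_of_finrank_pos (R := K) (by omega)
    obtain ⟨χ, hχ⟩ := LieModule.exists_nontrivial_weightSpace_of_isSolvable K L V
    obtain ⟨⟨v, hv⟩, hv0⟩ := exists_ne (0 : LieModule.weightSpace V χ)
    have hv0 : v ≠ 0 := fun h => hv0 (Subtype.ext h)
    rw [LieModule.mem_weightSpace] at hv
    let N : LieSubmodule K L V :=
      { K ∙ v with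
        lie_mem := by
          intro x w hw
          obtain ⟨t, rfl⟩ := Submodule.mem_span_singleton.1 hw
          rw [lie_smul, hv]
          exact Submodule.smul_mem _ _ (Submodule.smul_mem _ _ (Submodule.mem_span_singleton_self v)) }
    have hN : finrank K (N : Submodule K V) = 1 := finrank_span_singleton hv0
    have hq : finrank K (V ⧸ N) = m := by
      have : finrank K (V ⧸ N) + finrank K (N : Submodule K V) = finrank K V :=
        Submodule.finrank_quotient_add_finrank (N : Submodule K V)
      omega
    have hle := ih (V ⧸ N) hq
    obtain ⟨p, hp⟩ := Module.Projective.exists_dual_ne_zero K hv0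
    let f : L →ₗ[K] Dual K V := (LinearMap.compRight K p) ∘ₗ (LieModule.toEnd K L V : L →ₗ[K] End K V)
    have hf : finrank K (LinearMap.range f) ≤ m + 1 :=
      (Submodule.finrank_le _).trans (by rw [Subspace.dual_finrank_eq, hV])
    have := LinearMap.finrank_range_le_add_of_ker_inf_le
      (LieModule.toEnd K L (V ⧸ N) : L →ₗ[K] End K (V ⧸ N)) f
      (LieModule.toEnd K L V : L →ₗ[K] End K V) (by
        rintro x ⟨hx1, hx2⟩
        refine LinearMap.mem_ker.2 (LinearMap.ext fun w => ?_)
        have h1 : (LieSubmodule.Quotient.mk ⁅x, w⁆ : V ⧸ N) = 0 :=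
          LinearMap.congr_fun (LinearMap.mem_ker.1 hx1) (LieSubmodule.Quotient.mk w)
        have h2 : p ⁅x, w⁆ = 0 := LinearMap.congr_fun (LinearMap.mem_ker.1 hx2) w
        have h3 : ⁅x, w⁆ ∈ N := by simpa using h1
        obtain ⟨t, ht⟩ := Submodule.mem_span_singleton.1 (show ⁅x, w⁆ ∈ K ∙ v from h3)
        rw [← ht, map_smul, smul_eq_mul] at h2
        have ht0 := (mul_eq_zero.1 h2).resolve_right hp
        change ⁅x, w⁆ = 0
        rw [← ht, ht0, zero_smul])
    nlinarith

/-- The ideal `A ⊔ K ∙ x` for an ideal `A` modulo which `x` is a common eigenvector. -/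
def _root_.LieIdeal.supSpan {L : Type*} [LieRing L] [LieAlgebra K L] (A : LieIdeal K L) (x : L)
    (χ : L → K) (hx : ∀ y, ⁅y, x⁆ - χ y • x ∈ A) : LieIdeal K L :=
  { A.toSubmodule ⊔ K ∙ x with
    lie_mem := by
      intro y w hw
      obtain ⟨a, ha, b, hb, rfl⟩ := Submodule.mem_sup.1 hw
      obtain ⟨t, rfl⟩ := Submodule.mem_span_singleton.1 hb
      have e : ⁅y, a + t • x⁆ = (⁅y, a⁆ + t • (⁅y, x⁆ - χ y • x)) + (t * χ y) • x := by
        rw [lie_add, lie_smul, smul_sub, smul_smul]; abel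
      rw [e]
      exact Submodule.add_mem_sup
        (add_mem (lie_mem_right K L A y a ha) (Submodule.smul_mem _ _ (hx y)))
        (Submodule.smul_mem _ _ (Submodule.mem_span_singleton_self x)) }

lemma exists_abelian_lieIdeal_eq_centralizer (L : Type*) [LieRing L] [LieAlgebra K L]
    [FiniteDimensional K L] [IsSolvable L] :
    ∃ A : LieIdeal K L, (∀ x ∈ A, ∀ y ∈ A, ⁅x, y⁆ = 0) ∧
      ∀ x, (∀ y ∈ A, ⁅x, y⁆ = 0) → x ∈ A := by
  obtain ⟨A, hA, hmax⟩ := (wellFounded_gt (α := LieIdeal K L)).has_min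
    {A : LieIdeal K L | ∀ x ∈ A, ∀ y ∈ A, ⁅x, y⁆ = 0} ⟨⊥, fun x hx y _ => by
      rw [(LieSubmodule.mem_bot x).1 hx, zero_lie]⟩
  refine ⟨A, hA, ?_⟩
  by_contra! hcon
  obtain ⟨x₀, hx₀, hx₀A⟩ := hcon
  let C : LieIdeal K L := LieModule.ker K L A
  have hC : ∀ {x}, x ∈ C ↔ ∀ y ∈ A, ⁅x, y⁆ = 0 := by
    intro x
    rw [LieModule.mem_ker]
    exact ⟨fun h y hy => congrArg Subtype.val (h ⟨y, hy⟩), fun h y => Subtype.ext (h y y.2)⟩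
  let C' : LieSubmodule K L (L ⧸ A) := LieSubmodule.map (LieSubmodule.Quotient.mk' A) C
  have hmem : ∀ {x}, x ∈ C → LieSubmodule.Quotient.mk' A x ∈ C' := fun hx =>
    LieSubmodule.mem_map_of_mem hx
  have hne : LieSubmodule.Quotient.mk' A x₀ ≠ 0 := fun h0 => hx₀A (by simpa using h0)
  have : Nontrivial C' :=
    ⟨⟨⟨_, hmem (hC.2 hx₀)⟩, 0, fun h => hne (congrArg Subtype.val h)⟩⟩
  obtain ⟨χ, hχ⟩ := LieModule.exists_nontrivial_weightSpace_of_isSolvable K L C'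
  obtain ⟨⟨⟨c, hc⟩, hcw⟩, hc0⟩ := exists_ne (0 : LieModule.weightSpace C' χ)
  rw [LieModule.mem_weightSpace] at hcw
  obtain ⟨x, hxC, rfl⟩ := (LieSubmodule.mem_map _).1 hc
  have hxA : x ∉ A := fun hx => hc0 (Subtype.ext (Subtype.ext (by simpa using hx)))
  have hxw : ∀ y, ⁅y, x⁆ - χ y • x ∈ A := by
    intro y
    have := congrArg Subtype.val (hcw y)
    have h2 : LieSubmodule.Quotient.mk' A (⁅y, x⁆ - χ y • x) = 0 := by
      rw [map_sub, map_smul, LieModuleHom.map_lie]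
      exact sub_eq_zero.2 this
    exact (LieSubmodule.Quotient.mk_eq_zero' (N := A)).1 h2
  refine hmax (A.supSpan x χ hxw) ?_ ?_
  · have hcomm : ∀ y ∈ A, ⁅x, y⁆ = 0 := hC.1 hxC
    have hcomm' : ∀ y ∈ A, ⁅y, x⁆ = 0 := fun y hy => by rw [← lie_skew, hcomm y hy, neg_zero]
    rintro w hw z hz
    obtain ⟨a, ha, b, hb, rfl⟩ := Submodule.mem_sup.1 hw
    obtain ⟨t, rfl⟩ := Submodule.mem_span_singleton.1 hb
    obtain ⟨a', ha', b', hb', rfl⟩ := Submodule.mem_sup.1 hz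
    obtain ⟨t', rfl⟩ := Submodule.mem_span_singleton.1 hb'
    simp [hA a ha a' ha', hcomm a' ha', hcomm' a ha]
  · refine lt_of_le_of_ne (fun y hy => Submodule.mem_sup_left hy) fun he => hxA ?_
    rw [he]
    exact Submodule.mem_sup_right (Submodule.mem_span_singleton_self x)

/-- A solvable Lie algebra has an abelian subalgebra whose dimension is at least of the order of
the square root of the dimension of the algebra. -/
theorem exists_abelian_of_isSolvable (L : Type*) [LieRing L] [LieAlgebra K L]
    [FiniteDimensional K L] [IsSolvable L] :
    ∃ H : LieSubalgebra K L, IsLieAbelian H ∧ 2 * finrank K L ≤ finrank K H * (finrank K H + 3) := by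
  obtain ⟨A, hA, hmax⟩ := exists_abelian_lieIdeal_eq_centralizer (K := K) L
  refine ⟨A.toLieSubalgebra, ⟨fun x y => Subtype.ext (hA x x.2 y y.2)⟩, ?_⟩
  have h1 := two_mul_finrank_range_toEnd_le (L := L) (finrank K A) A rfl
  have h2 := (LieModule.toEnd K L A : L →ₗ[K] End K A).finrank_range_add_finrank_ker
  have h3 : LinearMap.ker (LieModule.toEnd K L A : L →ₗ[K] End K A) ≤ A.toSubmodule := by
    intro x hx
    refine hmax x fun y hy => ?_
    exact congrArg Subtype.val (LinearMap.congr_fun (LinearMap.mem_ker.1 hx) ⟨y, hy⟩)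
  have h4 := Submodule.finrank_mono h3
  change 2 * finrank K L ≤ finrank K A * (finrank K A + 3)
  change _ ≤ finrank K A at h4
  nlinarith

end LieAlgebra

end

section

open Module LieModule

namespace LieAlgebra

variable {K s : Type*} [Field K] [LieRing s] [LieAlgebra K s] [FiniteDimensional K s]

theorem IsKilling.lie_top_top [IsKilling K s] : ⁅(⊤ : LieIdeal K s), (⊤ : LieIdeal K s)⁆ = ⊤ := by
  set I : LieIdeal K s := ⁅(⊤ : LieIdeal K s), (⊤ : LieIdeal K s)⁆ with hI
  have h : I.killingCompl = ⊥ := by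
    rw [LieSubmodule.eq_bot_iff]
    intro y hy
    rw [LieIdeal.mem_killingCompl] at hy
    have hc : y ∈ LieAlgebra.center K s := by
      rw [LieModule.mem_maxTrivSubmodule]
      intro x
      apply (IsKilling.killingForm_nondegenerate K s).2
      intro z
      have := hy ⁅z, x⁆ (LieSubmodule.lie_mem_lie (LieSubmodule.mem_top z) (LieSubmodule.mem_top x))
      rw [← LieModule.traceForm_apply_lie_apply]
      exact this
    simpa using hc
  have h2 := (LieIdeal.isCompl_killingCompl I).sup_eq_top
  rwa [h, sup_bot_eq] at h2

variable {W : Type*} [AddCommGroup W] [Module K W] [LieRingModule s W] [LieModule K s W]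

theorem IsKilling.isTrivial_of_isNilpotent [IsKilling K s] [LieModule.IsNilpotent s W] :
    LieModule.IsTrivial s W := by
  have h1 : ⁅(⊤ : LieIdeal K s), (⊤ : LieSubmodule K s W)⁆ ≤
      ⁅(⊤ : LieIdeal K s), ⁅(⊤ : LieIdeal K s), (⊤ : LieSubmodule K s W)⁆⁆ := by
    conv_lhs => rw [← IsKilling.lie_top_top (K := K) (s := s)]
    rw [LieSubmodule.lieIdeal_oper_eq_span, LieSubmodule.lieSpan_le]
    rintro _ ⟨⟨x, hx⟩, ⟨w, -⟩, rfl⟩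
    simp only [SetLike.mem_coe]
    rw [← LieSubmodule.mem_toSubmodule, LieSubmodule.lieIdeal_oper_eq_linear_span'] at hx
    induction hx using Submodule.span_induction with
    | mem x hx =>
      obtain ⟨a, -, b, -, rfl⟩ := hx
      rw [lie_lie]
      refine sub_mem ?_ ?_ <;>
      exact LieSubmodule.lie_mem_lie (LieSubmodule.mem_top _)
        (LieSubmodule.lie_mem_lie (LieSubmodule.mem_top _) (LieSubmodule.mem_top _))
    | zero => simp
    | add x y _ _ hx hy => rw [add_lie]; exact add_mem hx hy
    | smul a x _ hx => rw [smul_lie]; exact SMulMemClass.smul_mem _ hx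
  have h2 : ∀ k, ⁅(⊤ : LieIdeal K s), (⊤ : LieSubmodule K s W)⁆ ≤
      lowerCentralSeries K s W (k + 1) := by
    intro k
    induction k with
    | zero => simp
    | succ k ih =>
      rw [lowerCentralSeries_succ]
      exact h1.trans (LieSubmodule.mono_lie_right _ ih)
  obtain ⟨k, hk⟩ := (LieModule.isNilpotent_iff K s W).mp inferInstance
  have h3 : ⁅(⊤ : LieIdeal K s), (⊤ : LieSubmodule K s W)⁆ = ⊥ := by
    rw [eq_bot_iff, ← hk]
    exact (h2 k).trans (antitone_lowerCentralSeries K s W (Nat.le_succ k))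
  refine ⟨fun x w => ?_⟩
  have := LieSubmodule.lie_mem_lie (LieSubmodule.mem_top (R := K) (L := s) x)
    (LieSubmodule.mem_top (R := K) (L := s) w)
  rw [h3] at this
  simpa using this

variable [CharZero K]

theorem IsKilling.isTrivial_of_traceForm_eq_zero [FiniteDimensional K W] [IsKilling K s]
    (h : traceForm K s W = 0) : LieModule.IsTrivial s W := by
  have h1 := LieModule.isNilpotent_derivedSeries_of_traceForm_eq_zero h
  have : LieModule.IsNilpotent s W := by
    rw [LieModule.isNilpotent_iff_forall' (R := K)] at h1 ⊢
    intro x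
    refine h1 ⟨x, ?_⟩
    have : derivedSeries K s 1 = ⊤ := by
      simpa using IsKilling.lie_top_top (K := K) (s := s)
    rw [this]; trivial
  exact IsKilling.isTrivial_of_isNilpotent (K := K)

/-- The Casimir operator attached to the trace form of a module. -/
theorem IsKilling.exists_casimir [IsKilling K s] : ∃ Γ : End K W,
    (∀ (x : s) (w : W), ⁅x, Γ w⁆ = Γ ⁅x, w⁆) ∧
    (∀ φ : W →ₗ[K] K, (∀ (x : s) (w : W), φ ⁅x, w⁆ = 0) → ∀ w, φ (Γ w) = 0) ∧
    (IsNilpotent Γ → traceForm K s W = 0) := by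
  set τ := traceForm K s W with hτ
  have hinv : τ.lieInvariant s := LieModule.traceForm_lieInvariant K s W
  set I : LieIdeal K s := InvariantForm.orthogonal τ hinv ⊤ with hI
  have hIcpl := LieIdeal.isCompl_killingCompl I
  set J := I.killingCompl with hJ
  let B : LinearMap.BilinForm K J := τ.restrict J.toSubmodule
  have hBapp : ∀ x y : J, B x y = τ x y := fun _ _ => rfl
  have hsymτ : ∀ x y, τ x y = τ y x := fun x y => LieModule.traceForm_comm K s W x y
  have hB : B.Nondegenerate := by
    have key : ∀ x : J, (∀ y : J, τ x y = 0) → x = 0 := by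
      intro x hx
      have hxI : (x : s) ∈ I := by
        rw [hI, InvariantForm.mem_orthogonal]
        intro z _
        have hz : z ∈ I ⊔ J := by rw [hIcpl.sup_eq_top]; trivial
        obtain ⟨a, ha, c, hc, rfl⟩ := (LieSubmodule.mem_sup _ _ _).mp hz
        rw [hI, InvariantForm.mem_orthogonal] at ha
        rw [map_add, LinearMap.add_apply, hsymτ c, hx ⟨c, hc⟩, hsymτ a, ha _ trivial, add_zero]
      have : (x : s) ∈ I ⊓ J := ⟨hxI, x.2⟩
      rw [hIcpl.inf_eq_bot] at this
      exact Subtype.ext (by simpa using this)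
    refine ⟨fun x hx => key x hx, fun x hx => key x fun y => ?_⟩
    rw [hsymτ]; exact hx y
  let b := Module.finBasis K J
  let b' := B.dualBasis hB b
  have hb'b : ∀ i j, B (b' i) (b j) = if j = i then 1 else 0 := fun i j =>
    LinearMap.BilinForm.apply_dualBasis_left ..
  have hb'r : ∀ y j, b'.repr y j = B y (b j) := fun y j =>
    LinearMap.BilinForm.dualBasis_repr_apply ..
  have hrepr : ∀ (x : s) i j, b'.repr ⁅x, b' i⁆ j = - b.repr ⁅x, b j⁆ i := by
    intro x i j
    have h1 : B ⁅x, b' i⁆ (b j) = - B (b' i) ⁅x, b j⁆ := hinv x (b' i) (b j)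
    rw [hb'r, h1]
    congr 1
    conv_lhs => rw [← b.sum_repr ⁅x, b j⁆]
    simp only [map_sum, map_smul, hb'b, smul_eq_mul, mul_ite, mul_one, mul_zero,
      Finset.sum_ite_eq', Finset.mem_univ, if_true]
  let Γ : End K W := ∑ i, (toEnd K s W (b i)) * (toEnd K s W (b' i))
  have hΓ : ∀ w, Γ w = ∑ i, ⁅(b i : s), ⁅(b' i : s), w⁆⁆ := by
    intro w; simp [Γ]
  refine ⟨Γ, ?_, ?_, ?_⟩
  · intro x w
    have e1 : ∀ i, ⁅x, (b i : s)⁆ = ∑ j, b.repr ⁅x, b i⁆ j • (b j : s) := by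
      intro i
      have := congrArg J.toSubmodule.subtype (b.sum_repr ⁅x, b i⁆)
      simp only [map_sum, map_smul] at this
      exact this.symm
    have e2 : ∀ i, ⁅x, (b' i : s)⁆ = ∑ j, - (b.repr ⁅x, b j⁆ i • (b' j : s)) := by
      intro i
      have := congrArg J.toSubmodule.subtype (b'.sum_repr ⁅x, b' i⁆)
      simp only [map_sum, hrepr, neg_smul] at this
      exact this.symm
    rw [hΓ, hΓ, lie_sum]
    have e3 : ∀ i, ⁅x, ⁅(b i : s), ⁅(b' i : s), w⁆⁆⁆ =
        ∑ j, b.repr ⁅x, b i⁆ j • ⁅(b j : s), ⁅(b' i : s), w⁆⁆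
        - ∑ j, b.repr ⁅x, b j⁆ i • ⁅(b i : s), ⁅(b' j : s), w⁆⁆
        + ⁅(b i : s), ⁅(b' i : s), ⁅x, w⁆⁆⁆ := by
      intro i
      rw [leibniz_lie x (b i : s), leibniz_lie x (b' i : s), lie_add, e1, e2]
      simp only [sum_lie, lie_sum, smul_lie, neg_lie, lie_neg, lie_smul, Finset.sum_neg_distrib]
      abel
    rw [Finset.sum_congr rfl fun i _ => e3 i, Finset.sum_add_distrib, Finset.sum_sub_distrib,
      Finset.sum_comm, sub_self, zero_add]
  · intro φ hφ w
    rw [hΓ, map_sum]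
    exact Finset.sum_eq_zero fun i _ => hφ _ _
  · intro hnil
    have htr : LinearMap.trace K W Γ = finrank K J := by
      have : ∀ i, LinearMap.trace K W ((toEnd K s W (b i)) * (toEnd K s W (b' i))) = 1 := by
        intro i
        have h1 : LinearMap.trace K W ((toEnd K s W (b i)) * (toEnd K s W (b' i))) =
          τ (b i) (b' i) := rfl
        rw [h1, hsymτ, ← hBapp, hb'b, if_pos rfl]
      simp only [Γ, map_sum, this]
      simp
    have h0 : LinearMap.trace K W Γ = 0 := (LinearMap.isNilpotent_trace_of_isNilpotent hnil).eq_zero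
    have hJ0 : finrank K J = 0 := by
      rw [htr] at h0; exact_mod_cast h0
    have hJbot : J = ⊥ := by
      rw [LieSubmodule.eq_bot_iff]
      intro x hx
      have : Subsingleton J := Module.finrank_zero_iff.mp hJ0
      exact congrArg Subtype.val (Subsingleton.elim (⟨x, hx⟩ : J) 0)
    have hItop : I = ⊤ := by
      have := hIcpl.sup_eq_top
      rwa [hJbot, sup_bot_eq] at this
    ext x y
    have : y ∈ I := by rw [hItop]; trivial
    rw [hI, InvariantForm.mem_orthogonal] at this
    exact this x trivial

variable [FiniteDimensional K W]

theorem IsKilling.exists_invariant [IsKilling K s] (φ : W →ₗ[K] K) (hφ0 : φ ≠ 0)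
    (hφ : ∀ (x : s) (w : W), φ ⁅x, w⁆ = 0) : ∃ w : W, (∀ x : s, ⁅x, w⁆ = 0) ∧ φ w = 1 := by
  induction hd : finrank K W using Nat.strong_induction_on generalizing W with
  | _ d ih =>
  obtain ⟨Γ, hΓ, hΓφ, hΓnil⟩ := IsKilling.exists_casimir (K := K) (s := s) (W := W)
  have hpow : ∀ (k : ℕ) (x : s) (w : W), ⁅x, (Γ ^ k) w⁆ = (Γ ^ k) ⁅x, w⁆ := by
    intro k
    induction k with
    | zero => simp
    | succ k ihk => intro x w; simp only [pow_succ, Module.End.mul_apply, ihk, hΓ]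
  obtain ⟨N, hN⟩ := (LinearMap.eventually_isCompl_ker_pow_range_pow Γ).and
    (Filter.eventually_ge_atTop 1) |>.exists
  obtain ⟨hcpl, hN1⟩ := hN
  let U : LieSubmodule K s W :=
    { LinearMap.ker (Γ ^ N) with
      lie_mem := by
        intro x m hm
        have hm : (Γ ^ N) m = 0 := hm
        change (Γ ^ N) ⁅x, m⁆ = 0
        rw [← hpow, hm, lie_zero] }
  have hU : ∀ m, m ∈ U ↔ (Γ ^ N) m = 0 := fun m => Iff.rfl
  have hrange : ∀ w, φ ((Γ ^ N) w) = 0 := by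
    intro w
    obtain ⟨M, rfl⟩ : ∃ M, N = M + 1 := ⟨N - 1, by omega⟩
    rw [pow_succ', Module.End.mul_apply]
    exact hΓφ φ hφ _
  by_cases htop : LinearMap.ker (Γ ^ N) = ⊤
  · have hnil : IsNilpotent Γ := ⟨N, LinearMap.ker_eq_top.mp htop⟩
    have := IsKilling.isTrivial_of_traceForm_eq_zero (hΓnil hnil)
    obtain ⟨w, hw⟩ : ∃ w, φ w ≠ 0 := by
      by_contra! h
      exact hφ0 (LinearMap.ext h)
    exact ⟨(φ w)⁻¹ • w, fun x => trivial_lie_zero .., by simp [hw]⟩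
  · have hlt : finrank K U < d := hd ▸ Submodule.finrank_lt (lt_top_iff_ne_top.mpr htop).ne
    have hφU : φ ∘ₗ U.toSubmodule.subtype ≠ 0 := by
      intro h
      apply hφ0
      ext w
      have hw : w ∈ LinearMap.ker (Γ ^ N) ⊔ LinearMap.range (Γ ^ N) := by
        rw [hcpl.sup_eq_top]; trivial
      obtain ⟨a, ha, _, ⟨c, rfl⟩, rfl⟩ := Submodule.mem_sup.mp hw
      have : φ a = 0 := LinearMap.congr_fun h ⟨a, ha⟩
      rw [map_add, hrange, this]; simp
    obtain ⟨w, hw, hw1⟩ := ih _ hlt (W := U) (φ ∘ₗ U.toSubmodule.subtype) hφU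
      (fun x w => hφ x w) rfl
    exact ⟨w, fun x => congrArg Subtype.val (hw x), hw1⟩

end LieAlgebra

end

section

open Module LieModule

namespace LieAlgebra

theorem _root_.LieHom.exists_comp_eq_of_surjective {K g s L' : Type*} [Field K]
    [LieRing g] [LieAlgebra K g] [LieRing s] [LieAlgebra K s] [LieRing L'] [LieAlgebra K L']
    (π : g →ₗ⁅K⁆ s) (hπ : Function.Surjective π) (f : g →ₗ⁅K⁆ L')
    (hf : ∀ x, π x = 0 → f x = 0) : ∃ ρ : s →ₗ⁅K⁆ L', ∀ x, ρ (π x) = f x := by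
  obtain ⟨t, ht⟩ := (π : g →ₗ[K] s).exists_rightInverse_of_surjective
    (LinearMap.range_eq_top.mpr hπ)
  have ht' : ∀ y, π (t y) = y := fun y => LinearMap.congr_fun ht y
  have key : ∀ x y, π x = π y → f x = f y := fun x y h => by
    rw [← sub_eq_zero, ← map_sub]
    exact hf _ (by rw [map_sub, h, sub_self])
  refine ⟨{ (f : g →ₗ[K] L') ∘ₗ t with
    map_lie' := fun {x y} => ?_ }, fun x => key _ _ (ht' _)⟩
  change f (t ⁅x, y⁆) = ⁅f (t x), f (t y)⁆
  rw [← LieHom.map_lie]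
  exact key _ _ (by simp [ht'])

universe u
variable {K s : Type*} [Field K] [CharZero K] [LieRing s] [LieAlgebra K s]
  [FiniteDimensional K s] [IsKilling K s]

theorem exists_invariant_of_surjective {g W : Type*} [LieRing g] [LieAlgebra K g]
    [AddCommGroup W] [Module K W] [LieRingModule g W] [LieModule K g W] [FiniteDimensional K W]
    (π : g →ₗ⁅K⁆ s) (hπ : Function.Surjective π) (hker : ∀ x, π x = 0 → ∀ w : W, ⁅x, w⁆ = 0)
    (φ : W →ₗ[K] K) (hφ0 : φ ≠ 0) (hφ : ∀ (x : g) (w : W), φ ⁅x, w⁆ = 0) :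
    ∃ w : W, (∀ x : g, ⁅x, w⁆ = 0) ∧ φ w = 1 := by
  obtain ⟨t, ht⟩ := (π : g →ₗ[K] s).exists_rightInverse_of_surjective
    (LinearMap.range_eq_top.mpr hπ)
  have ht' : ∀ y, π (t y) = y := fun y => LinearMap.congr_fun ht y
  have key : ∀ x y, π x = π y → ∀ w : W, ⁅x, w⁆ = ⁅y, w⁆ := fun x y h w => by
    rw [← sub_eq_zero, ← sub_lie]
    exact hker _ (by rw [map_sub, h, sub_self]) w
  let _ : LieRingModule s W :=
    { bracket := fun y w => ⁅t y, w⁆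
      add_lie := fun x y w => by simp
      lie_add := fun x v w => lie_add (t x) v w
      leibniz_lie := fun x y w => by
        change ⁅t x, ⁅t y, w⁆⁆ = ⁅t ⁅x, y⁆, w⁆ + ⁅t y, ⁅t x, w⁆⁆
        rw [key (t ⁅x, y⁆) ⁅t x, t y⁆ (by simp [ht'])]
        exact leibniz_lie .. }
  let _ : LieModule K s W :=
    { smul_lie := fun c x w => by change ⁅t (c • x), w⁆ = c • ⁅t x, w⁆; simp
      lie_smul := fun c x w => lie_smul c (t x) w }
  obtain ⟨w, hw, hw1⟩ := IsKilling.exists_invariant (s := s) φ hφ0 fun x w => hφ (t x) w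
  exact ⟨w, fun x => (key x (t (π x)) (ht' _).symm w).trans (hw (π x)), hw1⟩

/-- The kernel of a surjection onto a Killing Lie algebra, if abelian and nonzero, has a proper
supplement. -/
theorem exists_supplement_of_abelian_ker {g : Type*} [LieRing g] [LieAlgebra K g]
    [FiniteDimensional K g] (π : g →ₗ⁅K⁆ s) (hπ : Function.Surjective π)
    (hab : ∀ x y, π x = 0 → π y = 0 → ⁅x, y⁆ = 0) (hne : ∃ x, x ≠ 0 ∧ π x = 0) :
    ∃ k : LieSubalgebra K g, k ≠ ⊤ ∧ ∀ x, ∃ y ∈ k, π y = π x := by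
  obtain ⟨v₀, hv₀, hπv₀⟩ := hne
  set V : LieIdeal K g := π.ker with hV
  have memV : ∀ x, x ∈ V ↔ π x = 0 := fun x => LieHom.mem_ker
  obtain ⟨ξ, hξ⟩ : ∃ ξ : V →ₗ[K] K, ξ ⟨v₀, (memV _).2 hπv₀⟩ = 1 := by
    have : (⟨v₀, (memV _).2 hπv₀⟩ : V) ≠ 0 := fun h => hv₀ (congrArg Subtype.val h)
    obtain ⟨ξ, h⟩ := Module.Projective.exists_dual_ne_zero K this
    exact ⟨(ξ ⟨v₀, (memV _).2 hπv₀⟩)⁻¹ • ξ, by simp [h]⟩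
  let M : LieSubmodule K g (g →ₗ[K] V) :=
    { carrier := {f | ∃ c : K, ∀ v : V, f v = c • v}
      add_mem' := by
        rintro f f' ⟨c, hc⟩ ⟨c', hc'⟩
        exact ⟨c + c', fun v => by simp [hc, hc', add_smul]⟩
      zero_mem' := ⟨0, fun v => by simp⟩
      smul_mem' := by
        rintro a f ⟨c, hc⟩
        exact ⟨a * c, fun v => by simp [hc, mul_smul]⟩
      lie_mem := by
        rintro x f ⟨c, hc⟩
        refine ⟨0, fun v => ?_⟩
        have := hc ⁅x, v⁆
        rw [LieSubmodule.coe_bracket] at this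
        rw [LieHom.lie_apply, hc, this, lie_smul, sub_self, zero_smul] }
  let P : LieSubmodule K g M :=
    { carrier := {f | ∃ v : V, ∀ y, (f.1 y : g) = ⁅(v : g), y⁆}
      add_mem' := by
        rintro f f' ⟨c, hc⟩ ⟨c', hc'⟩
        exact ⟨c + c', fun v => by simp [hc, hc']⟩
      zero_mem' := ⟨0, fun v => by simp⟩
      smul_mem' := by
        rintro a f ⟨c, hc⟩
        exact ⟨a • c, fun v => by simp [hc]⟩
      lie_mem := by
        rintro x f ⟨v, hv⟩
        refine ⟨⁅x, v⁆, fun y => ?_⟩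
        rw [LieSubmodule.coe_bracket, LieHom.lie_apply, LieSubmodule.coe_sub,
          LieSubmodule.coe_bracket, hv, hv, LieSubmodule.coe_bracket, lie_lie] }
  let φ₀ : M →ₗ[K] K := ξ ∘ₗ (LinearMap.applyₗ v₀) ∘ₗ M.toSubmodule.subtype
  have hφ₀ : ∀ f : M, φ₀ f = ξ (f.1 v₀) := fun f => rfl
  have hcoef : ∀ (f : M) (c : K), (∀ v : V, f.1 v = c • v) → φ₀ f = c := by
    intro f c hc
    have := hc ⟨v₀, (memV _).2 hπv₀⟩
    rw [hφ₀, this, map_smul, hξ]; simp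
  have hφP : P.toSubmodule ≤ LinearMap.ker φ₀ := by
    rintro f ⟨v, hv⟩
    refine hcoef f 0 fun u => Subtype.ext ?_
    rw [hv, zero_smul, hab _ _ ((memV _).1 v.2) ((memV _).1 u.2)]; rfl
  let φ : (M ⧸ P) →ₗ[K] K := P.toSubmodule.liftQ φ₀ hφP
  have hφ : ∀ f : M, φ (LieSubmodule.Quotient.mk f) = φ₀ f := fun f => rfl
  have hsurj : ∀ w : M ⧸ P, ∃ f : M, LieSubmodule.Quotient.mk f = w :=
    fun w => Submodule.Quotient.mk_surjective _ w
  have hmk0 : ∀ f : M, (LieSubmodule.Quotient.mk f : M ⧸ P) = 0 ↔ f ∈ P :=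
    fun f => Submodule.Quotient.mk_eq_zero _
  have hmklie : ∀ (x : g) (f : M), ⁅x, (LieSubmodule.Quotient.mk f : M ⧸ P)⁆ =
    LieSubmodule.Quotient.mk ⁅x, f⁆ := fun x f => rfl
  have hproj : ∃ p : g →ₗ[K] V, ∀ v : V, p v = v := by
    obtain ⟨p, hp⟩ := V.toSubmodule.subtype.exists_leftInverse_of_injective
      (LinearMap.ker_eq_bot.mpr Subtype.val_injective)
    exact ⟨p, fun v => LinearMap.congr_fun hp v⟩
  obtain ⟨w, hw, hw1⟩ : ∃ w : M ⧸ P, (∀ x : g, ⁅x, w⁆ = 0) ∧ φ w = 1 := by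
    refine exists_invariant_of_surjective π hπ ?_ φ ?_ ?_
    · intro u hu w
      obtain ⟨f, rfl⟩ := hsurj w
      rw [hmklie, hmk0]
      obtain ⟨c, hc⟩ := f.2
      refine ⟨-c • ⟨u, (memV _).2 hu⟩, fun y => ?_⟩
      have h2 : π ⁅u, y⁆ = 0 := by simp [hu]
      have h3 := hc ⟨⁅u, y⁆, (memV _).2 h2⟩
      rw [LieSubmodule.coe_bracket, LieHom.lie_apply, h3, LieSubmodule.coe_sub,
          LieSubmodule.coe_bracket, hab _ _ hu ((memV _).1 (f.1 y).2)]
      simp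
    · intro h
      obtain ⟨p, hp⟩ := hproj
      have h1 := hcoef ⟨p, 1, fun v => by rw [hp, one_smul]⟩ 1 (fun v => by rw [hp, one_smul])
      rw [← hφ, h] at h1
      simp at h1
    · intro x w
      obtain ⟨f, rfl⟩ := hsurj w
      rw [hmklie, hφ]
      obtain ⟨c, hc⟩ := f.2
      refine hcoef _ _ fun v => ?_
      have := hc ⁅x, v⁆
      rw [LieSubmodule.coe_bracket] at this
      rw [LieSubmodule.coe_bracket, LieHom.lie_apply, hc, this, lie_smul, sub_self, zero_smul]
  obtain ⟨f, rfl⟩ := hsurj w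
  obtain ⟨c, hc⟩ := f.2
  have hc1 : c = 1 := by rw [hφ, hcoef f c hc] at hw1; exact hw1
  subst hc1
  have hfV : ∀ v, π v = 0 → (f.1 v : g) = v := fun v hv => by
    have := hc ⟨v, (memV _).2 hv⟩
    rw [this, one_smul]
  have hπf : ∀ y, π (f.1 y) = 0 := fun y => (memV _).1 (f.1 y).2
  have hder : ∀ x : g, ∃ v : V, ∀ y : g, ⁅x, (f.1 y : g)⁆ - f.1 ⁅x, y⁆ = ⁅(v : g), y⁆ := by
    intro x
    have := hw x
    rw [hmklie, hmk0] at this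
    exact this
  let k : LieSubalgebra K g :=
    { carrier := {x | ∀ y, ⁅x, (f.1 y : g)⁆ = f.1 ⁅x, y⁆}
      add_mem' := by
        intro a b ha hb y
        simp only [add_lie, map_add, ha y, hb y, LieSubmodule.coe_add]
      zero_mem' := by simp
      smul_mem' := by
        intro c a ha y
        simp only [smul_lie, map_smul, ha y, LieSubmodule.coe_smul]
      lie_mem' := by
        intro a b ha hb y
        rw [lie_lie, lie_lie, hb y, ha, ha y, hb, map_sub, LieSubmodule.coe_sub] }
  by_cases hk : k = ⊤
  · have heq : ∀ x y, ⁅x, (f.1 y : g)⁆ = f.1 ⁅x, y⁆ := fun x => by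
      have : x ∈ k := by rw [hk]; trivial
      exact this
    let k' : LieSubalgebra K g :=
      { LinearMap.ker f.1 with
        lie_mem' := by
          intro x y _ hy
          have hy : f.1 y = 0 := hy
          refine Subtype.ext ?_
          change (f.1 ⁅x, y⁆ : g) = 0
          rw [← heq, hy]; simp }
    have hk' : ∀ x, x ∈ k' ↔ f.1 x = 0 := fun x => Iff.rfl
    refine ⟨k', fun h => hv₀ ?_, fun x => ⟨x - f.1 x, ?_, by rw [map_sub, hπf, sub_zero]⟩⟩
    · have : v₀ ∈ k' := by rw [h]; trivial
      rw [hk'] at this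
      rw [← hfV v₀ hπv₀, this]; rfl
    · rw [hk', map_sub, sub_eq_zero]
      exact Subtype.ext (hfV _ (hπf x)).symm
  · refine ⟨k, hk, fun x => ?_⟩
    obtain ⟨v, hv⟩ := hder x
    refine ⟨x + v, fun y => ?_, by rw [map_add, (memV _).1 v.2, add_zero]⟩
    have h2 : π ⁅(v : g), y⁆ = 0 := by simp [(memV _).1 v.2]
    rw [add_lie, add_lie, map_add, LieSubmodule.coe_add, hfV _ h2, ← hv y,
      hab _ _ ((memV _).1 v.2) (hπf y)]
    abel

theorem exists_section_of_abelian_ker {g : Type*} [LieRing g] [LieAlgebra K g]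
    [FiniteDimensional K g] (π : g →ₗ⁅K⁆ s) (hπ : Function.Surjective π)
    (hab : ∀ x y, π x = 0 → π y = 0 → ⁅x, y⁆ = 0) :
    ∃ σ : s →ₗ⁅K⁆ g, ∀ y, π (σ y) = y := by
  induction hd : finrank K g using Nat.strong_induction_on generalizing g with
  | _ d ih =>
  by_cases hne : ∃ x, x ≠ 0 ∧ π x = 0
  · obtain ⟨k, hk, hkπ⟩ := exists_supplement_of_abelian_ker π hπ hab hne
    obtain ⟨σ, hσ⟩ := ih (finrank K k) (hd ▸ Submodule.finrank_lt
      (fun h => hk (LieSubalgebra.toSubmodule_injective h))) (g := k) (π.comp k.incl)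
      (fun y => by
        obtain ⟨x, rfl⟩ := hπ y
        obtain ⟨z, hz, h⟩ := hkπ x
        exact ⟨⟨z, hz⟩, h⟩) (fun x y hx hy => Subtype.ext (hab x y hx hy)) rfl
    exact ⟨k.incl.comp σ, hσ⟩
  · push Not at hne
    obtain ⟨σ, hσ⟩ := π.exists_comp_eq_of_surjective hπ LieHom.id
      (fun x hx => by by_contra h; exact hne x h hx)
    refine ⟨σ, fun y => ?_⟩
    obtain ⟨x, rfl⟩ := hπ y
    rw [hσ]; rfl

/-- **Levi's theorem** -/
theorem exists_section_of_isSolvable_ker {g : Type*} [LieRing g] [LieAlgebra K g]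
    [FiniteDimensional K g] (π : g →ₗ⁅K⁆ s) (hπ : Function.Surjective π)
    (hsol : IsSolvable π.ker) :
    ∃ σ : s →ₗ⁅K⁆ g, ∀ y, π (σ y) = y := by
  induction hd : finrank K g using Nat.strong_induction_on generalizing g with
  | _ d ih =>
  set R := π.ker with hR
  let A : LieIdeal K g := ⁅R, R⁆
  have hAR : A ≤ R := LieSubmodule.lie_le_left _ _
  let q : g →ₗ⁅K⁆ g ⧸ A := 
    { (LieSubmodule.Quotient.mk' A : g →ₗ[K] g ⧸ A) with
      map_lie' := fun {x y} => LieSubmodule.Quotient.mk_bracket A x y }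
  have hq : Function.Surjective q := LieSubmodule.Quotient.surjective_mk' A
  have hq0 : ∀ x, q x = 0 ↔ x ∈ A := fun x => Submodule.Quotient.mk_eq_zero _
  obtain ⟨π', hπ'⟩ := q.exists_comp_eq_of_surjective hq π
    (fun x hx => LieHom.mem_ker.1 (hAR ((hq0 x).1 hx)))
  obtain ⟨σ', hσ'⟩ := exists_section_of_abelian_ker π'
    (fun y => by obtain ⟨x, rfl⟩ := hπ y; exact ⟨q x, hπ' x⟩) (by
      intro x y hx hy
      obtain ⟨x, rfl⟩ := hq x
      obtain ⟨y, rfl⟩ := hq y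
      rw [hπ'] at hx hy
      rw [← LieHom.map_lie, hq0]
      exact LieSubmodule.lie_mem_lie (LieHom.mem_ker.2 hx) (LieHom.mem_ker.2 hy))
  let k : LieSubalgebra K g := σ'.range.comap q
  have hk : ∀ x, x ∈ k ↔ ∃ y, σ' y = q x := fun x => Iff.rfl
  have hkπ : ∀ y, ∃ x ∈ k, π x = y := by
    intro y
    obtain ⟨x, hx⟩ := hq (σ' y)
    exact ⟨x, ⟨y, hx.symm⟩, by rw [← hπ', hx, hσ']⟩
  by_cases hkt : k = ⊤
  · have hRA : R ≤ A := by
      intro x hx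
      have : x ∈ k := by rw [hkt]; trivial
      obtain ⟨y, hy⟩ := (hk x).1 this
      have h0 : y = 0 := by rw [← hσ' y, hy, hπ']; exact LieHom.mem_ker.1 hx
      rw [← hq0, ← hy, h0, map_zero]
    have hRbot : R = ⊥ := by
      obtain ⟨m, hm⟩ := IsSolvable.solvable K R
      rw [LieIdeal.derivedSeries_eq_bot_iff] at hm
      have hle : ∀ m, R ≤ derivedSeriesOfIdeal K g m R := by
        intro m
        induction m with
        | zero => exact le_rfl
        | succ m ihm =>
          rw [derivedSeriesOfIdeal_succ]
          exact hRA.trans (LieSubmodule.mono_lie ihm ihm)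
      exact eq_bot_iff.2 (hm ▸ hle m)
    refine exists_section_of_abelian_ker π hπ fun x y hx hy => ?_
    have : x ∈ R := LieHom.mem_ker.2 hx
    rw [hRbot] at this
    rw [(LieSubmodule.mem_bot x).1 this, zero_lie]
  · obtain ⟨σ, hσ⟩ := ih (finrank K k) (hd ▸ Submodule.finrank_lt
      (fun h => hkt (LieSubalgebra.toSubmodule_injective h))) (g := k) (π.comp k.incl)
      (fun y => by
        obtain ⟨z, hz, h⟩ := hkπ y
        exact ⟨⟨z, hz⟩, h⟩) (by
      let j : (π.comp k.incl).ker →ₗ⁅K⁆ R :=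
        { toFun := fun x => ⟨x.1.1, LieHom.mem_ker.2 (LieHom.mem_ker.1 x.2)⟩
          map_add' := fun _ _ => rfl
          map_smul' := fun _ _ => rfl
          map_lie' := rfl }
      exact Function.Injective.lieAlgebra_isSolvable (f := j) fun x y h =>
        Subtype.ext (Subtype.ext (congrArg (fun z : R => (z : g)) h))) rfl
    exact ⟨k.incl.comp σ, hσ⟩

end LieAlgebra

end

section

open Module
open scoped RealInnerProductSpace

namespace RootPairing

variable {ι K M N : Type*} [Field K] [AddCommGroup M] [Module K M]
  [AddCommGroup N] [Module K N] (P : RootPairing ι K M N) [P.IsCrystallographic]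

/-- The integral vector of pairings of a root with all coroots, viewed in a Euclidean space. -/
noncomputable def pairingVec (i : ι) : EuclideanSpace ℝ ι :=
  WithLp.toLp 2 fun j => ((P.pairingIn ℤ i j : ℤ) : ℝ)

lemma pairingVec_apply (i j : ι) : P.pairingVec i j = (P.pairingIn ℤ i j : ℤ) := rfl

lemma cast_pairingIn (i j : ι) : ((P.pairingIn ℤ i j : ℤ) : K) = P.pairing i j := by
  simpa using P.algebraMap_pairingIn ℤ i j

lemma inner_pairingVec [Fintype ι] (i j : ι) : ⟪P.pairingVec i, P.pairingVec j⟫ =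
    ((∑ k, P.pairingIn ℤ i k * P.pairingIn ℤ j k : ℤ) : ℝ) := by
  rw [PiLp.inner_apply]
  push_cast
  exact Finset.sum_congr rfl fun k _ => by
    simp [pairingVec_apply, mul_comm]

variable [CharZero K]

lemma pairingVec_linear_relation_iff [P.IsRootSystem] (a b c : ℤ) (i j k : ι) :
    a • P.pairingVec i + b • P.pairingVec j + c • P.pairingVec k = 0 ↔
    a • P.root i + b • P.root j + c • P.root k = 0 := by
  have h1 : a • P.pairingVec i + b • P.pairingVec j + c • P.pairingVec k = 0 ↔
      ∀ l, a * P.pairingIn ℤ i l + b * P.pairingIn ℤ j l + c * P.pairingIn ℤ k l = 0 := by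
    rw [PiLp.ext_iff]
    refine forall_congr' fun l => ?_
    simp only [PiLp.add_apply, PiLp.smul_apply, pairingVec_apply, PiLp.zero_apply, zsmul_eq_mul]
    exact_mod_cast Iff.rfl
  have h2 : a • P.root i + b • P.root j + c • P.root k = 0 ↔
      P.toLinearMap (a • P.root i + b • P.root j + c • P.root k) = 0 :=
    (map_eq_zero_iff _ P.toLinearMap.toPerfPair.injective).symm
  rw [h1, h2]
  have h3 : ∀ l, P.toLinearMap (a • P.root i + b • P.root j + c • P.root k) (P.coroot l) =
      ((a * P.pairingIn ℤ i l + b * P.pairingIn ℤ j l + c * P.pairingIn ℤ k l : ℤ) : K) := by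
    intro l
    push_cast
    simp [cast_pairingIn]
  constructor
  · intro h
    refine LinearMap.ext_on_range (IsRootSystem.span_coroot_eq_top (P := P)) fun l => ?_
    rw [h3, h]; simp
  · intro h l
    have := h3 l
    rw [h, LinearMap.zero_apply] at this
    exact_mod_cast this.symm

lemma pairingVec_injective [P.IsRootSystem] : Function.Injective P.pairingVec := by
  intro i j h
  have := (P.pairingVec_linear_relation_iff 1 (-1) 0 i j i).1 (by simp [h])
  exact P.root.injective (by simpa [← sub_eq_add_neg, sub_eq_zero] using this)

variable [Fintype ι]

lemma two_mul_inner_pairingVec (i j : ι) : 2 * ⟪P.pairingVec j, P.pairingVec i⟫ =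
    (P.pairingIn ℤ j i : ℤ) * ⟪P.pairingVec i, P.pairingVec i⟫ := by
  rw [inner_pairingVec, inner_pairingVec]
  have hform : ∀ i j, P.RootForm (P.root i) (P.root j) =
      ((∑ k, P.pairingIn ℤ i k * P.pairingIn ℤ j k : ℤ) : K) := by
    intro i j
    rw [rootForm_apply_apply]
    push_cast
    simp [cast_pairingIn]
  have h : (P.pairingIn ℤ j i * ∑ k, P.pairingIn ℤ i k * P.pairingIn ℤ i k : ℤ) =
      2 * ∑ k, P.pairingIn ℤ i k * P.pairingIn ℤ j k := by
    have h1 := congrArg (P.toLinearMap (P.root j)) (P.rootForm_self_smul_coroot i)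
    rw [map_smul, map_nsmul, P.toLinearMap_apply_apply_Polarization, hform, hform,
      root_coroot_eq_pairing, ← cast_pairingIn, smul_eq_mul, nsmul_eq_mul] at h1
    rw [mul_comm]
    exact_mod_cast h1
  have h' : (∑ k, P.pairingIn ℤ j k * P.pairingIn ℤ i k) =
      ∑ k, P.pairingIn ℤ i k * P.pairingIn ℤ j k :=
    Finset.sum_congr rfl fun k _ => mul_comm _ _
  rw [h']
  exact_mod_cast h.symm

theorem exists_abelian_finset [P.IsRootSystem] : ∃ S : Finset ι,
    (∀ i ∈ S, ∀ j ∈ S, P.root i + P.root j ≠ 0 ∧ ∀ k, P.root i + P.root j ≠ P.root k) ∧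
    Fintype.card ι ≤ 14 * S.card := by
  classical
  have hΦ : IsRootFinset (Finset.univ.image P.pairingVec) := by
    refine ⟨fun h => ?_, fun α hα β hβ => ?_⟩
    · obtain ⟨i, -, hi⟩ := Finset.mem_image.1 h
      have := (P.pairingVec_linear_relation_iff 1 0 0 i i i).1 (by simp [hi])
      exact P.ne_zero i (by simpa using this)
    · obtain ⟨i, -, rfl⟩ := Finset.mem_image.1 hα
      obtain ⟨j, -, rfl⟩ := Finset.mem_image.1 hβ
      refine ⟨P.pairingIn ℤ i j, P.two_mul_inner_pairingVec j i, Finset.mem_image.2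
        ⟨P.reflectionPerm j i, Finset.mem_univ _, ?_⟩⟩
      have := (P.pairingVec_linear_relation_iff 1 (-1) (P.pairingIn ℤ i j)
        (P.reflectionPerm j i) i j).2 (by
          rw [P.root_reflectionPerm, P.reflection_apply_root' ℤ, one_smul, neg_one_smul]; abel)
      rw [one_smul, neg_one_smul] at this
      rw [← sub_eq_zero, ← this]; abel
  obtain ⟨S, hS, hab, hcard⟩ := hΦ.exists_isAbelian
  rw [Finset.card_image_of_injective _ P.pairingVec_injective, Finset.card_univ] at hcard
  refine ⟨Finset.univ.filter fun i => P.pairingVec i ∈ S, fun i hi j hj => ?_, hcard.trans ?_⟩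
  · obtain ⟨h1, h2⟩ := hab _ (Finset.mem_filter.1 hi).2 _ (Finset.mem_filter.1 hj).2
    refine ⟨fun h => h2 ?_, fun k h => h1 ?_⟩
    · simpa using (P.pairingVec_linear_relation_iff 1 1 0 i j i).2 (by simpa using h)
    · refine Finset.mem_image.2 ⟨k, Finset.mem_univ _, ?_⟩
      have := (P.pairingVec_linear_relation_iff 1 1 (-1) i j k).2 (by simp [h])
      rw [one_smul, one_smul, neg_one_smul, ← sub_eq_add_neg, sub_eq_zero] at this
      exact this.symm
  · gcongr
    rw [← Finset.card_image_of_injective _ P.pairingVec_injective]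
    refine Finset.card_le_card fun x hx => ?_
    obtain ⟨i, -, rfl⟩ := Finset.mem_image.1 (hS hx)
    exact Finset.mem_image_of_mem _ (by simpa using hx)

end RootPairing

end

section

open Module

namespace LieAlgebra

open LieModule

theorem _root_.Submodule.lie_mem_of_span {K L : Type*} [CommRing K] [LieRing L] [LieAlgebra K L]
    {s t : Set L} {P : Submodule K L} (h : ∀ x ∈ s, ∀ y ∈ t, ⁅x, y⁆ ∈ P) {x y : L}
    (hx : x ∈ Submodule.span K s) (hy : y ∈ Submodule.span K t) : ⁅x, y⁆ ∈ P := by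
  induction hx, hy using Submodule.span_induction₂ with
  | mem_mem x y hx hy => exact h x hx y hy
  | zero_left y _ => simp
  | zero_right x _ => simp
  | add_left x y z _ _ _ h1 h2 => rw [add_lie]; exact add_mem h1 h2
  | add_right x y z _ _ _ h1 h2 => rw [lie_add]; exact add_mem h1 h2
  | smul_left r x y _ _ h => rw [smul_lie]; exact P.smul_mem _ h
  | smul_right r x y _ _ h => rw [lie_smul]; exact P.smul_mem _ h

variable {K L : Type*} [Field K] [CharZero K] [LieRing L] [LieAlgebra K L] [FiniteDimensional K L]
  [IsKilling K L] (H : LieSubalgebra K L) [H.IsCartanSubalgebra] [IsTriangularizable K H L]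

theorem IsKilling.exists_isLieAbelian_card_root_le :
    ∃ A : LieSubalgebra K L, IsLieAbelian A ∧ H.root.card ≤ 14 * finrank K A := by
  obtain ⟨S, hS, hcard⟩ := (rootSystem H).exists_abelian_finset
  have he : ∀ i : H.root, ∃ x ∈ rootSpace H i.1, x ≠ 0 := fun i =>
    (Submodule.ne_bot_iff _).1 fun h => i.1.genWeightSpace_ne_bot'
      (LieSubmodule.toSubmodule_eq_bot _ |>.1 h)
  choose e heS he0 using he
  have hlie : ∀ i ∈ S, ∀ j ∈ S, ⁅e i, e j⁆ = 0 := by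
    intro i hi j hj
    obtain ⟨h0, hr⟩ := hS i hi j hj
    have hmem := lie_mem_genWeightSpace_of_mem_genWeightSpace (heS i) (heS j)
    by_contra hne
    let γ : Weight K H L := ⟨i.1 + j.1, fun hbot => hne (by rw [hbot] at hmem; simpa using hmem)⟩
    by_cases hγ : γ.IsZero
    · apply h0
      ext x
      exact congrFun hγ x
    · refine hr ⟨γ, by simpa using hγ⟩ ?_
      ext x
      rfl
  have hspan : ∀ x ∈ Submodule.span K (e '' S), ∀ y ∈ Submodule.span K (e '' S), ⁅x, y⁆ = 0 := by
    intro x hx y hy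
    have := Submodule.lie_mem_of_span (P := ⊥) (s := e '' S) (t := e '' S) (by
      rintro _ ⟨i, hi, rfl⟩ _ ⟨j, hj, rfl⟩
      simpa using hlie i hi j hj) hx hy
    simpa using this
  let A : LieSubalgebra K L :=
    { Submodule.span K (e '' S) with
      lie_mem' := fun {x y} hx hy => by
        rw [hspan x hx y hy]
        exact Submodule.zero_mem _ }
  refine ⟨A, ⟨fun x y => Subtype.ext (hspan x x.2 y y.2)⟩, ?_⟩
  have hli : LinearIndependent K e := by
    refine iSupIndep.linearIndependent (fun i : H.root => (rootSpace H i.1).toSubmodule) ?_ heS he0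
    have := LieSubmodule.iSupIndep_toSubmodule.2 (iSupIndep_genWeightSpace' K H L)
    exact this.comp Subtype.val_injective
  have hA : finrank K A = S.card := by
    have h1 := finrank_span_eq_card (hli.comp (fun i : S => i.1) Subtype.val_injective)
    have h2 : Set.range (e ∘ fun i : S => i.1) = e '' S := by
      rw [Set.range_comp]
      congr 1
      ext
      simp
    rw [h2, Fintype.card_coe] at h1
    exact h1
  rw [hA]
  rwa [Fintype.card_coe] at hcard

theorem IsKilling.exists_isSolvable_finrank_le :
    ∃ b : LieSubalgebra K L, IsSolvable b ∧ 2 * finrank K L ≤ 2 * finrank K b + H.root.card := by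
  classical
  obtain ⟨θ, hθ0, hθ⟩ := exists_linear_functional_pos (k := ℚ) H.root
    (fun χ : Weight K H L => Weight.toLinear K H L χ) (fun χ hχ h => by
      have : χ.IsNonZero := by simpa using hχ
      exact this (by ext x; exact LinearMap.congr_fun h x))
  let h : Weight K H L → ℚ := fun χ => θ (Weight.toLinear K H L χ)
  have hzero : ∀ χ, h χ = 0 → χ.IsZero := by
    intro χ hχ
    by_contra hne
    exact hθ0 χ (by simpa using hne) hχ
  have hadd : ∀ χ ψ ω : Weight K H L, (ω : H → K) = χ + ψ → h ω = h χ + h ψ := by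
    intro χ ψ ω hω
    simp only [h]
    rw [← map_add]
    congr 1
    ext x
    exact congrFun hω x
  let G : ℚ → Set L := fun t => {x | ∃ χ : Weight K H L, t ≤ h χ ∧ x ∈ rootSpace H χ}
  let F : ℚ → Submodule K L := fun t => Submodule.span K (G t)
  have hF : ∀ t u v, (∀ χ ψ : Weight K H L, t ≤ h χ → u ≤ h ψ → ∀ x ∈ rootSpace H χ,
      ∀ y ∈ rootSpace H ψ, ⁅x, y⁆ ≠ 0 → v ≤ h χ + h ψ) →
      ∀ x ∈ F t, ∀ y ∈ F u, ⁅x, y⁆ ∈ F v := by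
    intro t u v hv x hx y hy
    refine Submodule.lie_mem_of_span ?_ hx hy
    rintro x ⟨χ, hχ, hx⟩ y ⟨ψ, hψ, hy⟩
    by_cases hne : ⁅x, y⁆ = 0
    · rw [hne]; exact zero_mem _
    have hmem := lie_mem_genWeightSpace_of_mem_genWeightSpace hx hy
    let γ : Weight K H L := ⟨χ + ψ, fun hbot => hne (by rw [hbot] at hmem; simpa using hmem)⟩
    refine Submodule.subset_span ⟨γ, ?_, hmem⟩
    rw [hadd χ ψ γ rfl]
    exact hv χ ψ hχ hψ x hx y hy hne
  have hFadd : ∀ t u, ∀ x ∈ F t, ∀ y ∈ F u, ⁅x, y⁆ ∈ F (t + u) := fun t u =>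
    hF t u _ fun χ ψ hχ hψ _ _ _ _ _ => add_le_add hχ hψ
  have hmono : ∀ t u, t ≤ u → F u ≤ F t := fun t u htu =>
    Submodule.span_mono fun x ⟨χ, hχ, hx⟩ => ⟨χ, htu.trans hχ, hx⟩
  obtain ⟨m, hm0, hm⟩ : ∃ m : ℚ, 0 < m ∧ ∀ χ, 0 < h χ → m ≤ h χ := by
    by_cases hne : (Finset.univ.filter fun χ => 0 < h χ).Nonempty
    · obtain ⟨χ, hχ, hmin⟩ := Finset.exists_min_image _ h hne
      exact ⟨h χ, by simpa using hχ, fun ψ hψ => hmin ψ (by simpa using hψ)⟩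
    · exact ⟨1, one_pos, fun χ hχ => absurd ⟨χ, by simpa using hχ⟩ hne⟩
  have hFzero : ∀ x ∈ F 0, ∀ y ∈ F 0, ⁅x, y⁆ ∈ F m := by
    refine hF _ _ _ fun χ ψ hχ hψ x hx y hy hne => ?_
    rcases hχ.lt_or_eq with hχ' | hχ'
    · linarith [hm χ hχ']
    rcases hψ.lt_or_eq with hψ' | hψ'
    · linarith [hm ψ hψ']
    exfalso
    apply hne
    have hx' : x ∈ H := by
      rw [(hzero χ hχ'.symm : (χ : H → K) = 0), rootSpace_zero_eq] at hx
      exact hx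
    have hy' : y ∈ H := by
      rw [(hzero ψ hψ'.symm : (ψ : H → K) = 0), rootSpace_zero_eq] at hy
      exact hy
    exact congrArg Subtype.val (trivial_lie_zero H H ⟨x, hx'⟩ ⟨y, hy'⟩)
  obtain ⟨N, hN⟩ : ∃ N : ℕ, F ((N + 1) * m) = ⊥ := by
    obtain ⟨B, hB⟩ := (Finset.univ.image h).bddAbove
    obtain ⟨N, hN⟩ := exists_nat_gt (B / m)
    refine ⟨N, ?_⟩
    rw [Submodule.span_eq_bot]
    rintro x ⟨χ, hχ, -⟩
    have := hB (Finset.mem_coe.2 (Finset.mem_image_of_mem h (Finset.mem_univ χ)))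
    rw [div_lt_iff₀ hm0] at hN
    nlinarith
  let b : LieSubalgebra K L :=
    { F 0 with lie_mem' := fun {x y} hx hy => by simpa using hFadd 0 0 x hx y hy }
  have hder : ∀ k : ℕ, ∀ x : b, x ∈ derivedSeries K b (k + 1) → (x : L) ∈ F ((k + 1) * m) := by
    intro k
    induction k with
    | zero =>
      intro x hx
      rw [derivedSeries_def, derivedSeriesOfIdeal_succ, derivedSeriesOfIdeal_zero,
        ← LieSubmodule.mem_toSubmodule, LieSubmodule.lieIdeal_oper_eq_linear_span'] at hx
      refine Submodule.span_induction (p := fun (x : b) _ => (x : L) ∈ F _) ?_ ?_ ?_ ?_ hx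
      · rintro _ ⟨y, -, z, -, rfl⟩
        simpa using hFzero y y.2 z z.2
      · exact zero_mem _
      · intro y z _ _ hy hz; exact add_mem hy hz
      · intro c y _ hy; exact Submodule.smul_mem _ c hy
    | succ k ih =>
      intro x hx
      rw [derivedSeries_def, derivedSeriesOfIdeal_succ,
        ← LieSubmodule.mem_toSubmodule, LieSubmodule.lieIdeal_oper_eq_linear_span'] at hx
      refine Submodule.span_induction (p := fun (x : b) _ => (x : L) ∈ F _) ?_ ?_ ?_ ?_ hx
      · rintro _ ⟨y, hy, z, hz, rfl⟩
        refine hmono _ _ ?_ (hFadd _ _ y (ih y hy) z (ih z hz))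
        push_cast
        have : (0 : ℚ) ≤ k * m := by positivity
        linarith
      · exact zero_mem _
      · intro y z _ _ hy hz; exact add_mem hy hz
      · intro c y _ hy; exact Submodule.smul_mem _ c hy
  refine ⟨b, (isSolvable_iff K b).2 ⟨N + 1, ?_⟩, ?_⟩
  · rw [LieSubmodule.eq_bot_iff]
    intro x hx
    have := hder N x hx
    rw [hN] at this
    exact Subtype.ext (by simpa using this)
  · have he : ∀ χ ∈ H.root, ∃ x : L, ∀ y ∈ rootSpace H χ, ∃ c : K, c • x = y := by
      intro χ hχ
      obtain ⟨x, -, hx⟩ := finrank_eq_one_iff'.1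
        (finrank_rootSpace_eq_one χ (by simpa using hχ))
      exact ⟨x, fun y hy => (hx ⟨y, hy⟩).imp fun c hc => congrArg Subtype.val hc⟩
    choose! e he using he
    set Q := H.root.filter fun χ => ¬ 0 < h χ with hQ
    have hcard : Q.card + (H.root.filter fun χ => 0 < h χ).card = H.root.card := by
      rw [add_comm]; exact Finset.card_filter_add_card_filter_not _
    have htop : (⊤ : Submodule K L) ≤ F 0 ⊔ Submodule.span K (Q.image e : Set L) := by
      have h1 := iSup_genWeightSpace_eq_top' K H L
      rw [← LieSubmodule.toSubmodule_inj, LieSubmodule.iSup_toSubmodule,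
        LieSubmodule.top_toSubmodule] at h1
      rw [← h1]
      refine iSup_le fun χ x hx => ?_
      by_cases hχ : 0 ≤ h χ
      · exact Submodule.mem_sup_left (Submodule.subset_span ⟨χ, hχ, hx⟩)
      · have hroot : χ ∈ H.root := by
          have : χ.IsNonZero := fun hz => hχ (le_of_eq (by
            have : Weight.toLinear K H L χ = 0 := by ext y; exact congrFun hz y
            simp [h, this]))
          simpa using this
        obtain ⟨c, rfl⟩ := he χ hroot x hx
        refine Submodule.mem_sup_right (Submodule.smul_mem _ _ (Submodule.subset_span ?_))
        exact Finset.mem_image_of_mem _ (Finset.mem_filter.2 ⟨hroot, by linarith⟩)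
    have h2 : finrank K L ≤ finrank K b + Q.card := by
      rw [← finrank_top K L]
      refine (Submodule.finrank_mono htop).trans
        ((Submodule.finrank_add_le_finrank_add_finrank _ _).trans ?_)
      gcongr
      · exact le_rfl
      · exact (finrank_span_finset_le_card _).trans Finset.card_image_le
    have h3 : H.root.card ≤ 2 * (H.root.filter fun χ => 0 < h χ).card := by
      convert hθ
    omega

end LieAlgebra

end

section

open Module

namespace LieAlgebra

theorem isSolvable_of_isSolvable_ker {K M N : Type*} [CommRing K] [LieRing M] [LieAlgebra K M]
    [LieRing N] [LieAlgebra K N] (f : M →ₗ⁅K⁆ N) [IsSolvable N] (hf : IsSolvable f.ker) :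
    IsSolvable M := by
  obtain ⟨k, hk⟩ := (isSolvable_iff K N).1 inferInstance
  obtain ⟨l, hl⟩ := (isSolvable_iff K f.ker).1 hf
  rw [LieIdeal.derivedSeries_eq_bot_iff] at hl
  refine IsSolvable.mk (R := K) (k := l + k) ?_
  have h1 : derivedSeries K M k ≤ f.ker := by
    rw [LieHom.ker, ← LieIdeal.map_le_iff_le_comap, ← hk]
    exact LieIdeal.derivedSeries_map_le k
  rw [derivedSeries_def, derivedSeriesOfIdeal_add, ← le_bot_iff, ← hl]
  exact derivedSeriesOfIdeal_mono h1 l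

theorem isSolvable_of_injective_of_forall_mem {K M g s : Type*} [CommRing K] [LieRing M]
    [LieAlgebra K M] [LieRing g] [LieAlgebra K g] [LieRing s] [LieAlgebra K s]
    (π : g →ₗ⁅K⁆ s) (hπ : IsSolvable π.ker) (b : LieSubalgebra K s) (hb : IsSolvable b)
    (i : M →ₗ⁅K⁆ g) (hi : Function.Injective i) (hib : ∀ x, π (i x) ∈ b) : IsSolvable M := by
  let f : M →ₗ⁅K⁆ b :=
    { (π.comp i : M →ₗ[K] s).codRestrict b.toSubmodule hib with
      map_lie' := fun {x y} => Subtype.ext ((π.comp i).map_lie x y) }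
  have hf : ∀ x : f.ker, i x ∈ π.ker := fun x => by
    have := LieHom.mem_ker.1 x.2
    exact LieHom.mem_ker.2 (congrArg Subtype.val this)
  let j : f.ker →ₗ⁅K⁆ π.ker :=
    { ((i : M →ₗ[K] g) ∘ₗ f.ker.toSubmodule.subtype).codRestrict π.ker.toSubmodule hf with
      map_lie' := fun {x y} => Subtype.ext (i.map_lie x y) }
  have hj : Function.Injective j := fun x y hxy =>
    Subtype.ext (hi (congrArg (fun z : π.ker => (z : g)) hxy))
  exact isSolvable_of_isSolvable_ker f hj.lieAlgebra_isSolvable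

theorem exists_surjective_hasTrivialRadical.{u} (K : Type*) (g : Type u) [CommRing K] [LieRing g]
    [LieAlgebra K g] [IsNoetherian K g] :
    ∃ (s : Type u) (_ : LieRing s) (_ : LieAlgebra K s) (π : g →ₗ⁅K⁆ s),
      Function.Surjective π ∧ IsSolvable π.ker ∧ HasTrivialRadical K s := by
  let π : g →ₗ⁅K⁆ g ⧸ radical K g :=
    { (LieSubmodule.Quotient.mk' (radical K g) : g →ₗ[K] g ⧸ radical K g) with
      map_lie' := fun {x y} => LieSubmodule.Quotient.mk_bracket (radical K g) x y }
  have hπ : Function.Surjective π := LieSubmodule.Quotient.surjective_mk' (radical K g)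
  have hker : π.ker = radical K g := by
    ext x
    rw [LieHom.mem_ker]
    exact Submodule.Quotient.mk_eq_zero _
  have hsol : IsSolvable π.ker := by rw [hker]; infer_instance
  refine ⟨g ⧸ radical K g, inferInstance, inferInstance, π, hπ, hsol,
    hasTrivialRadical_of_no_solvable_ideals fun I hI => ?_⟩
  have hJ : IsSolvable (I.comap π) :=
    isSolvable_of_injective_of_forall_mem π hsol (I : LieSubalgebra K (g ⧸ radical K g)) hI
      (I.comap π).incl Subtype.val_injective fun x => x.2
  rw [LieIdeal.solvable_iff_le_radical] at hJ
  replace hJ : I.comap π ≤ π.ker := hJ.trans_eq hker.symm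
  rw [LieSubmodule.eq_bot_iff]
  intro y hy
  obtain ⟨x, rfl⟩ := hπ y
  exact LieHom.mem_ker.1 (hJ (show π x ∈ I from hy))

theorem exists_map_isLieAbelian {K g s : Type*} [Field K] [LieRing g] [LieAlgebra K g]
    [LieRing s] [LieAlgebra K s] (f : s →ₗ⁅K⁆ g) (hf : Function.Injective f)
    (A : LieSubalgebra K s) (hA : IsLieAbelian A) :
    ∃ B : LieSubalgebra K g, IsLieAbelian B ∧ finrank K B = finrank K A := by
  refine ⟨A.map f, ⟨?_⟩, ?_⟩
  · rintro ⟨_, x, hx, rfl⟩ ⟨_, y, hy, rfl⟩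
    have h : ⁅x, y⁆ = 0 := congrArg Subtype.val (hA.trivial ⟨x, hx⟩ ⟨y, hy⟩)
    refine Subtype.ext ?_
    change ⁅f x, f y⁆ = 0
    rw [← f.map_lie, h]
    exact map_zero (f : s →ₗ[K] g)
  · exact ((A.toSubmodule.equivMapOfInjective (f : s →ₗ[K] g) hf).finrank_eq).symm

end LieAlgebra

end

/-- If `𝔤` is a finite-dimensional complex Lie algebra in which every abelian Lie subalgebra
has dimension at most `n`, then `2 · dim 𝔤 ≤ n² + 17n`. -/
theorem dim_le_of_complex_lie_algebra
    (L : Type*) [LieRing L] [LieAlgebra ℂ L]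
    [FiniteDimensional ℂ L] (n : ℕ)
    (hA : ∀ H : LieSubalgebra ℂ L, IsLieAbelian H → Module.finrank ℂ H ≤ n) :
    2 * Module.finrank ℂ L ≤ n ^ 2 + 17 * n := by
  obtain ⟨s, _, _, π, hπ, hker, hs⟩ := LieAlgebra.exists_surjective_hasTrivialRadical ℂ L
  have : FiniteDimensional ℂ s := Module.Finite.of_surjective (π : L →ₗ[ℂ] s) hπ
  have : LieAlgebra.IsKilling ℂ s := LieAlgebra.HasTrivialRadical.instIsKilling ℂ s
  obtain ⟨σ, hσ⟩ := LieAlgebra.exists_section_of_isSolvable_ker π hπ hker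
  obtain ⟨x, hx⟩ := LieAlgebra.exists_isCartanSubalgebra_engel ℂ s
  obtain ⟨A, hA1, hA2⟩ := LieAlgebra.IsKilling.exists_isLieAbelian_card_root_le
    (LieSubalgebra.engel ℂ x)
  obtain ⟨b, hb1, hb2⟩ := LieAlgebra.IsKilling.exists_isSolvable_finrank_le
    (LieSubalgebra.engel ℂ x)
  obtain ⟨B, hB1, hB2⟩ := LieAlgebra.exists_map_isLieAbelian σ
    (Function.LeftInverse.injective hσ) A hA1
  have hAn := hA B hB1
  have hcomap : LieAlgebra.IsSolvable (b.comap π) :=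
    LieAlgebra.isSolvable_of_injective_of_forall_mem π hker b hb1 (b.comap π).incl
      Subtype.val_injective fun x => x.2
  obtain ⟨C, hC1, hC2⟩ := LieAlgebra.exists_abelian_of_isSolvable (K := ℂ) (b.comap π)
  obtain ⟨D, hD1, hD2⟩ := LieAlgebra.exists_map_isLieAbelian (b.comap π).incl
    Subtype.val_injective C hC1
  have hDn := hA D hD1
  have h1 := LinearMap.finrank_range_add_finrank_ker (π : L →ₗ[ℂ] s)
  rw [LinearMap.range_eq_top.2 hπ, finrank_top] at h1
  have h2 : Module.finrank ℂ (b.comap π) =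
      Module.finrank ℂ b + Module.finrank ℂ (LinearMap.ker (π : L →ₗ[ℂ] s)) := by
    have h3 := LinearMap.finrank_range_add_finrank_ker
      ((π : L →ₗ[ℂ] s).domRestrict (b.comap π).toSubmodule)
    have h4 : LinearMap.ker (π : L →ₗ[ℂ] s) ≤ (b.comap π).toSubmodule := fun y hy =>
      show π y ∈ b from (show π y = 0 from hy) ▸ b.zero_mem
    have h5 : (b.comap π).toSubmodule.map (π : L →ₗ[ℂ] s) = b.toSubmodule :=
      Submodule.map_comap_eq_of_surjective hπ b.toSubmodule
    rw [LinearMap.range_domRestrict, LinearMap.ker_domRestrict, h5,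
      (Submodule.comapSubtypeEquivOfLe h4).finrank_eq] at h3
    exact h3.symm
  rw [hB2] at hAn
  rw [hD2] at hDn
  nlinarith
end

section
/- Let 𝔤 be a finite-dimensional simple Lie algebra over the field ℝ of real numbers satisfying the condition 𝒜(n), i.e. every abelian Lie subalgebra of 𝔤 has dimension at most n. Then dim 𝔤 ≤ 2n² + 15n. -/
section frame

open Module Finset

variable {E : Type*} [NormedAddCommGroup E] [InnerProductSpace ℝ E] {ι : Type*}

/-- The Welch bound: a family of vectors in a space of dimension `D` has large frame potential. -/
lemma sq_sum_norm_sq_le_finrank_mul [FiniteDimensional ℝ E] (s : Finset ι) (f : ι → E) :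
    (∑ i ∈ s, ‖f i‖ ^ 2) ^ 2 ≤ finrank ℝ E * ∑ i ∈ s, ∑ j ∈ s, inner ℝ (f i) (f j) ^ 2 := by
  set b := stdOrthonormalBasis ℝ E
  have inner_eq (x y : E) : inner ℝ x y = ∑ k, inner ℝ (b k) x * inner ℝ (b k) y := by
    rw [← b.sum_inner_mul_inner x y]
    exact sum_congr rfl fun k _ ↦ by rw [real_inner_comm]
  set S : Fin (finrank ℝ E) → Fin (finrank ℝ E) → ℝ :=
    fun k l ↦ ∑ i ∈ s, inner ℝ (b k) (f i) * inner ℝ (b l) (f i) with hS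
  have h1 : ∑ i ∈ s, ‖f i‖ ^ 2 = ∑ k, S k k := by
    simp_rw [hS, ← real_inner_self_eq_norm_sq, inner_eq (f _) (f _)]
    rw [sum_comm]
  have h2 : ∑ i ∈ s, ∑ j ∈ s, inner ℝ (f i) (f j) ^ 2 = ∑ k, ∑ l, S k l ^ 2 := by
    simp_rw [hS, inner_eq (f _) (f _), sq, sum_mul_sum]
    have swap (g : ι → Fin (finrank ℝ E) → Fin (finrank ℝ E) → ℝ) :
        ∑ i ∈ s, ∑ k, ∑ l, g i k l = ∑ k, ∑ l, ∑ i ∈ s, g i k l := by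
      rw [sum_comm]
      exact sum_congr rfl fun k _ ↦ sum_comm
    simp_rw [swap]
    refine sum_congr rfl fun k _ ↦ sum_congr rfl fun l _ ↦ sum_congr rfl fun i _ ↦
      sum_congr rfl fun j _ ↦ by ring
  rw [h1, h2]
  calc (∑ k, S k k) ^ 2 ≤ finrank ℝ E * ∑ k, S k k ^ 2 := by
        simpa using sq_sum_le_card_mul_sum_sq (s := univ) (f := fun k ↦ S k k)
    _ ≤ _ := by
        gcongr with k
        exact single_le_sum (f := fun l ↦ S k l ^ 2) (fun _ _ ↦ sq_nonneg _) (mem_univ k)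

/-- The relative bound for families of vectors of equal length. -/
lemma card_mul_sq_le_finrank_mul [FiniteDimensional ℝ E] (s : Finset ι) (f : ι → E) {c C : ℝ}
    (hC0 : 0 ≤ C) (hc : ∀ i ∈ s, ‖f i‖ ^ 2 = c) (hC : ∀ i ∈ s, ∑ j ∈ s,
      inner ℝ (f i) (f j) ^ 2 ≤ C) :
    #s * c ^ 2 ≤ finrank ℝ E * C := by
  obtain rfl | hs := s.eq_empty_or_nonempty
  · simp only [card_empty, Nat.cast_zero, zero_mul]
    positivity
  have h := sq_sum_norm_sq_le_finrank_mul s f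
  rw [sum_congr rfl hc, sum_const, nsmul_eq_mul] at h
  have h' : ∑ i ∈ s, ∑ j ∈ s, inner ℝ (f i) (f j) ^ 2 ≤ #s * C := by
    simpa using sum_le_sum hC
  have : (0 : ℝ) < #s := by exact_mod_cast hs.card_pos
  have : (#s : ℝ) * (#s * c ^ 2) ≤ #s * (finrank ℝ E * C) := by
    calc _ = (#s * c) ^ 2 := by ring
      _ ≤ _ := h
      _ ≤ finrank ℝ E * (#s * C) := by gcongr
      _ = _ := by ring
  exact le_of_mul_le_mul_left this ‹_›

/-- A Bessel-type inequality (Schur test). -/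
lemma sum_inner_sq_le_of_sum_abs_inner_le (s : Finset ι) (f : ι → E) {C : ℝ}
    (hC0 : 0 ≤ C) (hC : ∀ i ∈ s, ∑ j ∈ s, |inner ℝ (f i) (f j)| ≤ C) (y : E) :
    ∑ i ∈ s, inner ℝ (f i) y ^ 2 ≤ C * ‖y‖ ^ 2 := by
  set a : ι → ℝ := fun i ↦ inner ℝ (f i) y with ha
  set S := ∑ i ∈ s, a i ^ 2 with hS
  set z := ∑ i ∈ s, a i • f i with hz
  have hzy : inner ℝ z y = S := by
    rw [hz, sum_inner]
    exact sum_congr rfl fun i _ ↦ by rw [real_inner_smul_left, sq]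
  have hzz : ‖z‖ ^ 2 ≤ C * S := by
    rw [← real_inner_self_eq_norm_sq, hz, sum_inner]
    simp_rw [inner_sum, real_inner_smul_left, real_inner_smul_right]
    have key : ∀ i ∈ s, ∀ j ∈ s, a i * (a j * inner ℝ (f i) (f j)) ≤
        (a i ^ 2 * |inner ℝ (f i) (f j)|) / 2 + (a j ^ 2 * |inner ℝ (f j) (f i)|) / 2 := by
      intro i _ j _
      rw [real_inner_comm (f i) (f j)]
      set g := inner ℝ (f i) (f j)
      cases abs_cases g <;> nlinarith [sq_nonneg (a i - a j), sq_nonneg (a i + a j)]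
    calc _ ≤ ∑ i ∈ s, ∑ j ∈ s, ((a i ^ 2 * |inner ℝ (f i) (f j)|) / 2 +
            (a j ^ 2 * |inner ℝ (f j) (f i)|) / 2) :=
          sum_le_sum fun i hi ↦ sum_le_sum fun j hj ↦ key i hi j hj
      _ = ∑ i ∈ s, a i ^ 2 * ∑ j ∈ s, |inner ℝ (f i) (f j)| := by
          simp_rw [sum_add_distrib]
          rw [sum_comm (f := fun i j ↦ a j ^ 2 * |inner ℝ (f j) (f i)| / 2), ← sum_add_distrib]
          refine sum_congr rfl fun i _ ↦ ?_
          rw [← sum_add_distrib, mul_sum]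
          exact sum_congr rfl fun j _ ↦ by ring
      _ ≤ ∑ i ∈ s, a i ^ 2 * C := sum_le_sum fun i hi ↦ by gcongr; exact hC i hi
      _ = C * S := by rw [← sum_mul, mul_comm]
  have hS0 : 0 ≤ S := sum_nonneg fun _ _ ↦ sq_nonneg _
  have hcs : S ^ 2 ≤ ‖z‖ ^ 2 * ‖y‖ ^ 2 := by
    rw [← hzy, ← mul_pow]
    exact sq_le_sq.mpr (by simpa [abs_mul] using abs_real_inner_le_norm z y)
  obtain h0 | h0 := hS0.eq_or_lt
  · rw [← h0]; positivity
  · have : S * S ≤ S * (C * ‖y‖ ^ 2) := by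
      calc S * S = S ^ 2 := by ring
        _ ≤ _ := hcs
        _ ≤ (C * S) * ‖y‖ ^ 2 := by gcongr
        _ = _ := by ring
    exact le_of_mul_le_mul_left this h0

/-- Rows of the Gram matrix of a family of vectors along mutually orthogonal lines. -/
lemma sum_abs_inner_le_of_orthogonal_lines (s : Finset ι) (f : ι → E) {c : ℝ} (hc : 0 < c)
    (hn : ∀ i ∈ s, ‖f i‖ ^ 2 = c)
    (h : ∀ i ∈ s, ∀ j ∈ s, i ≠ j → inner ℝ (f i) (f j) = 0 ∨ inner ℝ (f i) (f j) = -c) :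
    ∀ i ∈ s, ∑ j ∈ s, |inner ℝ (f i) (f j)| ≤ 2 * c := by
  classical
  intro i hi
  have hneg {j : ι} (hj : j ∈ s) (hij : inner ℝ (f i) (f j) = -c) : f j = -f i := by
    rw [eq_neg_iff_add_eq_zero, ← norm_eq_zero, ← sq_eq_zero_iff, norm_add_sq_real,
      real_inner_comm, hn i hi, hn j hj, hij]
    ring
  have hone : #{j ∈ s.erase i | inner ℝ (f i) (f j) = -c} ≤ 1 := by
    rw [card_le_one]
    intro j hj k hk
    simp only [mem_filter, mem_erase] at hj hk
    by_contra hjk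
    have := h j hj.1.2 k hk.1.2 hjk
    rw [hneg hj.1.2 hj.2, hneg hk.1.2 hk.2, real_inner_self_eq_norm_sq, norm_neg, hn i hi] at this
    rcases this with h | h <;> linarith
  rw [← add_sum_erase s _ hi, real_inner_self_eq_norm_sq, hn i hi, abs_of_pos hc, two_mul]
  gcongr
  calc ∑ j ∈ s.erase i, |inner ℝ (f i) (f j)|
      = ∑ j ∈ s.erase i, if inner ℝ (f i) (f j) = -c then c else 0 := by
        refine sum_congr rfl fun j hj ↦ ?_
        rw [mem_erase] at hj
        rcases h i hi j hj.2 hj.1.symm with h | h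
        · simp [h, hc.ne']
        · simp [h, hc.le]
    _ = #{j ∈ s.erase i | inner ℝ (f i) (f j) = -c} * c := by
        rw [← sum_filter, sum_const, nsmul_eq_mul]
    _ ≤ 1 * c := by gcongr; exact_mod_cast hone
    _ = c := one_mul c

lemma sum_inner_sq_le_of_orthogonal_lines (s : Finset ι) (f : ι → E) {c : ℝ} (hc : 0 < c)
    (hn : ∀ i ∈ s, ‖f i‖ ^ 2 = c)
    (h : ∀ i ∈ s, ∀ j ∈ s, i ≠ j → inner ℝ (f i) (f j) = 0 ∨ inner ℝ (f i) (f j) = -c) (y : E) :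
    ∑ i ∈ s, inner ℝ (f i) y ^ 2 ≤ 2 * c * ‖y‖ ^ 2 :=
  sum_inner_sq_le_of_sum_abs_inner_le s f (by positivity)
    (sum_abs_inner_le_of_orthogonal_lines s f hc hn h) y

lemma card_le_of_orthogonal_lines [FiniteDimensional ℝ E] (s : Finset ι) (f : ι → E) {c : ℝ}
    (hc : 0 < c) (hn : ∀ i ∈ s, ‖f i‖ ^ 2 = c)
    (h : ∀ i ∈ s, ∀ j ∈ s, i ≠ j → inner ℝ (f i) (f j) = 0 ∨ inner ℝ (f i) (f j) = -c) :
    #s ≤ 2 * finrank ℝ E := by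
  have key := card_mul_sq_le_finrank_mul s f (C := 2 * c * c) (by positivity) hn fun i hi ↦ by
    simpa only [hn i hi,
      real_inner_comm] using sum_inner_sq_le_of_orthogonal_lines s f hc hn h (f i)
  have : (#s : ℝ) * c ^ 2 ≤ (2 * finrank ℝ E : ℝ) * c ^ 2 := by linarith
  exact_mod_cast le_of_mul_le_mul_right this (by positivity)

/-- Vectors whose Gram matrix is `2 • 1` plus the all-ones matrix are linearly independent. -/
lemma card_le_of_inner_eq_one [FiniteDimensional ℝ E] (s : Finset ι) (f : ι → E)
    (hn : ∀ i ∈ s, ‖f i‖ ^ 2 = 3)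
    (h : ∀ i ∈ s, ∀ j ∈ s, i ≠ j → inner ℝ (f i) (f j) = 1) :
    #s ≤ finrank ℝ E := by
  classical
  have hli : LinearIndependent ℝ (fun i : s ↦ f i) := by
    rw [Fintype.linearIndependent_iff]
    intro a ha
    have h0 : inner ℝ (∑ i, a i • f i) (∑ i, a i • f i) = 0 := by rw [ha, inner_zero_left]
    have h1 : inner ℝ (∑ i, a i • f i) (∑ i, a i • f i) = 2 * ∑ i, a i ^ 2 + (∑ i, a i) ^ 2 := by
      simp_rw [sum_inner, inner_sum, real_inner_smul_left, real_inner_smul_right]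
      rw [sq (∑ i, a i), sum_mul_sum, mul_sum, ← sum_add_distrib]
      refine sum_congr rfl fun i _ ↦ ?_
      rw [← sum_erase_add _ _ (mem_univ i),
        ← sum_erase_add univ (fun j ↦ a i * a j) (mem_univ i), real_inner_self_eq_norm_sq,
        hn i i.2, sum_congr rfl fun j hj ↦ by
          rw [h i i.2 j j.2 fun e ↦ (mem_erase.mp hj).1 (Subtype.ext e.symm), mul_one]]
      ring
    have h2 : ∑ i, a i ^ 2 = 0 := by
      have : 0 ≤ ∑ i, a i ^ 2 := sum_nonneg fun _ _ ↦ sq_nonneg _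
      nlinarith [sq_nonneg (∑ i, a i)]
    intro i
    rw [sum_eq_zero_iff_of_nonneg fun _ _ ↦ sq_nonneg _] at h2
    exact sq_eq_zero_iff.mp (h2 i (mem_univ i))
  simpa using hli.fintype_card_le_finrank

section pillar
variable {s : Finset ι} {f : ι → E} {x y z : E}

lemma pillar_aux (hn : ∀ i ∈ s, ‖f i‖ ^ 2 = 3)
    (h : ∀ i ∈ s, ∀ j ∈ s, i ≠ j → inner ℝ (f i) (f j) = 1 ∨ inner ℝ (f i) (f j) = -1)
    (hx : ‖x‖ ^ 2 = 3) (hy : ‖y‖ ^ 2 = 3) (hxy : inner ℝ x y = -1)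
    (h1 : ∀ i ∈ s, inner ℝ (f i) x = 1 ∨ inner ℝ (f i) x = -1)
    (h2 : ∀ i ∈ s, inner ℝ (f i) y = inner ℝ (f i) x) :
    let g : ι → E := fun i ↦ inner ℝ (f i) x • f i - (1 / 2 : ℝ) • (x + y)
    (∀ i ∈ s, ‖g i‖ ^ 2 = 2) ∧
      ∀ i ∈ s, ∀ j ∈ s, i ≠ j → inner ℝ (g i) (g j) = 0 ∨ inner ℝ (g i) (g j) = -2 := by
  intro g
  have hx' : inner ℝ x x = 3 := by rw [real_inner_self_eq_norm_sq, hx]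
  have hy' : inner ℝ y y = 3 := by rw [real_inner_self_eq_norm_sq, hy]
  have key (i j) (hi : i ∈ s) (hj : j ∈ s) : inner ℝ (g i) (g j) =
      inner ℝ (f i) x * inner ℝ (f j) x * inner ℝ (f i) (f j) - 1 := by
    have e1 : inner ℝ (f i) x ^ 2 = 1 := by rcases h1 i hi with e | e <;> rw [e] <;> norm_num
    have e2 : inner ℝ (f j) x ^ 2 = 1 := by rcases h1 j hj with e | e <;> rw [e] <;> norm_num
    simp only [g, inner_sub_left, inner_sub_right, inner_add_left, inner_add_right,
      real_inner_smul_left, real_inner_smul_right, hx', hy', hxy, h2 i hi,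
        real_inner_comm (f j) x, real_inner_comm (f j) y, real_inner_comm x y, h2 j hj]
    linear_combination (-1 : ℝ) * e1 - e2
  refine ⟨fun i hi ↦ ?_, fun i hi j hj hij ↦ ?_⟩
  · rw [← real_inner_self_eq_norm_sq, key i i hi hi, real_inner_self_eq_norm_sq, hn i hi]
    rcases h1 i hi with e | e <;> rw [e] <;> norm_num
  · rw [key i j hi hj]
    rcases h1 i hi with e | e <;> rcases h1 j hj with e' | e' <;> rcases h i hi j hj hij with k | k <;>
      rw [e, e', k] <;> norm_num

lemma card_pillar_le [FiniteDimensional ℝ E] (hn : ∀ i ∈ s, ‖f i‖ ^ 2 = 3)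
    (h : ∀ i ∈ s, ∀ j ∈ s, i ≠ j → inner ℝ (f i) (f j) = 1 ∨ inner ℝ (f i) (f j) = -1)
    (hx : ‖x‖ ^ 2 = 3) (hy : ‖y‖ ^ 2 = 3) (hxy : inner ℝ x y = -1)
    (h1 : ∀ i ∈ s, inner ℝ (f i) x = 1 ∨ inner ℝ (f i) x = -1)
    (h2 : ∀ i ∈ s, inner ℝ (f i) y = inner ℝ (f i) x) :
    #s ≤ 2 * finrank ℝ E :=
  have key := pillar_aux hn h hx hy hxy h1 h2
  card_le_of_orthogonal_lines s _ two_pos key.1 key.2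

lemma card_pillar_le_eight (hn : ∀ i ∈ s, ‖f i‖ ^ 2 = 3)
    (h : ∀ i ∈ s, ∀ j ∈ s, i ≠ j → inner ℝ (f i) (f j) = 1 ∨ inner ℝ (f i) (f j) = -1)
    (hx : ‖x‖ ^ 2 = 3) (hy : ‖y‖ ^ 2 = 3) (hz : ‖z‖ ^ 2 = 3) (hxy : inner ℝ x y = -1)
    (hxz : inner ℝ x z = -1) (hyz : inner ℝ y z = -1)
    (h1 : ∀ i ∈ s, inner ℝ (f i) x = 1 ∨ inner ℝ (f i) x = -1)
    (h2 : ∀ i ∈ s, inner ℝ (f i) y = inner ℝ (f i) x)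
    (h3 : ∀ i ∈ s, inner ℝ (f i) z = -inner ℝ (f i) x)
    {w : E} (hw : ‖w‖ ^ 2 = 3) (hwf : ∀ i ∈ s, inner ℝ (f i) w = 1 ∨ inner ℝ (f i) w = -1)
    (hw1 : inner ℝ w x = 1 ∨ inner ℝ w x = -1) (hw2 : inner ℝ w z = inner ℝ w x)
    (hw3 : inner ℝ w y = -inner ℝ w x) : #s ≤ 8 := by
  have hx' : inner ℝ x x = 3 := by rw [real_inner_self_eq_norm_sq, hx]
  have hz' : inner ℝ z z = 3 := by rw [real_inner_self_eq_norm_sq, hz]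
  have hw' : inner ℝ w w = 3 := by rw [real_inner_self_eq_norm_sq, hw]
  have key := pillar_aux hn h hx hy hxy h1 h2
  have hb := sum_inner_sq_le_of_orthogonal_lines s _ two_pos key.1 key.2
    (w - (inner ℝ w x / 2) • (x + z))
  have hnorm : ‖w - (inner ℝ w x / 2) • (x + z)‖ ^ 2 = 2 := by
    rw [← real_inner_self_eq_norm_sq]
    simp only [inner_sub_left, inner_sub_right, inner_add_left, inner_add_right,
      real_inner_smul_left, real_inner_smul_right, hx', hz', hxz,
      real_inner_comm w x, real_inner_comm w z, real_inner_comm x z, hw', hw2]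
    rcases hw1 with e | e <;> rw [e] <;> norm_num
  rw [hnorm, sum_congr rfl (g := fun _ ↦ 1)] at hb
  · rw [sum_const, nsmul_one] at hb
    norm_num at hb
    exact_mod_cast hb
  · intro i hi
    simp only [inner_sub_left, inner_sub_right, inner_add_left, inner_add_right,
      real_inner_smul_left, real_inner_smul_right, hx', hxz, hxy, hyz, real_inner_comm w x,
        real_inner_comm w y, real_inner_comm x y, hw3,
      h3 i hi]
    rcases hw1 with e | e <;> rcases h1 i hi with e' | e' <;> rcases hwf i hi with k | k <;>
      rw [e, e', k] <;> norm_num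

end pillar

/-- The three-pillar bound: a family of equiangular lines containing three vectors with pairwise
inner product `-1` (up to sign) has size at most `max (2 D + 1) 25`. -/
lemma card_le_of_negative_triple [FiniteDimensional ℝ E] (s : Finset ι) (f : ι → E)
    (hn : ∀ i ∈ s, ‖f i‖ ^ 2 = 3)
    (h : ∀ i ∈ s, ∀ j ∈ s, i ≠ j → inner ℝ (f i) (f j) = 1 ∨ inner ℝ (f i) (f j) = -1)
    {x y z : E} (hx : ‖x‖ ^ 2 = 3) (hy : ‖y‖ ^ 2 = 3) (hz : ‖z‖ ^ 2 = 3)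
    (hxy : inner ℝ x y = -1) (hxz : inner ℝ x z = -1) (hyz : inner ℝ y z = -1)
    (h1 : ∀ i ∈ s, inner ℝ (f i) x = 1 ∨ inner ℝ (f i) x = -1)
    (h2 : ∀ i ∈ s, inner ℝ (f i) y = 1 ∨ inner ℝ (f i) y = -1)
    (h3 : ∀ i ∈ s, inner ℝ (f i) z = 1 ∨ inner ℝ (f i) z = -1) :
    #s ≤ max (2 * finrank ℝ E + 1) 25 := by
  classical
  set A := {i ∈ s | inner ℝ (f i) y = inner ℝ (f i) x ∧ inner ℝ (f i) z = -inner ℝ (f i) x}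
    with hA
  set B := {i ∈ s | inner ℝ (f i) z = inner ℝ (f i) x ∧ inner ℝ (f i) y = -inner ℝ (f i) x}
    with hB
  set C := {i ∈ s | inner ℝ (f i) z = inner ℝ (f i) y ∧ inner ℝ (f i) x = -inner ℝ (f i) y}
    with hC
  set Q := {i ∈ s | inner ℝ (f i) y = inner ℝ (f i) x ∧ inner ℝ (f i) z = inner ℝ (f i) x}
    with hQ
  have hsub : s ⊆ Q ∪ (A ∪ (B ∪ C)) := by
    intro i hi
    simp only [hA, hB, hC, hQ, mem_union, mem_filter, hi, true_and]
    rcases h1 i hi with e1 | e1 <;> rcases h2 i hi with e2 | e2 <;> rcases h3 i hi with e3 | e3 <;>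
      simp [e1, e2, e3]
  have hcard : #s ≤ #Q + (#A + (#B + #C)) :=
    (card_le_card hsub).trans <| (card_union_le _ _).trans <| Nat.add_le_add_left
      ((card_union_le _ _).trans <| Nat.add_le_add_left (card_union_le _ _) _) _
  have hQ1 : #Q ≤ 1 := by
    have hQ' (i) (hi : i ∈ Q) : f i = inner ℝ (f i) x • (x + y + z) := by
      simp only [hQ, mem_filter] at hi
      have hx' : inner ℝ x x = 3 := by rw [real_inner_self_eq_norm_sq, hx]
      have hy' : inner ℝ y y = 3 := by rw [real_inner_self_eq_norm_sq, hy]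
      have hz' : inner ℝ z z = 3 := by rw [real_inner_self_eq_norm_sq, hz]
      have hf' : inner ℝ (f i) (f i) = 3 := by rw [real_inner_self_eq_norm_sq, hn i hi.1]
      rw [← sub_eq_zero, ← inner_self_eq_zero (𝕜 := ℝ)]
      simp only [inner_sub_left, inner_sub_right, inner_add_left, inner_add_right,
        real_inner_smul_left, real_inner_smul_right, hx', hy', hz', hf', hxy, hxz, hyz,
        real_inner_comm x y, real_inner_comm x z, real_inner_comm y z, real_inner_comm (f i) x,
        real_inner_comm (f i) y, real_inner_comm (f i) z, hi.2.1, hi.2.2]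
      rcases h1 i hi.1 with e | e <;> rw [e] <;> norm_num
    rw [card_le_one]
    intro i hi j hj
    by_contra hij
    have hi' := (mem_filter.mp hi).1
    have hj' := (mem_filter.mp hj).1
    have e1 := hQ' i hi
    have e2 := hQ' j hj
    have hii := hn i hi'
    rw [← real_inner_self_eq_norm_sq] at hii
    have hji : f j = f i ∨ f j = -f i := by
      rw [e1, e2]
      generalize x + y + z = w
      rcases h1 i hi' with e | e <;> rcases h1 j hj' with e' | e' <;> simp [e, e']
    rcases hji with e | e <;> rcases h i hi' j hj' hij with k | k <;>
      simp only [e, inner_neg_right, hii] at k <;> norm_num at k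
  have hsA : ∀ i ∈ A, i ∈ s := fun i hi ↦ (mem_filter.mp hi).1
  have hsB : ∀ i ∈ B, i ∈ s := fun i hi ↦ (mem_filter.mp hi).1
  have hsC : ∀ i ∈ C, i ∈ s := fun i hi ↦ (mem_filter.mp hi).1
  have hyx : inner ℝ y x = -1 := by rw [real_inner_comm, hxy]
  have hzx : inner ℝ z x = -1 := by rw [real_inner_comm, hxz]
  have hzy : inner ℝ z y = -1 := by rw [real_inner_comm, hyz]
  have hAD : #A ≤ 2 * finrank ℝ E := card_pillar_le (fun i hi ↦ hn i (hsA i hi))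
    (fun i hi j hj ↦ h i (hsA i hi) j (hsA j hj)) hx hy hxy (fun i hi ↦ h1 i (hsA i hi))
    fun i hi ↦ (mem_filter.mp hi).2.1
  have hBD : #B ≤ 2 * finrank ℝ E := card_pillar_le (fun i hi ↦ hn i (hsB i hi))
    (fun i hi j hj ↦ h i (hsB i hi) j (hsB j hj)) hx hz hxz (fun i hi ↦ h1 i (hsB i hi))
    fun i hi ↦ (mem_filter.mp hi).2.1
  have hCD : #C ≤ 2 * finrank ℝ E := card_pillar_le (fun i hi ↦ hn i (hsC i hi))
    (fun i hi j hj ↦ h i (hsC i hi) j (hsC j hj)) hy hz hyz (fun i hi ↦ h2 i (hsC i hi))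
    fun i hi ↦ (mem_filter.mp hi).2.1
  have cross {P R : Finset ι} (hP : ∀ i ∈ P, i ∈ s) (hR : ∀ i ∈ R, i ∈ s) {x y z : E}
      (hx : ‖x‖ ^ 2 = 3) (hy : ‖y‖ ^ 2 = 3) (hz : ‖z‖ ^ 2 = 3)
      (hxy : inner ℝ x y = -1) (hxz : inner ℝ x z = -1) (hyz : inner ℝ y z = -1)
      (h1 : ∀ i ∈ s, inner ℝ (f i) x = 1 ∨ inner ℝ (f i) x = -1)
      (hP1 : ∀ i ∈ P, inner ℝ (f i) y = inner ℝ (f i) x)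
      (hP2 : ∀ i ∈ P, inner ℝ (f i) z = -inner ℝ (f i) x)
      (hR1 : ∀ i ∈ R, inner ℝ (f i) z = inner ℝ (f i) x)
      (hR2 : ∀ i ∈ R, inner ℝ (f i) y = -inner ℝ (f i) x) (hne : R.Nonempty) : #P ≤ 8 := by
    obtain ⟨j, hj⟩ := hne
    refine card_pillar_le_eight (fun i hi ↦ hn i (hP i hi))
      (fun i hi j hj ↦ h i (hP i hi) j (hP j hj)) hx hy hz hxy hxz hyz (fun i hi ↦ h1 i (hP i hi))
      hP1 hP2 (hn j (hR j hj)) (fun i hi ↦ h i (hP i hi) j (hR j hj) ?_) (h1 j (hR j hj))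
      (hR1 j hj) (hR2 j hj)
    rintro rfl
    have e1 := hP1 i hi
    have e2 := hR2 i hj
    rcases h1 i (hP i hi) with e | e <;> linarith
  have fA (i) (hi : i ∈ A) := (mem_filter.mp hi).2
  have fB (i) (hi : i ∈ B) := (mem_filter.mp hi).2
  have fC (i) (hi : i ∈ C) := (mem_filter.mp hi).2
  have cAB : B.Nonempty → #A ≤ 8 := cross hsA hsB hx hy hz hxy hxz hyz h1
    (fun i hi ↦ (fA i hi).1) (fun i hi ↦ (fA i hi).2) (fun i hi ↦ (fB i hi).1)
    (fun i hi ↦ (fB i hi).2)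
  have cBA : A.Nonempty → #B ≤ 8 := cross hsB hsA hx hz hy hxz hxy hzy h1
    (fun i hi ↦ (fB i hi).1) (fun i hi ↦ (fB i hi).2) (fun i hi ↦ (fA i hi).1)
    (fun i hi ↦ (fA i hi).2)
  have cAC : C.Nonempty → #A ≤ 8 := cross hsA hsC hy hx hz hyx hyz hxz h2
    (fun i hi ↦ (fA i hi).1.symm) (fun i hi ↦ by rw [(fA i hi).1, (fA i hi).2])
    (fun i hi ↦ (fC i hi).1) (fun i hi ↦ (fC i hi).2)
  have cCA : A.Nonempty → #C ≤ 8 := cross hsC hsA hy hz hx hyz hyx hzx h2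
    (fun i hi ↦ (fC i hi).1) (fun i hi ↦ (fC i hi).2) (fun i hi ↦ (fA i hi).1.symm)
    (fun i hi ↦ by rw [(fA i hi).1, (fA i hi).2])
  have cBC : C.Nonempty → #B ≤ 8 := cross hsB hsC hz hx hy hzx hzy hxy h3
    (fun i hi ↦ (fB i hi).1.symm) (fun i hi ↦ by rw [(fB i hi).1, (fB i hi).2])
    (fun i hi ↦ (fC i hi).1.symm) (fun i hi ↦ by rw [(fC i hi).1, (fC i hi).2])
  have cCB : B.Nonempty → #C ≤ 8 := cross hsC hsB hz hy hx hzy hzx hyx h3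
    (fun i hi ↦ (fC i hi).1.symm) (fun i hi ↦ by rw [(fC i hi).1, (fC i hi).2])
    (fun i hi ↦ (fB i hi).1.symm) (fun i hi ↦ by rw [(fB i hi).1, (fB i hi).2])
  simp only [← card_pos] at cAB cBA cAC cCA cBC cCB
  lia

/-- A bound for the number of equiangular lines with angle `arccos (1 / 3)`. -/
lemma card_le_of_equiangular [FiniteDimensional ℝ E] (s : Finset ι) (f : ι → E)
    (hn : ∀ i ∈ s, ‖f i‖ ^ 2 = 3)
    (h : ∀ i ∈ s, ∀ j ∈ s, i ≠ j → inner ℝ (f i) (f j) = 1 ∨ inner ℝ (f i) (f j) = -1) :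
    #s ≤ 2 * finrank ℝ E + 14 := by
  classical
  rcases le_or_gt (finrank ℝ E) 7 with hD | hD
  · have key := card_mul_sq_le_finrank_mul s f (c := 3) (C := #s + 8) (by positivity) hn
      fun i hi ↦ by
        rw [← add_sum_erase s _ hi, real_inner_self_eq_norm_sq, hn i hi,
          sum_congr rfl (g := fun _ ↦ 1), sum_const, nsmul_one, card_erase_of_mem hi,
          Nat.cast_sub (card_pos.mpr ⟨i, hi⟩)]
        · push_cast
          linarith
        · intro j hj
          rw [mem_erase] at hj
          rcases h i hi j hj.2 hj.1.symm with e | e <;> rw [e] <;> norm_num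
    have key' : #s * 9 ≤ finrank ℝ E * (#s + 8) := by
      norm_num at key
      exact_mod_cast key
    generalize finrank ℝ E = D at *
    interval_cases D <;> lia
  · have hsymm (i j) (hi : i ∈ s) (hj : j ∈ s) (hij : i ≠ j) :
        inner ℝ (f i) (f j) ^ 2 = 1 := by
      rcases h i hi j hj hij with e | e <;> rw [e] <;> norm_num
    by_cases htri : ∃ i ∈ s, ∃ j ∈ s, ∃ k ∈ s, i ≠ j ∧ i ≠ k ∧ j ≠ k ∧
        inner ℝ (f i) (f j) * inner ℝ (f i) (f k) * inner ℝ (f j) (f k) = -1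
    · obtain ⟨i, hi, j, hj, k, hk, hij, hik, hjk, hprod⟩ := htri
      have hs : #s ≤ #(((s.erase i).erase j).erase k) + 3 := by
        have := pred_card_le_card_erase (s := s) (a := i)
        have := pred_card_le_card_erase (s := s.erase i) (a := j)
        have := pred_card_le_card_erase (s := (s.erase i).erase j) (a := k)
        lia
      have hmem {l} (hl : l ∈ ((s.erase i).erase j).erase k) : l ∈ s ∧ l ≠ i ∧ l ≠ j ∧ l ≠ k := by
        simp only [mem_erase] at hl
        tauto
      have hsign {l m} (hl : l ∈ s) (hm : m ∈ s) (hlm : l ≠ m) {t : ℝ} (ht : t = 1 ∨ t = -1) :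
          inner ℝ (f l) (-t • f m) = 1 ∨ inner ℝ (f l) (-t • f m) = -1 := by
        rw [real_inner_smul_right]
        rcases ht with e | e <;> rcases h l hl m hm hlm with e' | e' <;> rw [e, e'] <;> norm_num
      have hnorm {m} (hm : m ∈ s) {t : ℝ} (ht : t = 1 ∨ t = -1) : ‖-t • f m‖ ^ 2 = 3 := by
        rcases ht with e | e <;> simp [e, hn m hm]
      have tij := h i hi j hj hij
      have tik := h i hi k hk hik
      have key := card_le_of_negative_triple (((s.erase i).erase j).erase k) f
        (fun l hl ↦ hn l (hmem hl).1) (fun l hl m hm ↦ h l (hmem hl).1 m (hmem hm).1)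
        (hn i hi) (hnorm hj tij) (hnorm hk tik)
        (by rw [real_inner_smul_right]; linarith [hsymm i j hi hj hij])
        (by rw [real_inner_smul_right]; linarith [hsymm i k hi hk hik])
        (by rw [real_inner_smul_right, real_inner_smul_left]; linarith)
        (fun l hl ↦ h l (hmem hl).1 i hi (hmem hl).2.1)
        (fun l hl ↦ hsign (hmem hl).1 hj (hmem hl).2.2.1 tij)
        (fun l hl ↦ hsign (hmem hl).1 hk (hmem hl).2.2.2 tik)
      lia
    · push Not at htri
      obtain rfl | ⟨i, hi⟩ := s.eq_empty_or_nonempty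
      · simp
      have key := card_le_of_inner_eq_one (s.erase i) (fun j ↦ inner ℝ (f i) (f j) • f j)
        (fun j hj ↦ by
          rw [mem_erase] at hj
          rcases h i hi j hj.2 hj.1.symm with e | e <;> simp [e, hn j hj.2])
        (fun j hj k hk hjk ↦ by
          rw [mem_erase] at hj hk
          have := htri i hi j hj.2 k hk.2 hj.1.symm hk.1.symm hjk
          rw [real_inner_smul_left, real_inner_smul_right]
          rcases h i hi j hj.2 hj.1.symm with e | e <;> rcases h i hi k hk.2 hk.1.symm with e' | e' <;>
            rcases h j hj.2 k hk.2 hjk with e'' | e'' <;>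
            first
            | rw [e, e', e'']; norm_num; done
            | exact absurd (by rw [e, e', e'']; norm_num) this)
      have := pred_card_le_card_erase (s := s) (a := i)
      lia
end frame

section unitRoots

open Module Finset

variable {E F : Type*} [NormedAddCommGroup E] [InnerProductSpace ℝ E]
  [NormedAddCommGroup F] [InnerProductSpace ℝ F]

/-- A finite set of unit vectors which is closed under the reflections in its elements, and which
has the crystallographic property `4 ⟪u, v⟫² ∈ ℕ`; such as the normalized roots of a root system. -/
structure IsUnitRootSet (Ψ : Finset E) : Prop where
  norm_eq_one : ∀ v ∈ Ψ, ‖v‖ = 1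
  reflection_mem : ∀ u ∈ Ψ, ∀ v ∈ Ψ, v - (2 * inner ℝ u v) • u ∈ Ψ
  exists_nat : ∀ u ∈ Ψ, ∀ v ∈ Ψ, ∃ n : ℕ, 4 * inner ℝ u v ^ 2 = n

namespace IsUnitRootSet

variable {Ψ : Finset E} {a u v w : E}

lemma exists_nat_le (h : IsUnitRootSet Ψ) (hu : u ∈ Ψ) (hv : v ∈ Ψ) :
    ∃ n : ℕ, n ≤ 4 ∧ 4 * inner ℝ u v ^ 2 = n := by
  obtain ⟨n, hn⟩ := h.exists_nat u hu v hv
  refine ⟨n, ?_, hn⟩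
  have h1 : |inner ℝ u v| ≤ 1 := by
    simpa [h.norm_eq_one u hu, h.norm_eq_one v hv] using abs_real_inner_le_norm u v
  have h2 : inner ℝ u v ^ 2 ≤ 1 := (sq_le_one_iff_abs_le_one _).mpr h1
  have : (n : ℝ) ≤ 4 := by linarith
  exact_mod_cast this

/-- The inner product of `v` and of `w` reflected in `a` gives a second integrality condition. -/
lemma exists_nat_nat (h : IsUnitRootSet Ψ) (ha : a ∈ Ψ) (hv : v ∈ Ψ) (hw : w ∈ Ψ) :
    ∃ n m : ℕ, n ≤ 4 ∧ m ≤ 4 ∧ 4 * inner ℝ v w ^ 2 = n ∧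
      4 * (inner ℝ v w - 2 * (inner ℝ a v * inner ℝ a w)) ^ 2 = m := by
  obtain ⟨n, hn, hn'⟩ := h.exists_nat_le hv hw
  obtain ⟨m, hm, hm'⟩ := h.exists_nat_le hv (h.reflection_mem a ha w hw)
  refine ⟨n, m, hn, hm, hn', ?_⟩
  rw [← hm', inner_sub_right, real_inner_smul_right, real_inner_comm a v]
  ring

lemma inner_ne_one (h : IsUnitRootSet Ψ) (hv : v ∈ Ψ) (hw : w ∈ Ψ) (hvw : v ≠ w) :
    inner ℝ v w ≠ 1 := fun e ↦
  hvw <| (inner_eq_one_iff_of_norm_eq_one (h.norm_eq_one v hv) (h.norm_eq_one w hw)).mp e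

lemma neg_mem (h : IsUnitRootSet Ψ) (ha : a ∈ Ψ) : -a ∈ Ψ := by
  have := h.reflection_mem a ha a ha
  rw [real_inner_self_eq_norm_sq, h.norm_eq_one a ha] at this
  convert this using 1
  module

/-- The elements `v` of `Ψ` with `⟪a, v⟫ = √k / 2`. -/
noncomputable def layer (Ψ : Finset E) (a : E) (k : ℝ) : Finset E :=
  {v ∈ Ψ | 0 < inner ℝ a v ∧ 4 * inner ℝ a v ^ 2 = k}

lemma mem_layer {k : ℝ} : v ∈ layer Ψ a k ↔ v ∈ Ψ ∧ 0 < inner ℝ a v ∧ 4 * inner ℝ a v ^ 2 = k :=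
  mem_filter

lemma mem_of_mem_layer {k : ℝ} (hv : v ∈ layer Ψ a k) : v ∈ Ψ := (mem_layer.mp hv).1

lemma inner_of_mem_layer_one (hv : v ∈ layer Ψ a 1) : inner ℝ a v = 1 / 2 := by
  obtain ⟨-, h1, h2⟩ := mem_layer.mp hv
  nlinarith

lemma inner_mul_inner_of_mem_layer {k : ℝ} (hv : v ∈ layer Ψ a k)
    (hw : w ∈ layer Ψ a k) : inner ℝ a v * inner ℝ a w = k / 4 := by
  obtain ⟨-, h1, h2⟩ := mem_layer.mp hv
  obtain ⟨-, h3, h4⟩ := mem_layer.mp hw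
  have : inner ℝ a v = inner ℝ a w := by
    rw [← sq_eq_sq₀ h1.le h3.le]; linarith
  rw [← this]
  linarith

lemma inner_layer_one (h : IsUnitRootSet Ψ) (ha : a ∈ Ψ) (hv : v ∈ layer Ψ a 1)
    (hw : w ∈ layer Ψ a 1) (hvw : v ≠ w) :
    inner ℝ v w = 0 ∨ inner ℝ v w = 1 / 2 ∨ inner ℝ v w = -1 / 2 := by
  have hx := h.inner_ne_one (mem_of_mem_layer hv) (mem_of_mem_layer hw) hvw
  obtain ⟨n, m, hn, hm, e1, e2⟩ := h.exists_nat_nat ha (mem_of_mem_layer hv) (mem_of_mem_layer hw)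
  rw [inner_mul_inner_of_mem_layer hv hw] at e2
  generalize inner ℝ v w = x at *
  have e3 : x = (n + 1 - m) / 4 := by linarith
  subst e3
  interval_cases n <;> interval_cases m <;> norm_num at *

lemma inner_layer_two (h : IsUnitRootSet Ψ) (ha : a ∈ Ψ) (hv : v ∈ layer Ψ a 2)
    (hw : w ∈ layer Ψ a 2) (hvw : v ≠ w) :
    inner ℝ v w = 0 ∨ inner ℝ v w = 1 / 2 := by
  have hx := h.inner_ne_one (mem_of_mem_layer hv) (mem_of_mem_layer hw) hvw
  obtain ⟨n, m, hn, hm, e1, e2⟩ := h.exists_nat_nat ha (mem_of_mem_layer hv) (mem_of_mem_layer hw)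
  rw [inner_mul_inner_of_mem_layer hv hw] at e2
  generalize inner ℝ v w = x at *
  have e3 : x = (n + 4 - m) / 8 := by linarith
  subst e3
  interval_cases n <;> interval_cases m <;> norm_num at *

lemma inner_layer_three (h : IsUnitRootSet Ψ) (ha : a ∈ Ψ) (hv : v ∈ layer Ψ a 3)
    (hw : w ∈ layer Ψ a 3) (hvw : v ≠ w) : inner ℝ v w = 1 / 2 := by
  have hx := h.inner_ne_one (mem_of_mem_layer hv) (mem_of_mem_layer hw) hvw
  obtain ⟨n, m, hn, hm, e1, e2⟩ := h.exists_nat_nat ha (mem_of_mem_layer hv) (mem_of_mem_layer hw)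
  rw [inner_mul_inner_of_mem_layer hv hw] at e2
  generalize inner ℝ v w = x at *
  have e3 : x = (n + 9 - m) / 12 := by linarith
  subst e3
  interval_cases n <;> interval_cases m <;> norm_num at *

lemma inner_layer_one_two (h : IsUnitRootSet Ψ) (ha : a ∈ Ψ) (hv : v ∈ layer Ψ a 1)
    (hw : w ∈ layer Ψ a 2) : inner ℝ v w = 0 ∨ inner ℝ v w = inner ℝ a w := by
  obtain ⟨n, m, hn, hm, e1, e2⟩ := h.exists_nat_nat ha (mem_of_mem_layer hv) (mem_of_mem_layer hw)
  obtain ⟨-, h3, h4⟩ := mem_layer.mp hw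
  rw [inner_of_mem_layer_one hv] at e2
  generalize inner ℝ v w = x at *
  generalize inner ℝ a w = β at *
  have e3 : x * β = (n + 2 - m) / 8 := by linarith
  have e4 : (x * β) ^ 2 = n / 8 := by
    rw [mul_pow]; linear_combination (1 / 4) * x ^ 2 * h4 + (1 / 8) * e1
  rw [e3] at e4
  have e5 : x * β = 0 ∨ x * β = 1 / 2 := by
    rw [e3]
    interval_cases n <;> interval_cases m <;> norm_num at *
  refine e5.imp (fun e ↦ by simpa [h3.ne'] using e) fun e ↦ ?_
  have : (x - β) * β = 0 := by linarith
  simpa [h3.ne', sub_eq_zero] using this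

lemma inner_layer_one_three (h : IsUnitRootSet Ψ) (ha : a ∈ Ψ) (hv : v ∈ layer Ψ a 1)
    (hw : w ∈ layer Ψ a 3) : inner ℝ v w = 0 ∨ inner ℝ v w = inner ℝ a w := by
  obtain ⟨n, m, hn, hm, e1, e2⟩ := h.exists_nat_nat ha (mem_of_mem_layer hv) (mem_of_mem_layer hw)
  obtain ⟨-, h3, h4⟩ := mem_layer.mp hw
  rw [inner_of_mem_layer_one hv] at e2
  generalize inner ℝ v w = x at *
  generalize inner ℝ a w = β at *
  have e3 : x * β = (n + 3 - m) / 8 := by linarith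
  have e4 : (x * β) ^ 2 = 3 * n / 16 := by
    rw [mul_pow]; linear_combination (1 / 4) * x ^ 2 * h4 + (3 / 16) * e1
  rw [e3] at e4
  have e5 : x * β = 0 ∨ x * β = 3 / 4 := by
    rw [e3]
    interval_cases n <;> interval_cases m <;> norm_num at *
  refine e5.imp (fun e ↦ by simpa [h3.ne'] using e) fun e ↦ ?_
  have : (x - β) * β = 0 := by linarith
  simpa [h3.ne', sub_eq_zero] using this

lemma layer_two_eq_empty (h : IsUnitRootSet Ψ) (ha : a ∈ Ψ) (hw : w ∈ layer Ψ a 3) :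
    layer Ψ a 2 = ∅ := by
  rw [eq_empty_iff_forall_notMem]
  intro v hv
  obtain ⟨n, m, hn, hm, e1, e2⟩ := h.exists_nat_nat ha (mem_of_mem_layer hv) (mem_of_mem_layer hw)
  obtain ⟨-, -, h2⟩ := mem_layer.mp hv
  obtain ⟨-, -, h4⟩ := mem_layer.mp hw
  generalize inner ℝ v w = x at *
  generalize inner ℝ a w = β at *
  generalize inner ℝ a v = α at *
  have e0 : (α * β) ^ 2 = 3 / 8 := by
    rw [mul_pow]; linear_combination (1 / 4) * β ^ 2 * h2 + (1 / 8) * h4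
  have e3 : x * (α * β) = (n + 6 - m) / 16 := by linarith
  have e4 : (x * (α * β)) ^ 2 = 3 * n / 32 := by
    rw [mul_pow, e0]; linarith
  rw [e3] at e4
  interval_cases n <;> interval_cases m <;> norm_num at e4

section projection

/-! In this section `p` is the orthogonal projection along `a`. -/

variable {p : E → F} (h : IsUnitRootSet Ψ) (ha : a ∈ Ψ)
  (hp : ∀ v w, inner ℝ (p v) (p w) = inner ℝ v w - inner ℝ a v * inner ℝ a w)
include h ha hp

omit ha in
lemma norm_sq_proj {k : ℝ} (hv : v ∈ layer Ψ a k) : ‖p v‖ ^ 2 = 1 - k / 4 := by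
  obtain ⟨h1, -, h2⟩ := mem_layer.mp hv
  rw [← real_inner_self_eq_norm_sq, hp, real_inner_self_eq_norm_sq, h.norm_eq_one v h1]
  linarith

lemma proj_layer_two (hv : v ∈ layer Ψ a 2) (hw : w ∈ layer Ψ a 2) (hvw : v ≠ w) :
    inner ℝ (p v) (p w) = 0 ∨ inner ℝ (p v) (p w) = -(1 / 2) := by
  rw [hp, inner_mul_inner_of_mem_layer hv hw]
  rcases h.inner_layer_two ha hv hw hvw with e | e <;> rw [e] <;> norm_num

lemma card_layer_two_le [FiniteDimensional ℝ F] : #(layer Ψ a 2) ≤ 2 * finrank ℝ F :=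
  card_le_of_orthogonal_lines _ p one_half_pos
    (fun _ hv ↦ by rw [norm_sq_proj h hp hv]; norm_num)
    fun _ hv _ hw hvw ↦ proj_layer_two h ha hp hv hw hvw

lemma card_layer_three_le : #(layer Ψ a 3) ≤ 2 := by
  obtain h0 | ⟨v, hv⟩ := (layer Ψ a 3).eq_empty_or_nonempty
  · simp [h0]
  have hpp {v w} (hv : v ∈ layer Ψ a 3) (hw : w ∈ layer Ψ a 3) (hvw : v ≠ w) :
      inner ℝ (p v) (p w) = -(1 / 4) := by
    rw [hp, inner_mul_inner_of_mem_layer hv hw, h.inner_layer_three ha hv hw hvw]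
    norm_num
  have hn {v} (hv : v ∈ layer Ψ a 3) : ‖p v‖ ^ 2 = 1 / 4 := by
    rw [norm_sq_proj h hp hv]; norm_num
  have key := sum_inner_sq_le_of_orthogonal_lines (layer Ψ a 3) p (c := 1 / 4) (by norm_num)
    (fun _ hv ↦ hn hv) (fun _ hv _ hw hvw ↦ .inr <| hpp hv hw hvw) (p v)
  rw [hn hv, sum_congr rfl (g := fun _ ↦ 1 / 16), sum_const, nsmul_eq_mul] at key
  · have : (#(layer Ψ a 3) : ℝ) ≤ 2 := by linarith
    exact_mod_cast this
  · intro w hw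
    obtain rfl | hvw := eq_or_ne w v
    · rw [real_inner_self_eq_norm_sq, hn hv]; norm_num
    · rw [hpp hw hv hvw]; norm_num

lemma card_layer_two_le_six (hu : u ∈ layer Ψ a 1) : #(layer Ψ a 2) ≤ 6 := by
  have key := sum_inner_sq_le_of_orthogonal_lines (layer Ψ a 2) p one_half_pos
    (fun _ hv ↦ by rw [norm_sq_proj h hp hv]; norm_num)
    (fun _ hv _ hw hvw ↦ proj_layer_two h ha hp hv hw hvw) (p u)
  rw [norm_sq_proj h hp hu, sum_congr rfl (g := fun _ ↦ 1 / 8), sum_const, nsmul_eq_mul] at key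
  · have : (#(layer Ψ a 2) : ℝ) ≤ 6 := by linarith
    exact_mod_cast this
  · intro v hv
    rw [hp, inner_of_mem_layer_one hu, real_inner_comm]
    rcases h.inner_layer_one_two ha hu hv with e | e <;> rw [e] <;>
      linarith [(mem_layer.mp hv).2.2]

lemma card_layer_one_le_two (hw : w ∈ layer Ψ a 3) : #(layer Ψ a 1) ≤ 2 := by
  classical
  have hmaps : Set.MapsTo (fun v ↦ inner ℝ v w) (layer Ψ a 1 : Set E)
      ({0, inner ℝ a w} : Finset ℝ) := fun v hv ↦ by
    simpa using h.inner_layer_one_three ha hv hw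
  refine (card_le_card_of_injOn _ hmaps fun u hu v hv huv ↦ ?_).trans card_le_two
  have hβ := (mem_layer.mp hw).2.2
  have hline {v} (hv : v ∈ layer Ψ a 1) :
      p v = (4 * (inner ℝ v w - inner ℝ a w / 2)) • p w := by
    have hnv := norm_sq_proj h hp hv
    have hnw := norm_sq_proj h hp hw
    have hvw := hp v w
    rw [inner_of_mem_layer_one hv] at hvw
    rw [← sub_eq_zero, ← norm_eq_zero, ← sq_eq_zero_iff, norm_sub_sq_real, norm_smul, mul_pow,
      real_inner_smul_right, hvw, hnv, hnw, Real.norm_eq_abs, sq_abs]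
    rcases h.inner_layer_one_three ha hv hw with e | e <;> rw [e] <;> linarith
  have hp' : p u = p v := by
    rw [hline hu, hline hv, show inner ℝ u w = inner ℝ v w from huv]
  by_contra hne
  refine h.inner_ne_one (mem_of_mem_layer hu) (mem_of_mem_layer hv) hne ?_
  have := hp u v
  rw [hp', real_inner_self_eq_norm_sq, norm_sq_proj h hp hv,
    inner_mul_inner_of_mem_layer hu hv] at this
  linarith

lemma card_layer_one_le_four_mul [FiniteDimensional ℝ F] (hw : w ∈ layer Ψ a 2) :
    #(layer Ψ a 1) ≤ 4 * finrank ℝ F := by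
  classical
  have hβ := (mem_layer.mp hw).2.2
  have hnw : ‖p w‖ ^ 2 = 1 / 2 := by rw [norm_sq_proj h hp hw]; norm_num
  have half (x : ℝ) (hx : x = 0 ∨ x = inner ℝ a w) :
      #{v ∈ layer Ψ a 1 | inner ℝ v w = x} ≤ 2 * finrank ℝ F := by
    set g : E → F := fun v ↦ p v - (2 * (x - inner ℝ a w / 2)) • p w with hg
    have hgg {u v} (hu : u ∈ layer Ψ a 1) (hu' : inner ℝ u w = x) (hv : v ∈ layer Ψ a 1)
        (hv' : inner ℝ v w = x) : inner ℝ (g u) (g v) = inner ℝ u v - 1 / 2 := by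
      rw [hg, inner_sub_left, inner_sub_right, inner_sub_right, real_inner_smul_left,
        real_inner_smul_right, real_inner_smul_left, real_inner_smul_right,
        real_inner_self_eq_norm_sq, hnw, real_inner_comm (p v) (p w), hp, hp, hp,
        inner_of_mem_layer_one hu, inner_of_mem_layer_one hv, hu', hv']
      rcases hx with e | e <;> rw [e] <;> linarith
    have hgn {v} (hv : v ∈ layer Ψ a 1) (hv' : inner ℝ v w = x) : ‖g v‖ ^ 2 = 1 / 2 := by
      rw [← real_inner_self_eq_norm_sq, hgg hv hv' hv hv', real_inner_self_eq_norm_sq,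
        h.norm_eq_one v (mem_of_mem_layer hv)]
      norm_num
    refine card_le_of_orthogonal_lines _ g one_half_pos
      (fun v hv ↦ hgn (mem_filter.mp hv).1 (mem_filter.mp hv).2) fun u hu v hv huv ↦ ?_
    rw [mem_filter] at hu hv
    have hcs := abs_real_inner_le_norm (g u) (g v)
    have hle : |inner ℝ (g u) (g v)| ≤ 1 / 2 := by
      nlinarith [hgn hu.1 hu.2, hgn hv.1 hv.2, sq_nonneg (‖g u‖ - ‖g v‖)]
    rw [hgg hu.1 hu.2 hv.1 hv.2] at hle ⊢
    rcases h.inner_layer_one ha hu.1 hv.1 huv with e | e | e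
    · rw [e]; norm_num
    · rw [e]; norm_num
    · rw [e] at hle; norm_num [abs_le] at hle
  have hsub : layer Ψ a 1 ⊆
      {v ∈ layer Ψ a 1 | inner ℝ v w = 0} ∪ {v ∈ layer Ψ a 1 | inner ℝ v w = inner ℝ a w} := by
    intro v hv
    simpa [hv] using h.inner_layer_one_two ha hv hw
  have := (card_le_card hsub).trans (card_union_le _ _)
  linarith [half 0 (.inl rfl), half _ (.inr rfl)]

lemma card_layer_one_le [FiniteDimensional ℝ F] :
    #(layer Ψ a 1) ≤ 2 * (2 * finrank ℝ F + 14) := by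
  classical
  obtain h0 | ⟨u, hu⟩ := (layer Ψ a 1).eq_empty_or_nonempty
  · simp [h0]
  set f : E → F := fun v ↦ (2 : ℝ) • p v with hf
  have hff {v w} (hv : v ∈ layer Ψ a 1) (hw : w ∈ layer Ψ a 1) :
      inner ℝ (f v) (f w) = 4 * inner ℝ v w - 1 := by
    rw [hf, real_inner_smul_left, real_inner_smul_right, hp,
      inner_mul_inner_of_mem_layer hv hw]
    ring
  have hfn {v} (hv : v ∈ layer Ψ a 1) : ‖f v‖ ^ 2 = 3 := by
    rw [← real_inner_self_eq_norm_sq, hff hv hv, real_inner_self_eq_norm_sq,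
      h.norm_eq_one v (mem_of_mem_layer hv)]
    norm_num
  have hne {v} (hv : v ∈ layer Ψ a 1) : inner ℝ (f u) (f v) ≠ 0 := by
    obtain rfl | huv := eq_or_ne u v
    · rw [real_inner_self_eq_norm_sq, hfn hv]; norm_num
    · rw [hff hu hv]
      rcases h.inner_layer_one ha hu hv huv with e | e | e <;> rw [e] <;> norm_num
  have half (s : Finset E) (hs : s ⊆ layer Ψ a 1)
      (hsign : ∀ v ∈ s, ∀ w ∈ s, 0 < inner ℝ (f u) (f v) * inner ℝ (f u) (f w)) :
      #s ≤ 2 * finrank ℝ F + 14 := by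
    refine card_le_of_equiangular s f (fun v hv ↦ hfn (hs hv)) fun v hv w hw hvw ↦ ?_
    rw [hff (hs hv) (hs hw)]
    rcases h.inner_layer_one ha (hs hv) (hs hw) hvw with e | e | e
    · rw [e]; norm_num
    · rw [e]; norm_num
    · have hfvw : f w = -f v := by
        rw [eq_neg_iff_add_eq_zero, ← norm_eq_zero, ← sq_eq_zero_iff, norm_add_sq_real,
          hfn (hs hw), hfn (hs hv), real_inner_comm, hff (hs hv) (hs hw), e]
        norm_num
      have := hsign v hv w hw
      rw [hfvw, inner_neg_right] at this
      nlinarith [sq_nonneg (inner ℝ (f u) (f v))]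
  rw [← card_filter_add_card_filter_not (fun v ↦ 0 < inner ℝ (f u) (f v)), two_mul]
  refine add_le_add (half _ (filter_subset _ _) fun v hv w hw ↦ ?_)
    (half _ (filter_subset _ _) fun v hv w hw ↦ ?_) <;> rw [mem_filter] at hv hw
  · exact mul_pos hv.2 hw.2
  · exact mul_pos_of_neg_of_neg ((not_lt.mp hv.2).lt_of_ne (hne hv.1))
      ((not_lt.mp hw.2).lt_of_ne (hne hw.1))

lemma card_layer_add_le [FiniteDimensional ℝ F] :
    #(layer Ψ a 1) + 2 * #(layer Ψ a 2) + 3 * #(layer Ψ a 3) ≤ 4 * finrank ℝ F + 28 := by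
  obtain h3 | ⟨w, hw⟩ := (layer Ψ a 3).eq_empty_or_nonempty
  · obtain h2 | ⟨v, hv⟩ := (layer Ψ a 2).eq_empty_or_nonempty
    · rw [h2, h3, card_empty]
      linarith [card_layer_one_le h ha hp]
    · obtain h1 | ⟨u, hu⟩ := (layer Ψ a 1).eq_empty_or_nonempty
      · rw [h1, h3, card_empty]
        linarith [card_layer_two_le h ha hp]
      · rw [h3, card_empty]
        linarith [card_layer_two_le_six h ha hp hu, card_layer_one_le_four_mul h ha hp hv]
  · rw [h.layer_two_eq_empty ha hw, card_empty]
    linarith [card_layer_one_le_two h ha hp hw, card_layer_three_le h ha hp]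

end projection

lemma exists_projection [FiniteDimensional ℝ E] (hna : ‖a‖ = 1) :
    ∃ p : E → (ℝ ∙ a)ᗮ,
      ∀ v w, inner ℝ (p v) (p w) = inner ℝ v w - inner ℝ a v * inner ℝ a w := by
  refine ⟨fun v ↦ ⟨v - inner ℝ a v • a, ?_⟩, fun v w ↦ ?_⟩
  · rw [Submodule.mem_orthogonal_singleton_iff_inner_right, inner_sub_right,
      real_inner_smul_right, real_inner_self_eq_norm_sq, hna]
    ring
  · simp only [Submodule.coe_inner, inner_sub_left, inner_sub_right, real_inner_smul_left,
      real_inner_smul_right, real_inner_self_eq_norm_sq, hna, real_inner_comm a v]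
    ring

lemma sum_pos_inner_sq_le [FiniteDimensional ℝ E] (h : IsUnitRootSet Ψ) (ha : a ∈ Ψ) :
    ∑ v ∈ Ψ with 0 < inner ℝ a v, inner ℝ a v ^ 2 ≤ finrank ℝ E + 7 := by
  classical
  obtain ⟨p, hp⟩ := exists_projection (h.norm_eq_one a ha)
  have key := card_layer_add_le h ha hp
  have hdim : finrank ℝ (ℝ ∙ a)ᗮ + 1 = finrank ℝ E := by
    have := (ℝ ∙ a).finrank_add_finrank_orthogonal
    rw [finrank_span_singleton (by rintro rfl; simpa using h.norm_eq_one _ ha)] at this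
    lia
  have hsum : ∑ v ∈ Ψ with 0 < inner ℝ a v, 4 * inner ℝ a v ^ 2 ≤
      ∑ v ∈ Ψ, ((if v = a then 4 else 0) + (if v ∈ layer Ψ a 1 then 1 else 0) +
        2 * (if v ∈ layer Ψ a 2 then 1 else 0) + 3 * (if v ∈ layer Ψ a 3 then 1 else 0)) := by
    rw [sum_filter]
    refine sum_le_sum fun v hv ↦ ?_
    have h1 : (0 : ℝ) ≤ if v = a then 4 else 0 := by split_ifs <;> norm_num
    have hk (k : ℝ) : (0 : ℝ) ≤ if v ∈ layer Ψ a k then 1 else 0 := by split_ifs <;> norm_num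
    have h2 := hk 1
    have h3 := hk 2
    have h4 := hk 3
    by_cases hav : 0 < inner ℝ a v
    · rw [if_pos hav]
      obtain ⟨n, hn, e⟩ := h.exists_nat_le ha hv
      have hmem (k : ℝ) (hk : 4 * inner ℝ a v ^ 2 = k) : v ∈ layer Ψ a k :=
        mem_layer.mpr ⟨hv, hav, hk⟩
      rw [e]
      interval_cases n
      · push_cast
        linarith
      · rw [if_pos (hmem 1 (mod_cast e))]
        push_cast
        linarith
      · rw [if_pos (hmem 2 (mod_cast e))]
        push_cast
        linarith
      · rw [if_pos (hmem 3 (mod_cast e))]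
        push_cast
        linarith
      · have : v = a := by
          by_contra hva
          refine h.inner_ne_one ha hv (Ne.symm hva) ?_
          push_cast at e
          nlinarith
        rw [if_pos this]
        push_cast
        linarith
    · rw [if_neg hav]
      linarith
  have hcard (k : ℝ) : ∑ v ∈ Ψ, (if v ∈ layer Ψ a k then (1 : ℝ) else 0) = #(layer Ψ a k) := by
    rw [← sum_filter, sum_const, nsmul_one, filter_mem_eq_inter,
      inter_eq_right.mpr fun v hv ↦ mem_of_mem_layer hv]
  simp only [sum_add_distrib, ← mul_sum, hcard, sum_ite_eq', ha, if_true] at hsum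
  have key' : (#(layer Ψ a 1) + 2 * #(layer Ψ a 2) + 3 * #(layer Ψ a 3) : ℝ) ≤
    4 * finrank ℝ (ℝ ∙ a)ᗮ + 28 := by exact_mod_cast key
  have hdim' : (finrank ℝ (ℝ ∙ a)ᗮ + 1 : ℝ) = finrank ℝ E := by exact_mod_cast hdim
  linarith

lemma sum_inner_sq_le [FiniteDimensional ℝ E] (h : IsUnitRootSet Ψ) (ha : a ∈ Ψ) :
    ∑ v ∈ Ψ, inner ℝ a v ^ 2 ≤ 2 * finrank ℝ E + 14 := by
  have h1 := h.sum_pos_inner_sq_le ha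
  have h2 := h.sum_pos_inner_sq_le (h.neg_mem ha)
  simp only [inner_neg_left, even_two.neg_pow, neg_pos] at h2
  have : ∑ v ∈ Ψ, inner ℝ a v ^ 2 =
      (∑ v ∈ Ψ with 0 < inner ℝ a v, inner ℝ a v ^ 2) +
        ∑ v ∈ Ψ with inner ℝ a v < 0, inner ℝ a v ^ 2 := by
    rw [sum_filter, sum_filter, ← sum_add_distrib]
    refine sum_congr rfl fun v _ ↦ ?_
    rcases lt_trichotomy 0 (inner ℝ a v) with e | e | e
    · simp [e, e.not_gt]
    · simp [← e]
    · simp [e, e.not_gt]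
  linarith

/-- A unit root set in a Euclidean space of dimension `r` has at most `r (2 r + 14)` elements. -/
theorem card_le [FiniteDimensional ℝ E] (h : IsUnitRootSet Ψ) :
    #Ψ ≤ finrank ℝ E * (2 * finrank ℝ E + 14) := by
  have key := card_mul_sq_le_finrank_mul Ψ id (c := 1) (by positivity)
    (fun v hv ↦ by simp [h.norm_eq_one v hv]) fun v hv ↦ h.sum_inner_sq_le hv
  rw [one_pow, mul_one] at key
  exact_mod_cast key

end IsUnitRootSet
end unitRoots

section rootSystem

open Module Finset

/-- A finite reduced crystallographic root system, presented by vectors of a Euclidean space of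
dimension `r`, has at most `r (2 r + 14)` elements. -/
lemma card_le_of_inner_reflection {E ι : Type*} [NormedAddCommGroup E] [InnerProductSpace ℝ E]
    [FiniteDimensional ℝ E] [Fintype ι] (f : ι → E) (hne : ∀ i, f i ≠ 0)
    (hred : ∀ i j, ∀ c : ℝ, 0 < c → f i = c • f j → i = j)
    (href : ∀ i j, ∃ z : ℤ, 2 * inner ℝ (f i) (f j) = z * ‖f i‖ ^ 2 ∧
      ∃ k, f k = f j - (z : ℝ) • f i) :
    Fintype.card ι ≤ finrank ℝ E * (2 * finrank ℝ E + 14) := by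
  classical
  obtain ⟨g, hg⟩ : ∃ g : ι → E, ∀ i, g i = ‖f i‖⁻¹ • f i := ⟨_, fun _ ↦ rfl⟩
  have hpos i : 0 < ‖f i‖ := norm_pos_iff.mpr (hne i)
  have hfg i : f i = ‖f i‖ • g i := by rw [hg, smul_inv_smul₀ (hpos i).ne']
  have hgn i : ‖g i‖ = 1 := by rw [hg, norm_smul, norm_inv, norm_norm, inv_mul_cancel₀ (hpos i).ne']
  have hinner i j : inner ℝ (f i) (f j) = ‖f i‖ * ‖f j‖ * inner ℝ (g i) (g j) := by
    conv_lhs => rw [hfg i, hfg j, real_inner_smul_left, real_inner_smul_right]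
    ring
  have hginj : Function.Injective g := fun i j hij ↦ by
    refine hred i j (‖f i‖ * ‖f j‖⁻¹) (mul_pos (hpos i) (inv_pos.mpr (hpos j))) ?_
    conv_lhs => rw [hfg i, hij, hg]
    rw [smul_smul]
  have hz {i j} {z : ℤ} (h : 2 * inner ℝ (f i) (f j) = z * ‖f i‖ ^ 2) :
      2 * inner ℝ (g i) (g j) * ‖f j‖ = z * ‖f i‖ := by
    rw [hinner] at h
    refine mul_left_cancel₀ (hpos i).ne' ?_
    linear_combination h
  have hΨ : IsUnitRootSet (univ.image g) := by
    refine ⟨?_, ?_, ?_⟩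
    · simpa using hgn
    · simp only [mem_image, mem_univ, true_and, forall_exists_index, forall_apply_eq_imp_iff]
      intro i j
      obtain ⟨z, h1, k, hk⟩ := href i j
      refine ⟨k, ?_⟩
      have hk' : f k = ‖f j‖ • (g j - (2 * inner ℝ (g i) (g j)) • g i) := by
        rw [hk, smul_sub, smul_smul, mul_comm ‖f j‖ (2 * _), hz h1, ← smul_smul, ← hfg, ← hfg]
      have hnorm : ‖g j - (2 * inner ℝ (g i) (g j)) • g i‖ = 1 := by
        rw [← sq_eq_sq₀ (norm_nonneg _) zero_le_one, norm_sub_sq_real, norm_smul, mul_pow, hgn,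
          hgn, real_inner_smul_right, real_inner_comm (g i) (g j), Real.norm_eq_abs, sq_abs]
        ring
      simp only [hg] at hk' hnorm ⊢
      rw [hk', norm_smul, norm_norm, hnorm, mul_one, inv_smul_smul₀ (hpos j).ne']
    · simp only [mem_image, mem_univ, true_and, forall_exists_index, forall_apply_eq_imp_iff]
      intro i j
      obtain ⟨z, h1, -⟩ := href i j
      obtain ⟨w, h2, -⟩ := href j i
      have key : 4 * inner ℝ (g i) (g j) ^ 2 = ((z * w : ℤ) : ℝ) := by
        have e1 := hz h1
        have e2 := hz h2
        rw [real_inner_comm (g i) (g j)] at e2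
        refine mul_right_cancel₀ (mul_pos (hpos i) (hpos j)).ne' ?_
        push_cast
        linear_combination 2 * inner ℝ (g i) (g j) * ‖f i‖ * e1 + z * ‖f i‖ * e2
      have h0 : 0 ≤ z * w := by
        have : (0 : ℝ) ≤ ((z * w : ℤ) : ℝ) := key ▸ by positivity
        exact_mod_cast this
      exact ⟨(z * w).toNat, by rw [key, ← Int.cast_natCast, Int.toNat_of_nonneg h0]⟩
  have := hΨ.card_le
  rwa [card_image_of_injective _ hginj, card_univ] at this

/-- A finite reduced crystallographic complex root system of rank `r` has at most `r (2 r + 14)`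
roots. -/
lemma RootPairing.card_le_of_isReduced {ι M N : Type*} [Fintype ι] [AddCommGroup M] [Module ℂ M]
    [AddCommGroup N] [Module ℂ N] (P : RootPairing ι ℂ M N) [P.IsRootSystem]
    [P.IsCrystallographic] [P.IsReduced] :
    Fintype.card ι ≤ finrank ℂ M * (2 * finrank ℂ M + 14) := by
  let _i : Module ℝ M := .compHom M (algebraMap ℝ ℂ)
  let _i : Module ℝ N := .compHom N (algebraMap ℝ ℂ)
  have _i : IsScalarTower ℝ ℂ M := ⟨fun a b x ↦ by
    rw [Algebra.smul_def, mul_smul]; rfl⟩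
  have _i : IsScalarTower ℝ ℂ N := ⟨fun a b x ↦ by
    rw [Algebra.smul_def, mul_smul]; rfl⟩
  have _i : P.IsValuedIn ℝ := .trans P ℝ ℤ
  set B := (P.posRootForm ℝ).posForm with hB
  have hpos (x : P.rootSpan ℝ) (hx : x ≠ 0) : 0 < B x x :=
    P.posRootForm_posForm_pos_of_ne_zero ℝ hx
  let core : InnerProductSpace.Core ℝ (P.rootSpan ℝ) :=
    { inner := fun x y ↦ B x y
      conj_inner_symm := fun x y ↦ (P.posRootForm ℝ).isSymm_posForm.eq y x
      re_inner_nonneg := fun x ↦ by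
        obtain rfl | hx := eq_or_ne x 0
        · simp
        · exact (hpos x hx).le
      add_left := fun x y z ↦ by simp
      smul_left := fun x y r ↦ by simp
      definite := fun x hx ↦ by
        by_contra h
        exact (hpos x h).ne' hx }
  let _i : NormedAddCommGroup (P.rootSpan ℝ) := core.toNormedAddCommGroup
  let _i : InnerProductSpace ℝ (P.rootSpan ℝ) := .ofCore core.toCore
  have hinner (x y : P.rootSpan ℝ) : inner ℝ x y = B x y := rfl
  rw [← P.finrank_rootSpanIn ℝ]
  refine card_le_of_inner_reflection (P.rootSpanMem ℝ) (fun i h ↦ ?_) (fun i j c hc h ↦ ?_)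
    fun i j ↦ ?_
  · exact P.ne_zero i (congrArg Subtype.val h)
  · have h' : P.root i = (c : ℂ) • P.root j := congrArg Subtype.val h
    have hlin : ¬ LinearIndependent ℂ ![P.root i, P.root j] := by
      intro hl
      have := LinearIndependent.pair_iff.mp hl 1 (-c) (by rw [h']; module)
      simp at this
    rcases IsReduced.eq_or_eq_neg i j hlin with e | e
    · exact P.root.injective e
    · have : ((c : ℂ) + 1) • P.root j = 0 := by rw [add_smul, ← h', e]; module
      rcases smul_eq_zero.mp this with e | e
      · have : c + 1 = 0 := by exact_mod_cast e
        linarith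
      · exact absurd e (P.ne_zero j)
  · refine ⟨P.pairingIn ℤ j i, ?_, P.reflectionPerm i j, ?_⟩
    · rw [← real_inner_self_eq_norm_sq, hinner, hinner]
      apply Complex.ofReal_injective
      have := (P.posRootForm ℝ).two_mul_apply_root_root j i
      rw [← P.algebraMap_pairingIn ℤ, ← (P.posRootForm ℝ).symm.eq] at this
      have e (k l : ι) : ((B (P.rootSpanMem ℝ k) (P.rootSpanMem ℝ l) : ℝ) : ℂ) =
          (P.posRootForm ℝ).form (P.root k) (P.root l) :=
        (P.posRootForm ℝ).algebraMap_posForm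
      push_cast
      rw [e, e]
      simpa using this
    · ext
      have h := P.reflection_apply_root' ℤ (i := i) (j := j)
      rw [← P.root_reflectionPerm] at h
      change P.root _ = P.root j - ((P.pairingIn ℤ j i : ℝ) : ℂ) • P.root i
      rw [h, Complex.ofReal_intCast, Int.cast_smul_eq_zsmul]

end rootSystem

section lie

open Module LieAlgebra TensorProduct

lemma Submodule.finrank_biSup_le {ι K V : Type*} [Field K] [AddCommGroup V] [Module K V]
    [FiniteDimensional K V] (s : Finset ι) (p : ι → Submodule K V) :
    finrank K (⨆ i ∈ s, p i : Submodule K V) ≤ ∑ i ∈ s, finrank K (p i) := by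
  classical
  induction s using Finset.induction_on with
  | empty => simp
  | insert a s ha ih =>
    rw [Finset.iSup_insert, Finset.sum_insert ha]
    exact (Submodule.finrank_add_le_finrank_add_finrank _ _).trans (by gcongr)

/-- The dimension of a Killing Lie algebra is at most the rank plus the number of roots. -/
lemma LieAlgebra.IsKilling.finrank_le_finrank_add_card_root {K L : Type*} [Field K] [CharZero K]
    [LieRing L] [LieAlgebra K L] [FiniteDimensional K L] [IsKilling K L] (H : LieSubalgebra K L)
    [H.IsCartanSubalgebra] [LieModule.IsTriangularizable K H L] :
    finrank K L ≤ finrank K H + H.root.card := by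
  have htop : (⊤ : Submodule K L) ≤
      H.toSubmodule ⊔ ⨆ α ∈ H.root, (rootSpace H α).toSubmodule := by
    rw [← LieSubmodule.top_toSubmodule (R := K) (L := H),
      ← LieModule.iSup_genWeightSpace_eq_top' K H L, LieSubmodule.iSup_toSubmodule, iSup_le_iff]
    intro α
    by_cases hα : α.IsZero
    · have h0 : (rootSpace H α).toSubmodule = H.toSubmodule := by
        rw [show (α : H → K) = 0 from hα]
        exact congrArg LieSubmodule.toSubmodule (rootSpace_zero_eq K L H)
      exact le_sup_of_le_left h0.le
    · exact le_sup_of_le_right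
        (le_iSup₂_of_le (f := fun (α : LieModule.Weight K H L) (_ : α ∈ H.root) ↦
          (rootSpace H α).toSubmodule) α (by simpa using hα) le_rfl)
  have hsum : ∑ α ∈ H.root, finrank K (rootSpace H α).toSubmodule = H.root.card := by
    rw [Finset.card_eq_sum_ones]
    exact Finset.sum_congr rfl fun α hα ↦ finrank_rootSpace_eq_one α (by simpa using hα)
  calc finrank K L = finrank K (⊤ : Submodule K L) := finrank_top K L |>.symm
    _ ≤ _ := Submodule.finrank_mono htop
    _ ≤ _ := Submodule.finrank_add_le_finrank_add_finrank _ _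
    _ ≤ _ := by
      rw [← hsum]
      exact Nat.add_le_add le_rfl (Submodule.finrank_biSup_le _ _)

/-- A complex Killing Lie algebra of rank `r` has dimension at most `r (2 r + 15)`. -/
lemma LieAlgebra.IsKilling.finrank_le_of_isCartanSubalgebra {L : Type*} [LieRing L]
    [LieAlgebra ℂ L] [FiniteDimensional ℂ L] [IsKilling ℂ L] (H : LieSubalgebra ℂ L)
    [H.IsCartanSubalgebra] :
    finrank ℂ L ≤ finrank ℂ H * (2 * finrank ℂ H + 15) := by
  have h1 := finrank_le_finrank_add_card_root H
  have h2 := (rootSystem H).card_le_of_isReduced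
  rw [Fintype.card_coe, Subspace.dual_finrank_eq] at h2
  linarith

variable {L : Type*} [LieRing L] [LieAlgebra ℝ L]

lemma exists_eq_one_tmul_add_I_tmul (z : ℂ ⊗[ℝ] L) :
    ∃ a b : L, z = 1 ⊗ₜ a + Complex.I ⊗ₜ b := by
  induction z with
  | zero => exact ⟨0, 0, by simp⟩
  | tmul c l =>
    refine ⟨c.re • l, c.im • l, ?_⟩
    rw [← smul_tmul, ← smul_tmul, ← add_tmul]
    congr 1
    apply Complex.ext <;> simp
  | add x y hx hy =>
    obtain ⟨a, b, rfl⟩ := hx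
    obtain ⟨c, d, rfl⟩ := hy
    exact ⟨a + c, b + d, by rw [tmul_add, tmul_add]; abel⟩

lemma eq_zero_of_one_tmul_add_I_tmul_eq_zero {a b : L}
    (h : (1 ⊗ₜ a + Complex.I ⊗ₜ b : ℂ ⊗[ℝ] L) = 0) : a = 0 ∧ b = 0 := by
  have h1 := congrArg (TensorProduct.lid ℝ L ∘ LinearMap.rTensor L Complex.reLm) h
  have h2 := congrArg (TensorProduct.lid ℝ L ∘ LinearMap.rTensor L Complex.imLm) h
  exact ⟨by simpa using h1, by simpa using h2⟩

instance LieAlgebra.IsKilling.complexification [FiniteDimensional ℝ L] [IsKilling ℝ L] :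
    IsKilling ℂ (ℂ ⊗[ℝ] L) where
  killingCompl_top_eq_bot := by
    rw [eq_bot_iff]
    intro z hz
    rw [LieIdeal.mem_killingCompl] at hz
    obtain ⟨a, b, rfl⟩ := exists_eq_one_tmul_add_I_tmul z
    have key (c : L) : killingForm ℝ L c a = 0 ∧ killingForm ℝ L c b = 0 := by
      have := hz (1 ⊗ₜ c) trivial
      rw [killingForm, LieModule.traceForm_baseChange, map_add, LinearMap.BilinForm.baseChange_tmul,
        LinearMap.BilinForm.baseChange_tmul] at this
      have h1 := congrArg Complex.re this
      have h2 := congrArg Complex.im this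
      exact ⟨by simpa using h1, by simpa using h2⟩
    have hn := (killingForm_nondegenerate ℝ L).2
    rw [hn a fun c ↦ (key c).1, hn b fun c ↦ (key c).2]
    simp

lemma LieSubalgebra.exists_of_mem_engel_one_tmul {x : L} {z : ℂ ⊗[ℝ] L}
    (hz : z ∈ LieSubalgebra.engel ℂ (1 ⊗ₜ[ℝ] x : ℂ ⊗[ℝ] L)) :
    ∃ a ∈ LieSubalgebra.engel ℝ x, ∃ b ∈ LieSubalgebra.engel ℝ x,
      z = 1 ⊗ₜ a + Complex.I ⊗ₜ b := by
  obtain ⟨a, b, rfl⟩ := exists_eq_one_tmul_add_I_tmul z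
  rw [mem_engel_iff] at hz
  obtain ⟨n, hn⟩ := hz
  have had : ad ℂ (ℂ ⊗[ℝ] L) (1 ⊗ₜ x) = (ad ℝ L x).baseChange ℂ :=
    LieModule.toEnd_baseChange ..
  rw [had, ← LinearMap.baseChange_pow, map_add, LinearMap.baseChange_tmul,
    LinearMap.baseChange_tmul] at hn
  obtain ⟨h1, h2⟩ := eq_zero_of_one_tmul_add_I_tmul_eq_zero hn
  exact ⟨a, (mem_engel_iff ..).mpr ⟨n, h1⟩, b, (mem_engel_iff ..).mpr ⟨n, h2⟩, rfl⟩

lemma LieSubalgebra.finrank_engel_one_tmul_le [FiniteDimensional ℝ L] (x : L) :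
    finrank ℂ (LieSubalgebra.engel ℂ (1 ⊗ₜ[ℝ] x : ℂ ⊗[ℝ] L)) ≤
      finrank ℝ (LieSubalgebra.engel ℝ x) := by
  have hle : (engel ℂ (1 ⊗ₜ[ℝ] x : ℂ ⊗[ℝ] L)).toSubmodule ≤
      (engel ℝ x).toSubmodule.baseChange ℂ := fun z hz ↦ by
    obtain ⟨a, ha, b, hb, rfl⟩ := exists_of_mem_engel_one_tmul hz
    exact add_mem (Submodule.tmul_mem_baseChange_of_mem _ ha)
      (Submodule.tmul_mem_baseChange_of_mem _ hb)
  calc _ ≤ finrank ℂ ((engel ℝ x).toSubmodule.baseChange ℂ) := Submodule.finrank_mono hle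
    _ ≤ finrank ℂ (ℂ ⊗[ℝ] (engel ℝ x).toSubmodule) :=
      LinearMap.finrank_le_finrank_of_surjective (Submodule.toBaseChange_surjective ℂ _)
    _ = _ := finrank_baseChange

lemma LieSubalgebra.isCartanSubalgebra_engel_one_tmul (x : L)
    [IsLieAbelian (LieSubalgebra.engel ℝ x)] :
    (LieSubalgebra.engel ℂ (1 ⊗ₜ[ℝ] x : ℂ ⊗[ℝ] L)).IsCartanSubalgebra := by
  have hab {a b : L} (ha : a ∈ engel ℝ x) (hb : b ∈ engel ℝ x) : ⁅a, b⁆ = 0 :=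
    congrArg Subtype.val (trivial_lie_zero (engel ℝ x) (engel ℝ x) ⟨a, ha⟩ ⟨b, hb⟩)
  have : IsLieAbelian (engel ℂ (1 ⊗ₜ[ℝ] x : ℂ ⊗[ℝ] L)) := by
    refine ⟨fun y z ↦ Subtype.ext ?_⟩
    obtain ⟨a, ha, b, hb, hy⟩ := exists_of_mem_engel_one_tmul y.2
    obtain ⟨c, hc, d, hd, hz⟩ := exists_of_mem_engel_one_tmul z.2
    rw [LieSubalgebra.coe_bracket, hy, hz]
    simp [hab ha hc, hab ha hd, hab hb hc, hab hb hd]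
  exact ⟨inferInstance, normalizer_engel ℂ _⟩

/-- A real Killing Lie algebra whose abelian subalgebras have dimension at most `n` has dimension
at most `n (2 n + 15)`. -/
lemma LieAlgebra.IsKilling.finrank_le_of_forall_isLieAbelian [FiniteDimensional ℝ L]
    [IsKilling ℝ L] {n : ℕ} (hA : ∀ H : LieSubalgebra ℝ L, IsLieAbelian H → finrank ℝ H ≤ n) :
    finrank ℝ L ≤ n * (2 * n + 15) := by
  obtain ⟨x, hx⟩ := exists_isCartanSubalgebra_engel ℝ L
  have _i : IsLieAbelian (LieSubalgebra.engel ℝ x) := inferInstance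
  have _i := LieSubalgebra.isCartanSubalgebra_engel_one_tmul x
  have hr := (LieSubalgebra.finrank_engel_one_tmul_le x).trans (hA _ inferInstance)
  rw [← finrank_baseChange (R := ℂ) (S := ℝ) (M' := L)]
  exact (finrank_le_of_isCartanSubalgebra _).trans (by gcongr)

end lie

/-- If `𝔤` is a finite-dimensional simple real Lie algebra in which every abelian Lie
subalgebra has dimension at most `n`, then `dim 𝔤 ≤ 2n² + 15n`. -/
theorem dim_le_of_simple_real_lie_algebra
    (L : Type*) [LieRing L] [LieAlgebra ℝ L]
    [FiniteDimensional ℝ L] [LieAlgebra.IsSimple ℝ L] (n : ℕ)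
    (hA : ∀ H : LieSubalgebra ℝ L, IsLieAbelian H → Module.finrank ℝ H ≤ n) :
    Module.finrank ℝ L ≤ 2 * n ^ 2 + 15 * n := by
  have := LieAlgebra.IsKilling.finrank_le_of_forall_isLieAbelian hA
  linarith
end
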